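/- The only rational solutions (X, Y) ∈ ℚ × ℚ of the equation Y² = 5X⁵ − 5·3⁶ (that is, Y² = 5X⁵ − 3645) are (X, Y) = (9, 540) and (X, Y) = (9, −540). -/

import Mathlib

namespace RP
open Polynomial NumberField

theorem g_irred : Irreducible (X ^ 5 - C 3 : ℚ[X]) := by
  apply X_pow_sub_C_irreducible_of_prime (by norm_num)
  intro b hb
  have h1 : padicValRat 3 (b ^ 5) = padicValRat 3 3 := by rw [hb]
  have hb0 : b ≠ 0 := by rintro rfl; norm_num at hb
  have : Fact (Nat.Prime 3) := ⟨by norm_num⟩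
  rw [padicValRat.pow] at h1
  have : padicValRat 3 (3:ℚ) = 1 := by
    have := padicValRat.self (p := 3) (by norm_num)
    exact_mod_cast this
  rw [this] at h1
  omega

theorem g_monic : (X ^ 5 - C 3 : ℚ[X]).Monic := monic_X_pow_sub_C _ (by norm_num)
theorem g_ne : (X ^ 5 - C 3 : ℚ[X]) ≠ 0 := g_monic.ne_zero
theorem g_deg : (X ^ 5 - C 3 : ℚ[X]).natDegree = 5 := natDegree_X_pow_sub_C

theorem exK : ∃ (K : Type) (_ : Field K) (_ : NumberField K) (b : K),
    b ^ 5 = 3 ∧ Module.finrank ℚ K = 5 := by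
  let θ : ℝ := (3:ℝ)^((1:ℝ)/5)
  have hθ : θ ^ 5 = 3 := by
    simp only [θ]
    rw [← Real.rpow_natCast, ← Real.rpow_mul (by norm_num)]; norm_num
  have h0 : aeval θ (X ^ 5 - C 3 : ℚ[X]) = 0 := by simp [hθ]
  have hi : IsIntegral ℚ θ := ⟨_, g_monic, h0⟩
  have hm := minpoly.eq_of_irreducible_of_monic g_irred h0 g_monic
  have : FiniteDimensional ℚ (IntermediateField.adjoin ℚ {θ}) :=
    IntermediateField.adjoin.finiteDimensional hi
  refine ⟨IntermediateField.adjoin ℚ {θ}, inferInstance, {to_finiteDimensional := this}, 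
    IntermediateField.AdjoinSimple.gen ℚ θ, ?_, ?_⟩
  · apply Subtype.ext
    push_cast
    rw [IntermediateField.AdjoinSimple.coe_gen]
    exact hθ
  · have := IntermediateField.adjoin.finrank hi
    rw [← hm, g_deg] at this
    exact this

def K : Type := exK.choose
noncomputable instance : Field K := exK.choose_spec.choose
instance : NumberField K := exK.choose_spec.choose_spec.choose
noncomputable def β : K := exK.choose_spec.choose_spec.choose_spec.choose
theorem β5 : β ^ 5 = 3 := exK.choose_spec.choose_spec.choose_spec.choose_spec.1
theorem finrankK : Module.finrank ℚ K = 5 := exK.choose_spec.choose_spec.choose_spec.choose_spec.2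

theorem β_aeval : aeval β (X ^ 5 - C 3 : ℚ[X]) = 0 := by simp [β5]

theorem minpolyβ : minpoly ℚ β = X ^ 5 - C 3 :=
  (minpoly.eq_of_irreducible_of_monic g_irred β_aeval g_monic).symm

theorem linind : LinearIndependent ℚ (fun i : Fin 5 => β ^ (i : ℕ)) := by
  have h := linearIndependent_pow (K := ℚ) β
  have h5 : (minpoly ℚ β).natDegree = 5 := by rw [minpolyβ, g_deg]
  rw [← linearIndependent_equiv (finCongr h5)]
  exact h

/-- basis -/
noncomputable def bas : Module.Basis (Fin 5) ℚ K :=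
  basisOfLinearIndependentOfCardEqFinrank linind (by simp [finrankK])

theorem bas_apply (i : Fin 5) : bas i = β ^ (i : ℕ) := by
  simp [bas]

noncomputable def ev (q : Fin 5 → ℚ) : K := ∑ i, (q i : K) * β ^ (i : ℕ)

theorem ev_eq (q : Fin 5 → ℚ) : ev q = bas.equivFun.symm q := by
  rw [Module.Basis.equivFun_symm_apply, ev]
  refine Finset.sum_congr rfl fun i _ => ?_
  rw [bas_apply, Algebra.smul_def]; rfl

theorem ev_inj {q r : Fin 5 → ℚ} (h : ev q = ev r) : q = r := by
  rw [ev_eq, ev_eq] at h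
  exact bas.equivFun.symm.injective h

theorem ev_surj (x : K) : ∃ q, ev q = x := ⟨bas.equivFun x, by rw [ev_eq]; simp⟩

theorem ev_def (a b c d e : ℚ) : ev ![a, b, c, d, e] =
    (a : K) + b * β + c * β ^ 2 + d * β ^ 3 + e * β ^ 4 := by
  simp [ev, Fin.sum_univ_succ]; ring

/-- norm form -/
def nf (a b c d e : ℚ) : ℚ := (!![a, 3*e, 3*d, 3*c, 3*b; b, a, 3*e, 3*d, 3*c; c, b, a, 3*e, 3*d;
   d, c, b, a, 3*e; e, d, c, b, a]).det

theorem lmm (a b c d e : ℚ) : Algebra.leftMulMatrix bas (ev ![a, b, c, d, e]) =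
   !![a, 3*e, 3*d, 3*c, 3*b; b, a, 3*e, 3*d, 3*c; c, b, a, 3*e, 3*d;
   d, c, b, a, 3*e; e, d, c, b, a] := by
  have key : ∀ j : Fin 5, bas.repr (ev ![a,b,c,d,e] * β ^ (j:ℕ)) = 
     (![![a,b,c,d,e], ![3*e,a,b,c,d], ![3*d,3*e,a,b,c], ![3*c,3*d,3*e,a,b], ![3*b,3*c,3*d,3*e,a]] : Fin 5 → Fin 5 → ℚ) j := by
    intro j
    have : ev ![a,b,c,d,e] * β ^ (j:ℕ) = ev ((![![a,b,c,d,e], ![3*e,a,b,c,d], ![3*d,3*e,a,b,c], ![3*c,3*d,3*e,a,b], ![3*b,3*c,3*d,3*e,a]] : Fin 5 → Fin 5 → ℚ) j) := by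
      have h5 := β5
      fin_cases j
      · simp
      · simp [ev_def]; linear_combination (e : K) * h5
      · simp [ev_def]; linear_combination ((e : K) * β + d) * h5
      · simp [ev_def]; linear_combination ((e : K) * β^2 + d * β + c) * h5
      · simp [ev_def]; linear_combination ((e : K) * β^3 + d * β^2 + c * β + b) * h5
    rw [this, ev_eq]
    rw [← Module.Basis.equivFun_apply, LinearEquiv.apply_symm_apply]
  ext i j
  rw [Algebra.leftMulMatrix_eq_repr_mul, bas_apply, key]
  fin_cases i <;> fin_cases j <;> simp

theorem norm_ev (a b c d e : ℚ) : Algebra.norm ℚ (ev ![a, b, c, d, e]) = nf a b c d e := by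
  rw [Algebra.norm_eq_matrix_det bas, nf, lmm]

theorem trace_ev (a b c d e : ℚ) : Algebra.trace ℚ K (ev ![a, b, c, d, e]) = 5 * a := by
  rw [Algebra.trace_eq_matrix_trace bas, lmm]
  simp [Matrix.trace, Fin.sum_univ_succ]; ring

end RP


namespace RP
open Polynomial NumberField

theorem β_int : IsIntegral ℤ β := ⟨X ^ 5 - C 3, monic_X_pow_sub_C _ (by norm_num), by simp [β5]⟩

noncomputable def b₀ : 𝓞 K := ⟨β, β_int⟩

theorem coe_b₀ : (algebraMap (𝓞 K) K b₀) = β := rfl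

theorem b₀5 : b₀ ^ 5 = 3 := by
  apply RingOfIntegers.coe_injective
  rw [map_pow, coe_b₀, β5]; rfl

theorem discr_bas : Algebra.discr ℚ bas = 253125 := by
  rw [Algebra.discr_def]
  have h : Algebra.traceMatrix ℚ bas = !![5,0,0,0,0; 0,0,0,0,15; 0,0,0,15,0; 0,0,15,0,0; 0,15,0,0,0] := by
    have t : ∀ k : ℕ, k < 5 → ∀ j : ℕ, Algebra.trace ℚ K (β ^ (5 * j + k)) = if k = 0 then 5 * 3 ^ j else 0 := by
      intro k hk j
      have : β ^ (5 * j + k) = ev ((fun i => if (i:ℕ) = k then 3 ^ j else 0)) := by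
        rw [pow_add, pow_mul, β5]
        interval_cases k <;> simp [ev, Fin.sum_univ_succ]
      rw [this]
      have e5 : (fun i : Fin 5 => if (i:ℕ) = k then (3:ℚ) ^ j else 0) = 
        ![if k = 0 then 3 ^ j else 0, if k = 1 then 3 ^ j else 0, if k = 2 then 3 ^ j else 0, if k = 3 then 3 ^ j else 0, if k = 4 then 3 ^ j else 0] := by
        ext i; fin_cases i <;> simp [eq_comm]
      rw [e5, trace_ev]
      split_ifs <;> simp
    ext i j
    rw [Algebra.traceMatrix_apply, Algebra.traceForm_apply, bas_apply, bas_apply, ← pow_add]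
    have e0 : ((i:ℕ) + (j:ℕ)) = 5 * (((i:ℕ) + (j:ℕ)) / 5) + ((i:ℕ) + (j:ℕ)) % 5 := by omega
    rw [e0, t _ (Nat.mod_lt _ (by norm_num))]
    fin_cases i <;> fin_cases j <;> simp <;> norm_num
  rw [h]
  simp [Matrix.det_succ_row_zero, Fin.sum_univ_succ]
  norm_num [Fin.succAbove]
  decide +kernel

theorem discr_le : |discr K| ≤ 253125 := by
  classical
  have hc : Fintype.card (Module.Free.ChooseBasisIndex ℤ (𝓞 K)) = Fintype.card (Fin 5) := by
    have := Module.finrank_eq_card_basis (integralBasis K)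
    rw [finrankK] at this; simp [← this]
  let e := Fintype.equivOfCardEq hc
  let ib := (integralBasis K).reindex e
  have h1 : Algebra.discr ℚ ib = discr K := by
    rw [coe_discr]
    simp only [ib, Module.Basis.coe_reindex]
    rw [Algebra.discr_reindex]
  have hint : ∀ i j, IsIntegral ℤ (ib.toMatrix bas i j) := by
    intro i j
    rw [Module.Basis.toMatrix_apply, bas_apply]
    have : β ^ (j:ℕ) = algebraMap (𝓞 K) K (b₀ ^ (j:ℕ)) := by rw [map_pow, coe_b₀]
    rw [this]
    simp only [ib, Module.Basis.repr_reindex_apply]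
    rw [integralBasis_repr_apply]
    exact isIntegral_algebraMap
  have hdet : IsIntegral ℤ (ib.toMatrix bas).det := IsIntegral.det fun i j => hint i j
  obtain ⟨r, hr⟩ := IsIntegrallyClosed.isIntegral_iff.1 hdet
  have h2 : Algebra.discr ℚ bas = (ib.toMatrix bas).det ^ 2 * Algebra.discr ℚ ib := by
    rw [← Algebra.discr_of_matrix_vecMul, Module.Basis.toMatrix_map_vecMul]
  rw [discr_bas, h1, ← hr] at h2
  have h3 : (253125 : ℤ) = r ^ 2 * discr K := by
    have : ((253125 : ℤ) : ℚ) = ((r ^ 2 * discr K : ℤ) : ℚ) := by push_cast; simpa using h2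
    exact_mod_cast this
  have hr0 : r ≠ 0 := by rintro rfl; norm_num at h3
  have : 0 < r ^ 2 := by positivity
  have : |(253125:ℤ)| = r ^ 2 * |discr K| := by
    rw [h3, abs_mul, abs_of_nonneg (by positivity : 0 ≤ r^2)]
  norm_num at this
  nlinarith [abs_nonneg (discr K)]

open InfinitePlace in
theorem r2_le : nrComplexPlaces K ≤ 2 := by
  have := card_add_two_mul_card_eq_rank K
  rw [finrankK] at this
  omega

open InfinitePlace in
theorem mink : (4 / Real.pi) ^ nrComplexPlaces K *
    ((Module.finrank ℚ K).factorial / (Module.finrank ℚ K) ^ (Module.finrank ℚ K) * Real.sqrt |discr K|) < 32 := by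
  rw [finrankK]
  have hs : Real.sqrt |discr K| ≤ 503.2 := by
    rw [Real.sqrt_le_left (by norm_num)]
    have := discr_le
    have : ((|discr K| : ℤ) : ℝ) ≤ 253125 := by exact_mod_cast this
    push_cast at this
    linarith
  have hp := Real.pi_gt_d4
  have h4 : 4 / Real.pi ≤ 1.2733 := by
    rw [div_le_iff₀ (by linarith)]; linarith
  have h5 : 1 ≤ 4 / Real.pi := by
    rw [le_div_iff₀ (by linarith)]; linarith [Real.pi_le_four]
  have h6 : (4 / Real.pi) ^ nrComplexPlaces K ≤ 1.2733 ^ 2 :=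
    (pow_le_pow_right₀ h5 r2_le).trans (by gcongr)
  have h7 : ((Nat.factorial 5 : ℕ) : ℝ) / ((5:ℕ):ℝ) ^ 5 * Real.sqrt |discr K| ≤ 0.0384 * 503.2 := by
    norm_num [Nat.factorial]
    linarith
  calc _ ≤ (1.2733 ^ 2 : ℝ) * (0.0384 * 503.2) := by gcongr
    _ < 32 := by norm_num

end RP


namespace RP
open Polynomial NumberField

noncomputable def eZ (a b c d e : ℤ) : 𝓞 K := a + b * b₀ + c * b₀ ^ 2 + d * b₀ ^ 3 + e * b₀ ^ 4

theorem eZ_coe (a b c d e : ℤ) : (algebraMap (𝓞 K) K (eZ a b c d e)) = ev ![(a:ℚ), b, c, d, e] := by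
  rw [ev_def]; simp [eZ, coe_b₀]

theorem eZ_norm {a b c d e z : ℤ} (h : nf a b c d e = z) : Algebra.norm ℤ (eZ a b c d e) = z := by
  have := Algebra.coe_norm_int (eZ a b c d e)
  rw [show ((eZ a b c d e : 𝓞 K) : K) = ev ![(a:ℚ), b, c, d, e] from eZ_coe a b c d e, norm_ev, h] at this
  exact_mod_cast this

theorem prin_of_mem {P : Ideal (𝓞 K)} (hP : P.IsPrime) {π : 𝓞 K} (hm : π ∈ P)
    (hp : (Algebra.norm ℤ π).natAbs.Prime) : Submodule.IsPrincipal P := by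
  have h1 : (Ideal.span {π}).IsPrime := by
    apply Ideal.isPrime_of_irreducible_absNorm
    rw [Ideal.absNorm_span_singleton]; exact hp
  have h0 : Ideal.span {π} ≠ ⊥ := by
    intro h
    rw [Ideal.span_singleton_eq_bot] at h
    subst h
    rw [Algebra.norm_zero] at hp
    exact absurd hp (by norm_num)
  have := (h1.isMaximal h0).eq_of_le hP.ne_top ((Ideal.span_singleton_le_iff_mem _).2 hm)
  exact ⟨⟨π, by rw [← this]⟩⟩

theorem prin_eZ {P : Ideal (𝓞 K)} (hP : P.IsPrime) (a b c d e z : ℤ) (hm : eZ a b c d e ∈ P)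
    (h : nf a b c d e = z) (hz : z.natAbs.Prime) : Submodule.IsPrincipal P :=
  prin_of_mem hP hm (by rwa [eZ_norm h])

theorem nf_exp (a b c d e : ℚ) : nf a b c d e = (!![a, 3*e, 3*d, 3*c, 3*b; b, a, 3*e, 3*d, 3*c; c, b, a, 3*e, 3*d;
  d, c, b, a, 3*e; e, d, c, b, a] : Matrix _ _ ℚ).det := rfl

theorem n_five : nf 2 0 0 (-1) 0 = 5 := by decide +kernel

theorem deg1 {P : Ideal (𝓞 K)} (hP : P.IsPrime) {p : ℕ} (hp : p.Prime) (hn : Ideal.absNorm P = p) :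
    ∃ e : ℕ, e < p ∧ b₀ - e ∈ P ∧ p ∣ e ^ 5 + (p - 3 % p) := by
  have hpP : (p : 𝓞 K) ∈ P := by rw [← hn]; exact Ideal.absNorm_mem P
  have hcard : Nat.card (𝓞 K ⧸ P) = p := by
    rw [← hn]; rfl
  haveI : Finite (𝓞 K ⧸ P) := Nat.finite_of_card_ne_zero (by rw [hcard]; exact hp.ne_zero)
  haveI : Fintype (𝓞 K ⧸ P) := Fintype.ofFinite _
  let φ := ZMod.ringEquivOfPrime (𝓞 K ⧸ P) hp (by rw [← Nat.card_eq_fintype_card, hcard])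
  haveI : NeZero p := ⟨hp.ne_zero⟩
  let e := (φ.symm (Ideal.Quotient.mk P b₀)).val
  have he : Ideal.Quotient.mk P b₀ = (e : 𝓞 K ⧸ P) := by
    have : ((e : ℕ) : ZMod p) = φ.symm (Ideal.Quotient.mk P b₀) := ZMod.natCast_zmod_val _
    rw [← map_natCast φ, this]; simp
  refine ⟨e, ZMod.val_lt _, ?_, ?_⟩
  · rw [← Ideal.Quotient.eq, map_natCast]; exact he
  · have h5 : (Ideal.Quotient.mk P b₀) ^ 5 = 3 := by rw [← map_pow, b₀5]; rfl
    rw [he] at h5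
    have h6 : ((e:ZMod p)) ^ 5 = 3 := by
      apply φ.injective; rw [map_pow, map_natCast, h5]; exact (map_ofNat φ 3).symm
    rw [← ZMod.natCast_eq_zero_iff]
    push_cast [Nat.cast_sub (Nat.mod_lt 3 hp.pos).le]
    rw [h6]
    simp

theorem mem_of_deg1 {P : Ideal (𝓞 K)} {p : ℕ} (hpP : (p : 𝓞 K) ∈ P) {e : ℕ} (he : b₀ - e ∈ P)
    (a b c d f : ℤ) (h : (p:ℤ) ∣ a + b * e + c * e ^ 2 + d * e ^ 3 + f * e ^ 4) : eZ a b c d f ∈ P := by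
  obtain ⟨k, hk⟩ := h
  have h1 : Ideal.Quotient.mk P b₀ = (e : 𝓞 K ⧸ P) := by
    rw [← map_natCast (Ideal.Quotient.mk P), Ideal.Quotient.eq]; exact he
  rw [← Ideal.Quotient.eq_zero_iff_mem] at hpP ⊢
  simp only [eZ, map_add, map_mul, map_pow, h1, map_intCast]
  have := congrArg (Int.cast : ℤ → 𝓞 K ⧸ P) hk
  push_cast at this
  rw [map_natCast] at hpP
  rw [this, hpP, zero_mul]

theorem prin_small {P : Ideal (𝓞 K)} (hP : P.IsPrime) (h0 : P ≠ ⊥) (hn : Ideal.absNorm P ≤ 31) :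
    Submodule.IsPrincipal P := by
  have hmax := hP.isMaximal h0
  have hn0 : Ideal.absNorm P ≠ 0 := by rwa [Ne, Ideal.absNorm_eq_zero_iff]
  have hcard : Nat.card (𝓞 K ⧸ P) = Ideal.absNorm P := rfl
  haveI : Finite (𝓞 K ⧸ P) := Nat.finite_of_card_ne_zero (by rwa [hcard])
  haveI : Fintype (𝓞 K ⧸ P) := Fintype.ofFinite _
  letI : Field (𝓞 K ⧸ P) := Ideal.Quotient.field P
  have hpp := FiniteField.isPrimePow_card (𝓞 K ⧸ P)
  rw [← Nat.card_eq_fintype_card, hcard] at hpp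
  obtain ⟨p, k, hp, hk, hpk⟩ := hpp
  replace hp := hp.nat_prime
  have hpP : (p : 𝓞 K) ∈ P := by
    have := Ideal.absNorm_mem P
    rw [← hpk, Nat.cast_pow] at this
    exact hP.mem_of_pow_mem _ this
  have hple : p ≤ 31 := le_trans (Nat.le_self_pow hk.ne' p) (by rw [hpk]; exact hn)
  rcases lt_or_ge p 7 with h7 | h7
  · have : p = 2 ∨ p = 3 ∨ p = 5 := by
      interval_cases p <;> first | omega | (exfalso; revert hp; norm_num)
    rcases this with rfl | rfl | rfl
    · have h2 : eZ (-1) 1 0 0 0 * eZ 1 1 1 1 1 ∈ P := by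
        have : eZ (-1) 1 0 0 0 * eZ 1 1 1 1 1 = (2:ℕ) := by
          simp only [eZ]; push_cast; linear_combination b₀5
        rw [this]; exact hpP
      rcases hP.mem_or_mem h2 with h | h
      · exact prin_eZ hP _ _ _ _ _ 2 h (by decide +kernel) (by norm_num)
      · have hk4 : k ≤ 4 := by
          by_contra hc
          have : 2 ^ 5 ≤ 2 ^ k := Nat.pow_le_pow_right (by norm_num) (by omega)
          omega
        by_cases h4 : k = 4
        · subst h4
          have hle : Ideal.span {eZ 1 1 1 1 1} ≤ P := (Ideal.span_singleton_le_iff_mem _).2 h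
          have hN : Ideal.absNorm (Ideal.span {eZ 1 1 1 1 1}) = 16 := by
            rw [Ideal.absNorm_span_singleton, eZ_norm (z := 16) (by decide +kernel)]; rfl
          have hd := Ideal.dvd_iff_le.2 hle
          obtain ⟨J, hJ⟩ := hd
          have : Ideal.absNorm J = 1 := by
            have := congrArg Ideal.absNorm hJ
            rw [map_mul, hN, ← hpk] at this
            omega
          rw [Ideal.absNorm_eq_one_iff] at this
          rw [this, Ideal.mul_top] at hJ
          exact ⟨⟨_, hJ.symm⟩⟩
        · exfalso
          set x := Ideal.Quotient.mk P b₀ with hx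
          have hF : x ^ (2 ^ k) = x := by
            have := FiniteField.pow_card x
            rwa [← Nat.card_eq_fintype_card, hcard, ← hpk] at this
          have h20 : (2 : 𝓞 K ⧸ P) = 0 := by
            have := Ideal.Quotient.eq_zero_iff_mem.2 hpP
            rw [map_natCast] at this
            exact_mod_cast this
          have h5 : x ^ 5 = 1 := by
            rw [hx, ← map_pow, b₀5]
            have : Ideal.Quotient.mk P 3 = 3 := rfl
            rw [this]; linear_combination h20
          have hγ : 1 + x + x ^ 2 + x ^ 3 + x ^ 4 = 0 := by
            have := Ideal.Quotient.eq_zero_iff_mem.2 h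
            simpa [eZ] using this
          have hx0 : x ≠ 0 := by rintro h; rw [h] at h5; norm_num at h5
          have hx1 : x = 1 := by
            interval_cases k
            · apply mul_left_cancel₀ hx0
              linear_combination hF
            · have : x ^ 3 = 1 := by
                apply mul_left_cancel₀ hx0; linear_combination hF
              have h2 : x = x^3 * x^3  := by linear_combination - x * h5
              rw [h2, this]; norm_num
            · have : x ^ 2 = 1 := by
                apply mul_left_cancel₀ hx0; linear_combination hF - x^3 * h5
              have h2 : x = x^5  := by linear_combination -x * (x^2+1) * this 
              rw [h2, h5]
            · omega
          rw [hx1] at hγ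
          have : (1 : 𝓞 K ⧸ P) = 0 := by linear_combination hγ - 2 * h20
          exact one_ne_zero this
    · refine prin_eZ hP 0 1 0 0 0 3 ?_ (by decide +kernel) (by norm_num)
      have : b₀ ^ 5 ∈ P := by rw [b₀5]; exact hpP
      have := hP.mem_of_pow_mem _ this
      simpa [eZ] using this
    · refine prin_eZ hP 2 0 0 (-1) 0 5 ?_ n_five (by norm_num)
      apply hP.mem_of_pow_mem 5
      have : eZ 2 0 0 (-1) 0 ^ 5 = (5:ℕ) * (1 - 16 * b₀ ^ 3 + 16 * b₀ ^ 6 - 8 * b₀ ^ 9 + 2 * b₀ ^ 12) := by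
        simp only [eZ]; push_cast; linear_combination -(b₀ ^ 10 + 3 * b₀ ^ 5 + 9) * b₀5
      rw [this]; exact P.mul_mem_right _ hpP
  · have hk1 : k = 1 := by
      by_contra hc
      have h1 : p ^ 2 ≤ p ^ k := Nat.pow_le_pow_right (by omega) (by omega)
      nlinarith
    subst hk1
    rw [pow_one] at hpk
    obtain ⟨e, hep, heP, hed⟩ := deg1 hP hp hpk.symm
    clear hpk
    have hm := mem_of_deg1 hpP heP
    have key : ∀ a b c d f z : ℤ, nf a b c d f = z → z.natAbs.Prime → (p:ℤ) ∣ a + b * e + c * e ^ 2 + d * e ^ 3 + f * e ^ 4 → Submodule.IsPrincipal P := 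
      fun a b c d f z h1 h2 h3 => prin_eZ hP a b c d f z (hm _ _ _ _ _ h3) h1 h2
    have : (p = 7 ∧ e = 5) ∨ (p = 13 ∧ e = 9) ∨ (p = 17 ∧ e = 12) ∨ (p = 19 ∧ e = 10) ∨ (p = 23 ∧ e = 18) ∨ (p = 29 ∧ e = 2) := by
      clear key hm heP hpP
      have : p = 7 ∨ p = 11 ∨ p = 13 ∨ p = 17 ∨ p = 19 ∨ p = 23 ∨ p = 29 ∨ p = 31 := by
        clear hed hep
        interval_cases p <;> first | omega | (exfalso; revert hp; norm_num)
      rcases this with rfl | rfl | rfl | rfl | rfl | rfl | rfl | rfl <;>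
      (interval_cases e <;> revert hed <;> decide)
    rcases this with ⟨rfl, rfl⟩ | ⟨rfl, rfl⟩ | ⟨rfl, rfl⟩ | ⟨rfl, rfl⟩ | ⟨rfl, rfl⟩ | ⟨rfl, rfl⟩
    · exact key 1 (-1) 1 0 0 7 (by decide +kernel) (by norm_num) (by norm_num)
    · exact key 1 1 1 0 0 13 (by decide +kernel) (by norm_num) (by norm_num)
    · exact key 2 2 1 0 0 17 (by decide +kernel) (by norm_num) (by norm_num)
    · exact key 1 0 0 1 1 19 (by decide +kernel) (by norm_num) (by norm_num)
    · exact key (-2) 0 1 0 0 (-23) (by decide +kernel) (by norm_num) (by norm_num)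
    · exact key (-2) 1 0 0 0 (-29) (by decide +kernel) (by norm_num) (by norm_num)

theorem pid : IsPrincipalIdealRing (𝓞 K) := by
  apply RingOfIntegers.isPrincipalIdealRing_of_isPrincipal_of_norm_le_of_isPrime
  intro I hI hn
  refine prin_small hI (nonZeroDivisors.coe_ne_zero I) ?_
  have := lt_of_le_of_lt hn mink
  have h2 : Ideal.absNorm (I : Ideal (𝓞 K)) < 32 := by exact_mod_cast this
  omega
end RP


namespace RP
open Polynomial NumberField

def m5 {R : Type*} [CommRing R] (q r : Fin 5 → R) : Fin 5 → R :=
  ![q 0 * r 0 + 3 * (q 1 * r 4 + q 2 * r 3 + q 3 * r 2 + q 4 * r 1),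
    q 0 * r 1 + q 1 * r 0 + 3 * (q 2 * r 4 + q 3 * r 3 + q 4 * r 2),
    q 0 * r 2 + q 1 * r 1 + q 2 * r 0 + 3 * (q 3 * r 4 + q 4 * r 3),
    q 0 * r 3 + q 1 * r 2 + q 2 * r 1 + q 3 * r 0 + 3 * (q 4 * r 4),
    q 0 * r 4 + q 1 * r 3 + q 2 * r 2 + q 3 * r 1 + q 4 * r 0]

theorem ev_sum (q : Fin 5 → ℚ) : ev q = q 0 + q 1 * β + q 2 * β ^ 2 + q 3 * β ^ 3 + q 4 * β ^ 4 := by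
  simp [ev, Fin.sum_univ_succ]; ring

theorem ev_m5 (q r : Fin 5 → ℚ) : ev (m5 q r) = ev q * ev r := by
  simp only [ev_sum, m5]
  simp
  linear_combination (-(q 1 * r 4 + q 2 * r 3 + q 3 * r 2 + q 4 * r 1) - (q 2 * r 4 + q 3 * r 3 + q 4 * r 2) * β
    - (q 3 * r 4 + q 4 * r 3) * β ^ 2 - q 4 * r 4 * β ^ 3 : K) * β5

theorem m5_map {R S : Type*} [CommRing R] [CommRing S] (φ : R →+* S) (q r : Fin 5 → R) :
    (fun i => φ (m5 q r i)) = m5 (fun i => φ (q i)) (fun i => φ (r i)) := by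
  have h3 : φ 3 = 3 := map_ofNat φ 3
  ext i; fin_cases i <;> simp [m5, h3]

theorem m5_two {R : Type*} [CommRing R] (h4 : (4 : R) = 0) (s r : Fin 5 → R) :
    m5 (fun i => s i + 2 * r i) (fun i => s i + 2 * r i) = m5 s s := by
  ext i
  have : m5 (fun i => s i + 2 * r i) (fun i => s i + 2 * r i) i = m5 s s i + 4 * (m5 s r i + m5 r r i) := by
    fin_cases i <;> simp [m5] <;> ring
  rw [this, h4]; ring

theorem m5_comm {R : Type*} [CommRing R] (q r : Fin 5 → R) : m5 q r = m5 r q := by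
  ext i; fin_cases i <;> simp [m5] <;> ring
theorem m5_assoc {R : Type*} [CommRing R] (q r s : Fin 5 → R) : m5 (m5 q r) s = m5 q (m5 r s) := by
  ext i; fin_cases i <;> simp [m5] <;> ring
theorem m5_one {R : Type*} [CommRing R] (q : Fin 5 → R) : m5 ![1,0,0,0,0] q = q := by
  ext i; fin_cases i <;> simp [m5]
theorem m5_smul {R : Type*} [CommRing R] (k : R) (q r : Fin 5 → R) : m5 q (fun i => k * r i) = fun i => k * m5 q r i := by
  ext i; fin_cases i <;> simp [m5] <;> ring
theorem m5_smul_left {R : Type*} [CommRing R] (k : R) (q r : Fin 5 → R) : m5 (fun i => k * q i) r = fun i => k * m5 q r i := by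
  ext i; fin_cases i <;> simp [m5] <;> ring

/-- evaluation on integer vectors -/
noncomputable def evz (q : Fin 5 → ℤ) : K := ev (fun i => (q i : ℚ))

theorem evz_m5 (q r : Fin 5 → ℤ) : evz (m5 q r) = evz q * evz r := by
  unfold evz; rw [← ev_m5]
  congr 1
  exact m5_map (Int.castRingHom ℚ) q r

theorem evz_inj {q r : Fin 5 → ℤ} (h : evz q = evz r) : q = r := by
  have := ev_inj h
  ext i; have := congrFun this i; exact_mod_cast this

theorem evz_smul (k : ℤ) (q : Fin 5 → ℤ) : evz (fun i => k * q i) = k * evz q := by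
  unfold evz; simp only [ev_sum]; push_cast; ring

theorem evz_one : evz ![1,0,0,0,0] = 1 := by simp [evz, ev_sum]

theorem evz_frac (x : K) : ∃ (n : ℕ) (q : Fin 5 → ℤ), 0 < n ∧ (n:K) * x = evz q := by
  obtain ⟨r, rfl⟩ := ev_surj x
  refine ⟨∏ i, (r i).den, fun i => (r i).num * ∏ j ∈ Finset.univ.erase i, ((r j).den : ℤ), Finset.prod_pos fun i _ => (r i).pos, ?_⟩
  have : ∀ i, ((∏ i, (r i).den : ℕ) : ℚ) * r i = (((r i).num * ∏ j ∈ Finset.univ.erase i, ((r j).den : ℤ) : ℤ) : ℚ) := by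
    intro i
    rw [← Finset.mul_prod_erase _ _ (Finset.mem_univ i)]
    push_cast
    have := Rat.mul_den_eq_num (r i)
    linear_combination (∏ j ∈ Finset.univ.erase i, ((r j).den : ℚ)) * this
  unfold evz
  simp only [ev_sum, ← this]
  push_cast
  ring

theorem sq2 : ∀ q : Fin 5 → ZMod 2, m5 q q = 0 → q = 0 := by decide +kernel

def lift4 (s : Fin 5 → ZMod 2) : Fin 5 → ZMod 4 := fun i => if s i = 0 then 0 else 1

theorem sq4 (q : Fin 5 → ℤ) : (fun i => ((m5 q q i : ℤ) : ZMod 4)) =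
    m5 (lift4 fun i => (q i : ZMod 2)) (lift4 fun i => (q i : ZMod 2)) := by
  have h : ∀ i, ∃ r : ZMod 4, ((q i : ℤ) : ZMod 4) = lift4 (fun i => (q i : ZMod 2)) i + 2 * r := by
    intro i
    simp only [lift4]
    rcases Int.even_or_odd' (q i) with ⟨k, hk | hk⟩
    · refine ⟨k, ?_⟩
      have : ((q i : ℤ) : ZMod 2) = 0 := by
        rw [hk]; push_cast; rw [show (2 : ZMod 2) = 0 from rfl]; ring
      rw [if_pos this, hk]; push_cast; ring
    · refine ⟨k, ?_⟩
      have : ((q i : ℤ) : ZMod 2) ≠ 0 := by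
        rw [hk]; push_cast; rw [show (2 : ZMod 2) = 0 from rfl]; simp
      rw [if_neg this, hk]; push_cast; ring
  choose r hr using h
  have h4 : (4 : ZMod 4) = 0 := rfl
  have := m5_map (Int.castRingHom (ZMod 4)) q q
  simp only [eq_intCast] at this
  rw [this]
  generalize lift4 (fun i => (q i : ZMod 2)) = s at *
  have h' : (fun i => ((q i : ℤ) : ZMod 4)) = fun i => s i + 2 * r i := funext hr
  rw [h', m5_two h4]

theorem mod4 (c u u' : Fin 5 → ℤ) (hu : m5 u' u = ![1,0,0,0,0]) (ξ : K) (h : evz c = evz u * ξ ^ 2) :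
    ∃ s : Fin 5 → ZMod 2, (fun i => (c i : ZMod 4)) = m5 (fun i => (u i : ZMod 4)) (m5 (lift4 s) (lift4 s)) := by
  have key : ∀ n : ℕ, 0 < n → ∀ q : Fin 5 → ℤ, (fun i => (n:ℤ) ^ 2 * c i) = m5 u (m5 q q) →
      ∃ s : Fin 5 → ZMod 2, (fun i => (c i : ZMod 4)) = m5 (fun i => (u i : ZMod 4)) (m5 (lift4 s) (lift4 s)) := by
    intro n
    induction n using Nat.strong_induction_on with
    | _ n ih =>
      intro hn q hq
      rcases Nat.even_or_odd' n with ⟨k, hk | hk⟩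
      · -- even
        have h1 : m5 u' (fun i => (n:ℤ) ^ 2 * c i) = m5 q q := by
          rw [hq, ← m5_assoc, hu, m5_one]
        have h2 : m5 (fun i => (q i : ZMod 2)) (fun i => (q i : ZMod 2)) = 0 := by
          have := m5_map (Int.castRingHom (ZMod 2)) q q
          simp only [eq_intCast] at this
          rw [← this, ← h1, m5_smul]
          ext i
          have : (2 : ZMod 2) = 0 := rfl
          simp [hk, this]
        have h3 := sq2 _ h2
        have h4 : ∀ i, ∃ r, q i = 2 * r := by
          intro i
          have := congrFun h3 i
          exact (ZMod.intCast_zmod_eq_zero_iff_dvd _ 2).1 this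
        choose r hr using h4
        refine ih k (by omega) (by omega) r ?_
        have h5 : q = fun i => 2 * r i := funext hr
        rw [h5, m5_smul, m5_smul_left, m5_smul, m5_smul] at hq
        ext i
        have := congrFun hq i
        rw [hk] at this
        push_cast at this
        linarith
      · refine ⟨fun i => (q i : ZMod 2), ?_⟩
        rw [← sq4]
        have := m5_map (Int.castRingHom (ZMod 4)) u (m5 q q)
        simp only [eq_intCast] at this
        rw [← this, ← hq]
        ext i
        have h4 : (4 : ZMod 4) = 0 := rfl
        rw [hk]; push_cast
        linear_combination -(k ^ 2 + k) * (c i : ZMod 4) * h4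
  obtain ⟨n, q, hn, hq⟩ := evz_frac ξ
  refine key n hn q (evz_inj ?_)
  rw [evz_m5, evz_m5, ← hq]
  have : evz (fun i => (n:ℤ)^2 * c i) = ((n:ℤ)^2 : ℤ) * evz c := evz_smul _ _
  rw [this, h]; push_cast; ring

def U : Fin 4 → Fin 5 → ℤ := ![![1,0,0,0,0], ![-2,0,1,-1,1], ![1,2,-1,-1,0], ![4,-4,0,3,-2]]
def U' : Fin 4 → Fin 5 → ℤ := ![![1,0,0,0,0], ![7,6,5,4,3], ![31,25,20,16,13], m5 ![7,6,5,4,3] ![31,25,20,16,13]]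

theorem UU' : ∀ i, m5 (U' i) (U i) = ![1,0,0,0,0] := by decide +kernel
theorem Umul : U 3 = m5 (U 1) (U 2) := by decide +kernel

theorem Unsq : ∀ i, i ≠ 0 → ∀ t : Fin 5 → ZMod 2, (fun j => ((U i j : ℤ) : ZMod 4)) ≠ m5 (lift4 t) (lift4 t) ∧
   (fun j => ((- U i j : ℤ) : ZMod 4)) ≠ m5 (lift4 t) (lift4 t) := by decide +kernel

theorem U_not_sq (i : Fin 4) (hi : i ≠ 0) (ξ : K) : evz (U i) ≠ ξ ^ 2 := by
  intro h
  obtain ⟨s, hs⟩ := mod4 (U i) ![1,0,0,0,0] ![1,0,0,0,0] (by decide) ξ (by rw [evz_one, one_mul, h])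
  rw [show (fun i => ((![1,0,0,0,0] i : ℤ) : ZMod 4)) = ![1,0,0,0,0] by decide, m5_one] at hs
  exact (Unsq i hi s).1 hs

theorem U_not_neg_sq (i : Fin 4) (hi : i ≠ 0) (ξ : K) : evz (U i) ≠ - ξ ^ 2 := by
  intro h
  have h' : evz (fun j => - U i j) = ξ ^ 2 := by
    have := evz_smul (-1) (U i)
    rw [h] at this
    simpa using this
  obtain ⟨s, hs⟩ := mod4 (fun j => - U i j) ![1,0,0,0,0] ![1,0,0,0,0] (by decide) ξ (by rw [evz_one, one_mul, h'])
  rw [show (fun i => ((![1,0,0,0,0] i : ℤ) : ZMod 4)) = ![1,0,0,0,0] by decide, m5_one] at hs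
  exact (Unsq i hi s).2 hs

end RP


namespace RP
open Polynomial NumberField
open InfinitePlace in
theorem r1_le : nrRealPlaces K ≤ 1 := by
  classical
  rw [← card_real_embeddings, Fintype.card_le_one_iff]
  rintro ⟨φ, hφ⟩ ⟨ψ, hψ⟩
  have hr : ∀ χ : K →+* ℂ, ComplexEmbedding.IsReal χ → ∃ r : ℝ, χ β = r ∧ r ^ 5 = 3 := by
    intro χ hχ
    refine ⟨(χ β).re, ?_, ?_⟩
    · have := RingHom.congr_fun hχ β
      exact (Complex.conj_eq_iff_re.1 this).symm
    · have h1 := RingHom.congr_fun hχ β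
      have h2 : ((χ β).re : ℂ) = χ β := Complex.conj_eq_iff_re.1 h1
      have h3 : (((χ β).re ^ 5 : ℝ) : ℂ) = ((3 : ℝ) : ℂ) := by
        push_cast; rw [h2, ← map_pow, β5]; exact map_ofNat χ 3
      exact_mod_cast h3
  obtain ⟨r, h1, h2⟩ := hr φ hφ
  obtain ⟨s, h3, h4⟩ := hr ψ hψ
  have hrs : r = s := by
    have : StrictMono (fun x : ℝ => x ^ 5) := Odd.strictMono_pow (by decide)
    exact this.injective (by simp [h2, h4])
  have : φ = ψ := by
    ext x
    obtain ⟨q, rfl⟩ := ev_surj x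
    rw [ev_sum]
    simp [h1, h3, hrs]
  simp [this]

open InfinitePlace in
theorem rankK : Units.rank K = 2 := by
  have h1 := r1_le
  have h2 := r2_le
  have h3 := card_add_two_mul_card_eq_rank K
  rw [finrankK] at h3
  rw [Units.rank, card_eq_nrRealPlaces_add_nrComplexPlaces]
  omega

theorem pig : ∀ e1 e2 e3 : Fin 2 → ZMod 2, ∃ i j k : Fin 2, ¬ (i = 0 ∧ j = 0 ∧ k = 0) ∧
  ∀ t, (i : ℕ) • e1 t + (j : ℕ) • e2 t + (k : ℕ) • e3 t = 0 := by decide +kernel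

theorem unit_form (x : (𝓞 K)ˣ) : ∃ (s : (𝓞 K)ˣ) (e : Fin 2 → ℤ), (s = 1 ∨ s = -1) ∧
    x = s * ∏ i, (Units.fundSystem K (Fin.cast rankK.symm i)) ^ (e i) := by
  obtain ⟨⟨ζ, e⟩, h, _⟩ := Units.exist_unique_eq_mul_prod K x
  refine ⟨ζ, fun i => e (Fin.cast rankK.symm i), ?_, ?_⟩
  · exact Units.torsion_eq_one_or_neg_one_of_odd_finrank (by rw [finrankK]; decide) ζ
  · rw [h]; congr 1
    exact (Equiv.prod_comp (finCongr rankK.symm) (fun i => Units.fundSystem K i ^ e i)).symm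

noncomputable def oz (q : Fin 5 → ℤ) : 𝓞 K := eZ (q 0) (q 1) (q 2) (q 3) (q 4)
theorem oz_coe (q : Fin 5 → ℤ) : algebraMap (𝓞 K) K (oz q) = evz q := by
  rw [oz, eZ_coe, evz]; congr 1; ext i; fin_cases i <;> rfl
theorem oz_m5 (q r : Fin 5 → ℤ) : oz (m5 q r) = oz q * oz r := by
  apply RingOfIntegers.coe_injective
  rw [map_mul, oz_coe, oz_coe, oz_coe, evz_m5]

noncomputable def un (i : Fin 4) : (𝓞 K)ˣ where
  val := oz (U i)
  inv := oz (U' i)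
  val_inv := by rw [mul_comm, ← oz_m5, UU']; simp [oz, eZ]
  inv_val := by rw [← oz_m5, UU']; simp [oz, eZ]

theorem un_coe (i : Fin 4) : algebraMap (𝓞 K) K (un i : 𝓞 K) = evz (U i) := oz_coe _

theorem units_sq (w : (𝓞 K)ˣ) : ∃ (i : Fin 4) (s v : (𝓞 K)ˣ), (s = 1 ∨ s = -1) ∧ w = s * un i * v ^ 2 := by
  obtain ⟨s1, e1, hs1, h1⟩ := unit_form w
  obtain ⟨s2, e2, hs2, h2⟩ := unit_form (un 1)
  obtain ⟨s3, e3, hs3, h3⟩ := unit_form (un 2)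
  obtain ⟨i, j, k, hne, h⟩ := pig (fun t => (e1 t : ZMod 2)) (fun t => (e2 t : ZMod 2)) (fun t => (e3 t : ZMod 2))
  have hev : ∀ t, ∃ r : ℤ, (i : ℕ) * e1 t + (j : ℕ) * e2 t + (k : ℕ) * e3 t = 2 * r := by
    intro t
    have := h t
    apply (ZMod.intCast_zmod_eq_zero_iff_dvd _ 2).1
    push_cast
    simpa [nsmul_eq_mul] using this
  choose r hr using hev
  set f := fun t => Units.fundSystem K (Fin.cast rankK.symm t)
  have hprod : w ^ (i : ℕ) * un 1 ^ (j:ℕ) * un 2 ^ (k:ℕ) =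
      (s1 ^ (i:ℕ) * s2 ^ (j:ℕ) * s3 ^ (k:ℕ)) * (∏ t, f t ^ r t) ^ 2 := by
    have : ∏ t, f t ^ (2 * r t) = (∏ t, f t ^ e1 t) ^ (i:ℕ) * (∏ t, f t ^ e2 t) ^ (j:ℕ) * (∏ t, f t ^ e3 t) ^ (k:ℕ) := by
      rw [← Finset.prod_pow, ← Finset.prod_pow, ← Finset.prod_pow, ← Finset.prod_mul_distrib, ← Finset.prod_mul_distrib]
      refine Finset.prod_congr rfl fun t _ => ?_
      rw [← hr t, zpow_add, zpow_add]
      simp only [← zpow_natCast, ← zpow_mul]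
      rw [mul_comm (e1 t), mul_comm (e2 t), mul_comm (e3 t)]
    have h2r : (∏ t, f t ^ r t) ^ 2 = ∏ t, f t ^ (2 * r t) := by
      rw [← Finset.prod_pow]
      refine Finset.prod_congr rfl fun t _ => ?_
      rw [← zpow_natCast, ← zpow_mul, mul_comm]; rfl
    rw [h2r, this]
    conv_lhs => rw [h1, h2, h3]
    simp only [mul_pow]
    simp only [f]
    ac_rfl
  have hs : s1 ^ (i:ℕ) * s2 ^ (j:ℕ) * s3 ^ (k:ℕ) = 1 ∨ s1 ^ (i:ℕ) * s2 ^ (j:ℕ) * s3 ^ (k:ℕ) = -1 := by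
    fin_cases i <;> fin_cases j <;> fin_cases k <;> rcases hs1 with rfl | rfl <;> rcases hs2 with rfl | rfl <;> rcases hs3 with rfl | rfl <;> simp
  set σ := s1 ^ (i:ℕ) * s2 ^ (j:ℕ) * s3 ^ (k:ℕ)
  set v := ∏ t, f t ^ r t
  have hu3 : un 3 = un 1 * un 2 := by
    ext1; simp only [un, Units.val_mul]; rw [Umul, oz_m5]
  have hnot : ∀ i, i ≠ 0 → un i ≠ σ * v ^ 2 := by
    intro i hi heq
    have := congrArg (fun z : (𝓞 K)ˣ => algebraMap (𝓞 K) K (z : 𝓞 K)) heq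
    simp only [un_coe] at this
    rcases hs with h | h
    · rw [h] at this
      exact U_not_sq i hi (algebraMap (𝓞 K) K (v : 𝓞 K)) (by rw [this]; simp)
    · rw [h] at this
      exact U_not_neg_sq i hi (algebraMap (𝓞 K) K (v : 𝓞 K)) (by rw [this]; simp)
  have hu0 : un 0 = 1 := by ext1; simp [un, U, oz, eZ]
  have fin : ∀ l : Fin 4, w * un l = σ * v ^ 2 → ∃ (i : Fin 4) (s v : (𝓞 K)ˣ), (s = 1 ∨ s = -1) ∧ w = s * un i * v ^ 2 := by
    intro l hl
    refine ⟨l, σ, v * (un l)⁻¹, hs, ?_⟩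
    rw [← mul_inv_eq_iff_eq_mul.2 hl.symm]
    rw [mul_pow, inv_pow]
    rw [pow_two (un l)]
    rw [mul_inv]
    have : un l * (un l)⁻¹ = 1 := mul_inv_cancel _
    calc σ * v ^ 2 * (un l)⁻¹ = σ * v ^ 2 * (un l)⁻¹ * (un l * (un l)⁻¹) := by rw [this, mul_one]
      _ = _ := by ac_rfl
  have hi : i = 0 ∨ i = 1 := by omega
  have hj : j = 0 ∨ j = 1 := by omega
  have hk : k = 0 ∨ k = 1 := by omega
  clear_value σ v
  clear hr h
  rcases hi with rfl | rfl <;> rcases hj with rfl | rfl <;> rcases hk with rfl | rfl <;> simp at hprod hne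
  · exact absurd hprod (hnot 2 (by decide))
  · exact absurd hprod (hnot 1 (by decide))
  · rw [← hu3] at hprod; exact absurd hprod (hnot 3 (by decide))
  · exact fin 0 (by rw [hu0, mul_one, hprod])
  · exact fin 2 hprod
  · exact fin 1 hprod
  · exact fin 3 (by rw [hu3, ← mul_assoc, hprod])
end RP


namespace RP
open Polynomial NumberField

noncomputable def fZ : ℤ[X] := C 15 * X ^ 5 - C 45

theorem fZ_b : aeval b₀ fZ = 0 := by
  simp only [fZ, map_sub, map_mul, map_pow, aeval_C, aeval_X, b₀5]; norm_num
theorem fZ_d : aeval b₀ (derivative fZ) = 75 * b₀ ^ 4 := by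
  simp only [fZ, derivative_sub, derivative_mul, derivative_C, derivative_X_pow, zero_mul, zero_add, sub_zero, map_mul, map_pow, aeval_C, aeval_X, map_sub]
  norm_num; ring

instance : IsPrincipalIdealRing (𝓞 K) := pid

theorem ex_sqf (A : 𝓞 K) (hA : A ≠ 0) : ∃ s t : 𝓞 K, A = s ^ 2 * t ∧ Squarefree t := by
  induction A using UniqueFactorizationMonoid.induction_on_prime with
  | h₁ => exact absurd rfl hA
  | h₂ x hx => exact ⟨1, x, by simp, hx.squarefree⟩
  | h₃ a p ha hp ih =>
    obtain ⟨s, t, rfl, ht⟩ := ih ha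
    by_cases h : p ∣ t
    · obtain ⟨t', rfl⟩ := h
      exact ⟨s * p, t', by ring, ht.squarefree_of_dvd ⟨p, by ring⟩⟩
    · refine ⟨s, p * t, by ring, ?_⟩
      rw [squarefree_mul_iff]
      exact ⟨(hp.irreducible.isRelPrime_iff_not_dvd).2 h, hp.squarefree, ht⟩

theorem odd_prop {A s t π : 𝓞 K} (hA : A ≠ 0) (h : A = s ^ 2 * t) (ht : Squarefree t) (hπ : Prime π) (hd : π ∣ t)
    (V B : 𝓞 K) (hV : A * V = B ^ 2) : π ∣ V ∧ π ∣ B := by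
  have hs : s ≠ 0 := by rintro rfl; simp at h; exact hA h
  have h1 : s ∣ B := by
    rw [← IsIntegrallyClosed.pow_dvd_pow_iff (n := 2) two_ne_zero, ← hV, h]; exact ⟨t * V, by ring⟩
  obtain ⟨B', rfl⟩ := h1
  have h2 : t * V = B' ^ 2 := by
    have : s ^ 2 * (t * V) = s ^ 2 * B' ^ 2 := by rw [h] at hV; linear_combination hV
    exact mul_left_cancel₀ (pow_ne_zero 2 hs) this
  have h3 : π ∣ B' := hπ.dvd_of_dvd_pow (h2 ▸ hd.mul_right V)
  refine ⟨?_, h3.mul_left s⟩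
  obtain ⟨t', rfl⟩ := hd
  obtain ⟨B'', rfl⟩ := h3
  have h4 : t' * V = π * B'' ^ 2 := by
    apply mul_left_cancel₀ hπ.ne_zero; linear_combination h2
  rcases hπ.dvd_or_dvd (h4 ▸ dvd_mul_right π (B''^2) : π ∣ t' * V) with h5 | h5
  · obtain ⟨t'', rfl⟩ := h5
    exact absurd (ht π ⟨t'', by ring⟩) hπ.not_isUnit
  · exact h5

theorem mapp_zero (p : ℕ) (q : ℤ[X]) : q.map (Int.castRingHom (ZMod p)) = 0 ↔ C (p:ℤ) ∣ q := by
  rw [C_dvd_iff_dvd_coeff, Polynomial.ext_iff]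
  refine forall_congr' fun i => ?_
  rw [coeff_map, coeff_zero, eq_intCast, ZMod.intCast_zmod_eq_zero_iff_dvd]

theorem mapp_surj (p : ℕ) [NeZero p] (q : (ZMod p)[X]) : ∃ r : ℤ[X], r.map (Int.castRingHom (ZMod p)) = q :=
  Polynomial.map_surjective _ (ZMod.ringHom_surjective _) q

theorem not_dvd_int {p : ℕ} (hp : p.Prime) {π : 𝓞 K} (hπ : Prime π) (hpπ : π ∣ (p : 𝓞 K)) (m : ℤ)
    (hm : π ∣ (m : 𝓞 K)) : (p : ℤ) ∣ m := by
  by_contra h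
  have : IsCoprime (p:ℤ) m := (Nat.prime_iff_prime_int.1 hp).coprime_iff_not_dvd.2 h
  obtain ⟨x, y, hxy⟩ := this
  have h1 := congrArg (Int.cast : ℤ → 𝓞 K) hxy
  push_cast at h1
  exact hπ.not_isUnit (isUnit_of_dvd_one (h1 ▸ dvd_add (hpπ.mul_left _) (hm.mul_left _)))

theorem core0 {p : ℕ} (hp : p.Prime) {π : 𝓞 K} (hπ : Prime π) (hpπ : π ∣ (p : 𝓞 K)) {a b V : ℤ[X]} {m : ℤ}
    (h : a * V = b ^ 2 - C (m ^ 2) * fZ) (ha : π ∣ aeval b₀ a) (hV : π ∣ aeval b₀ V) (hb : π ∣ aeval b₀ b)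
    (hm : ¬ (p : ℤ) ∣ m) : p ∣ 15 := by
  have h1 := congrArg (fun q => aeval b₀ (derivative q)) h
  simp only [derivative_mul, derivative_sub, derivative_pow, derivative_C, zero_mul, zero_add, map_add, map_mul, map_sub, fZ_d] at h1
  have h2 : π ∣ ((75 * m ^ 2 : ℤ) : 𝓞 K) * b₀ ^ 4 := by
    have : ((75 * m ^ 2 : ℤ) : 𝓞 K) * b₀ ^ 4 = aeval b₀ b * (2 * aeval b₀ (derivative b)) - aeval b₀ (derivative a) * aeval b₀ V - aeval b₀ a * aeval b₀ (derivative V) := by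
      simp only [aeval_C, map_natCast, Nat.cast_ofNat, Nat.add_one_sub_one, pow_one, map_pow, algebraMap_int_eq, eq_intCast] at h1 ⊢
      have e2 : aeval b₀ (2 : ℤ[X]) = 2 := map_ofNat _ 2
      have em : aeval b₀ (m : ℤ[X]) = m := map_intCast _ m
      push_cast at h1 ⊢
      rw [e2, em] at h1
      linear_combination h1
    rw [this]
    exact dvd_sub (dvd_sub (hb.mul_right _) (hV.mul_left _)) (ha.mul_right _)
  have hpi := Nat.prime_iff_prime_int.1 hp
  rcases hπ.dvd_or_dvd h2 with h3 | h3
  · have := not_dvd_int hp hπ hpπ _ h3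
    rcases hpi.dvd_or_dvd this with h4 | h4
    · have : p ∣ 75 := by exact_mod_cast h4
      have : p ∣ 15 ^ 2 := this.trans (by norm_num)
      exact hp.dvd_of_dvd_pow this
    · exact absurd (hpi.dvd_of_dvd_pow h4) hm
  · have := hπ.dvd_of_dvd_pow h3
    have : π ∣ ((3:ℤ) : 𝓞 K) := by
      have h6 : ((3:ℤ) : 𝓞 K) = b₀ ^ 5 := by rw [b₀5]; norm_num
      rw [h6]; exact dvd_pow this (by norm_num)
    have h7 := not_dvd_int hp hπ hpπ _ this
    have : p ∣ 3 := by exact_mod_cast h7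
    exact this.trans (by norm_num)

theorem coreLin {p : ℕ} (hp : p.Prime) {π : 𝓞 K} (hπ : Prime π) (hpπ : π ∣ (p : 𝓞 K)) {a : ℤ[X]}
    (hodd : ∀ V B : 𝓞 K, aeval b₀ a * V = B ^ 2 → π ∣ V ∧ π ∣ B) (ha : π ∣ aeval b₀ a)
    (hap : Prime (a.map (Int.castRingHom (ZMod p)))) :
    ∀ n : ℕ, ∀ (m : ℤ) (b V : ℤ[X]), m.natAbs ≤ n → m ≠ 0 → a * V = b ^ 2 - C (m ^ 2) * fZ → p ∣ 15 := by
  have : Fact p.Prime := ⟨hp⟩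
  intro n
  induction n with
  | zero => intro m b V h1 h2; omega
  | succ n ih =>
    intro m b V hmn hm0 h
    have hev : aeval b₀ a * aeval b₀ V = (aeval b₀ b) ^ 2 := by
      have := congrArg (aeval b₀) h
      simpa [fZ_b] using this
    obtain ⟨hV, hb⟩ := hodd _ _ hev
    by_cases hm : (p:ℤ) ∣ m
    swap
    · exact core0 hp hπ hpπ h ha hV hb hm
    obtain ⟨m', rfl⟩ := hm
    have h1 : a.map (Int.castRingHom (ZMod p)) ∣ b.map (Int.castRingHom (ZMod p)) := by
      apply hap.dvd_of_dvd_pow (n := 2)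
      have := congrArg (Polynomial.map (Int.castRingHom (ZMod p))) h
      refine ⟨V.map (Int.castRingHom (ZMod p)), ?_⟩
      simp [Polynomial.map_mul, Polynomial.map_sub] at this
      exact this.symm
    obtain ⟨w', hw'⟩ := h1
    obtain ⟨w, rfl⟩ := mapp_surj p w'
    have h2 : C (p:ℤ) ∣ b - a * w := by
      rw [← mapp_zero]; simp [hw']
    obtain ⟨b', hb'⟩ := h2
    have hb2 : b = a * w + C (p:ℤ) * b' := by rw [← hb']; ring
    have hCp : Prime (C (p:ℤ)) := prime_C_iff.2 (Nat.prime_iff_prime_int.1 hp)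
    have ha0 : ¬ C (p:ℤ) ∣ a := by
      rw [← mapp_zero]; exact hap.ne_zero
    have h3 : a * (V - a * w ^ 2 - 2 * w * C (p:ℤ) * b') = C (p:ℤ) ^ 2 * (b' ^ 2 - C (m' ^ 2) * fZ) := by
      have : C (((p:ℤ) * m') ^ 2) = C (p:ℤ) ^ 2 * C (m' ^ 2) := by simp [mul_pow]
      rw [this, hb2] at h
      linear_combination h
    have h4 : C (p:ℤ) ^ 2 ∣ (V - a * w ^ 2 - 2 * w * C (p:ℤ) * b') := by
      refine hCp.pow_dvd_of_dvd_mul_left 2 ha0 ⟨_, h3⟩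
    obtain ⟨V', hV'⟩ := h4
    have h5 : a * V' = b' ^ 2 - C (m' ^ 2) * fZ := by
      apply mul_left_cancel₀ (pow_ne_zero 2 hCp.ne_zero); rw [← h3, hV']; ring
    refine ih m' b' V' ?_ (right_ne_zero_of_mul hm0) h5
    have hp2 := hp.two_le
    have : m'.natAbs ≠ 0 := by simpa using right_ne_zero_of_mul hm0
    rw [Int.natAbs_mul, Int.natAbs_natCast] at hmn
    nlinarith [Nat.pos_of_ne_zero this]

theorem core {p : ℕ} (hp : p.Prime) {π : 𝓞 K} (hπ : Prime π) (hpπ : π ∣ (p : 𝓞 K)) {a b V : ℤ[X]} {m : ℤ}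
    (hodd : ∀ V B : 𝓞 K, aeval b₀ a * V = B ^ 2 → π ∣ V ∧ π ∣ B) (ha : π ∣ aeval b₀ a)
    (hm0 : m ≠ 0) (hpr : ¬ C (p:ℤ) ∣ a) (hb1 : b.natDegree ≤ 1) (hbm : (p:ℤ) ∣ m → ¬ C (p:ℤ) ∣ b)
    (h : a * V = b ^ 2 - C (m ^ 2) * fZ) : p ∣ 15 := by
  have : Fact p.Prime := ⟨hp⟩
  have hev : aeval b₀ a * aeval b₀ V = (aeval b₀ b) ^ 2 := by
    have := congrArg (aeval b₀) h
    simpa [fZ_b] using this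
  obtain ⟨hV, hb⟩ := hodd _ _ hev
  by_cases hm : (p:ℤ) ∣ m
  swap
  · exact core0 hp hπ hpπ h ha hV hb hm
  refine coreLin hp hπ hpπ hodd ha ?_ m.natAbs m b V le_rfl hm0 h
  have hb0 := hbm hm
  rw [← mapp_zero] at hb0 hpr
  set φ := Int.castRingHom (ZMod p)
  -- residue field
  have hI : (Ideal.span {π}).IsPrime := (Ideal.span_singleton_prime hπ.ne_zero).2 hπ
  let F := 𝓞 K ⧸ Ideal.span {π}
  have hchar : (p : F) = 0 := by
    have : Ideal.Quotient.mk (Ideal.span {π}) (p : 𝓞 K) = 0 :=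
      Ideal.Quotient.eq_zero_iff_mem.2 (Ideal.mem_span_singleton.2 hpπ)
    simpa using this
  have : CharP F p := (CharP.charP_iff_prime_eq_zero hp).2 hchar
  let ψ : ZMod p →+* F := ZMod.castHom (dvd_refl p) F
  have hψ : ∀ q : ℤ[X], eval₂ ψ (Ideal.Quotient.mk (Ideal.span {π}) b₀) (q.map φ) = Ideal.Quotient.mk (Ideal.span {π}) (aeval b₀ q) := by
    intro q
    rw [eval₂_map, aeval_def, hom_eval₂]
    congr 1
    exact RingHom.ext_int _ _
  have hz : ∀ q : ℤ[X], π ∣ aeval b₀ q → ¬ IsUnit (q.map φ) := by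
    intro q hq hu
    have h1 := hψ q
    rw [Ideal.Quotient.eq_zero_iff_mem.2 (Ideal.mem_span_singleton.2 hq)] at h1
    have := hu.map (eval₂RingHom ψ (Ideal.Quotient.mk (Ideal.span {π}) b₀))
    rw [coe_eval₂RingHom, h1] at this
    exact not_isUnit_zero this
  have hm2 : a.map φ * V.map φ = (b.map φ) ^ 2 := by
    have := congrArg (Polynomial.map φ) h
    have h0 : φ m = 0 := (ZMod.intCast_zmod_eq_zero_iff_dvd _ _).2 hm
    rw [Polynomial.map_mul, Polynomial.map_sub, Polynomial.map_mul, map_C, map_pow, h0] at this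
    simpa using this
  have hbd : (b.map φ).natDegree ≤ 1 := natDegree_map_le.trans hb1
  have hbirr : Prime (b.map φ) := by
    rcases Nat.le_one_iff_eq_zero_or_eq_one.1 hbd with h0 | h1
    · exfalso
      have : IsUnit (b.map φ) := by
        rw [isUnit_iff_degree_eq_zero, degree_eq_natDegree hb0, h0]; rfl
      apply hz a ha
      exact isUnit_of_dvd_unit ⟨_, hm2.symm⟩ (this.pow 2)
    · exact (irreducible_of_degree_eq_one (by rw [degree_eq_natDegree hb0, h1]; rfl)).prime
  obtain ⟨i, hi, hass⟩ := (dvd_prime_pow hbirr 2).1 ⟨_, hm2.symm⟩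
  interval_cases i
  · exact absurd (hass.symm.isUnit (by simp)) (hz a ha)
  · rw [pow_one] at hass; exact hass.symm.prime hbirr
  · exfalso
    apply hz V hV
    have h3 : Associated (a.map φ * V.map φ) (a.map φ * 1) := by rw [hm2, mul_one]; exact hass.symm
    have := (Associated.of_mul_left h3 (Associated.refl _) hpr)
    exact this.symm.isUnit isUnit_one

end RP


namespace RP
open Polynomial NumberField

def kap (a0 a1 a2 : ℤ) : ℤ := a0 ^ 5 + 3 * a1 ^ 5 + 9 * a2 ^ 5 - 15 * a0 * a1 ^ 3 * a2 + 15 * a0 ^ 2 * a1 * a2 ^ 2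

theorem nf_kap (a0 a1 a2 : ℤ) : nf a0 a1 a2 0 0 = kap a0 a1 a2 := by
  unfold nf kap
  simp [Matrix.det_succ_row_zero, Fin.sum_univ_succ]
  simp [Fin.succAbove]
  ring

noncomputable def q2 {R : Type*} [CommRing R] (a0 a1 a2 : R) : R[X] := C a2 * X ^ 2 + C a1 * X + C a0

theorem q2_eZ (a0 a1 a2 : ℤ) : aeval b₀ (q2 a0 a1 a2) = eZ a0 a1 a2 0 0 := by
  simp only [q2, map_add, map_mul, map_pow, aeval_C, aeval_X, eZ]
  simp; ring

theorem C_dvd_q2 (p a0 a1 a2 : ℤ) : C p ∣ q2 a0 a1 a2 ↔ p ∣ a0 ∧ p ∣ a1 ∧ p ∣ a2 := by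
  constructor
  · intro h
    rw [C_dvd_iff_dvd_coeff] at h
    have h0 := h 0; have h1 := h 1; have h2 := h 2
    simp only [q2, coeff_add, coeff_C_mul, coeff_X_pow, coeff_X, coeff_C] at h0 h1 h2
    norm_num at h0 h1 h2
    exact ⟨h0, h1, h2⟩
  · rintro ⟨⟨x, rfl⟩, ⟨y, rfl⟩, ⟨z, rfl⟩⟩
    exact ⟨q2 x y z, by simp only [q2, C_mul]; ring⟩

noncomputable def ρ : 𝓞 K := eZ 2 0 0 (-1) 0
theorem norm_ρ : Algebra.norm ℤ ρ = 5 := eZ_norm n_five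
theorem norm_b₀ : Algebra.norm ℤ b₀ = 3 := by
  have : b₀ = eZ 0 1 0 0 0 := by simp [eZ]
  rw [this]; exact eZ_norm (by decide +kernel)
noncomputable def η' : 𝓞 K := 1 - 16 * b₀ ^ 3 + 16 * b₀ ^ 6 - 8 * b₀ ^ 9 + 2 * b₀ ^ 12
theorem ρ5 : ρ ^ 5 = 5 * η' := by
  simp only [eZ, ρ, η']; push_cast; linear_combination -(b₀ ^ 10 + 3 * b₀ ^ 5 + 9) * b₀5
theorem norm_int (k : ℤ) : Algebra.norm ℤ (k : 𝓞 K) = k ^ 5 := by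
  have := Algebra.norm_algebraMap (S := 𝓞 K) k
  rw [RingOfIntegers.rank, finrankK] at this
  simpa using this
theorem norm_η' : Algebra.norm ℤ η' = 1 := by
  have h := congrArg (Algebra.norm ℤ) ρ5
  have h5 := norm_int 5
  push_cast at h5
  rw [map_pow, map_mul, norm_ρ, h5] at h
  linarith
theorem unit_η' : IsUnit η' := by
  rw [← Ideal.span_singleton_eq_top, ← Ideal.absNorm_eq_one_iff, Ideal.absNorm_span_singleton, norm_η']; rfl

theorem prime_of_norm {π : 𝓞 K} (h : (Algebra.norm ℤ π).natAbs.Prime) : Prime π := by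
  have h0 : π ≠ 0 := by
    rintro rfl; rw [Algebra.norm_zero] at h; exact absurd h (by norm_num)
  rw [← Ideal.span_singleton_prime h0]
  apply Ideal.isPrime_of_irreducible_absNorm
  rw [Ideal.absNorm_span_singleton]; exact h

theorem prime_b₀ : Prime b₀ := prime_of_norm (by rw [norm_b₀]; norm_num)
theorem prime_ρ : Prime ρ := prime_of_norm (by rw [norm_ρ]; norm_num)

theorem exists_p {π : 𝓞 K} (hπ : Prime π) : ∃ p : ℕ, p.Prime ∧ π ∣ (p : 𝓞 K) := by
  have h1 : π ∣ ((Ideal.absNorm (Ideal.span {π}) : ℕ) : 𝓞 K) := Ideal.mem_span_singleton.1 (Ideal.absNorm_mem _)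
  have h0 : Ideal.absNorm (Ideal.span {π}) ≠ 0 := by
    rw [Ne, Ideal.absNorm_eq_zero_iff, Ideal.span_singleton_eq_bot]; exact hπ.ne_zero
  generalize Ideal.absNorm (Ideal.span {π}) = n at *
  rw [← Nat.prod_primeFactorsList h0, Nat.cast_list_prod, hπ.dvd_prod_iff] at h1
  obtain ⟨x, hx, hd⟩ := h1
  rw [List.mem_map] at hx
  obtain ⟨p, hp, rfl⟩ := hx
  exact ⟨p, Nat.prime_of_mem_primeFactorsList hp, hd⟩

theorem sqf_form {t : 𝓞 K} (ht : Squarefree t) (h : ∀ π, Prime π → π ∣ t → π ∣ b₀ ∨ π ∣ ρ) :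
    ∃ (w : (𝓞 K)ˣ) (i j : Fin 2), t = w * b₀ ^ (i:ℕ) * ρ ^ (j:ℕ) := by
  have step : ∀ (ϖ : 𝓞 K), Prime ϖ → ∀ t : 𝓞 K, Squarefree t → ∃ (i : Fin 2) (t' : 𝓞 K), t = ϖ ^ (i:ℕ) * t' ∧ ¬ ϖ ∣ t' := by
    intro ϖ hϖ t ht
    by_cases hd : ϖ ∣ t
    · obtain ⟨t', rfl⟩ := hd
      refine ⟨1, t', by simp, fun h' => ?_⟩
      obtain ⟨t'', rfl⟩ := h'
      exact hϖ.not_isUnit (ht ϖ ⟨t'', by ring⟩)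
    · exact ⟨0, t, by simp, hd⟩
  obtain ⟨i, t1, h1, h1'⟩ := step b₀ prime_b₀ t ht
  have ht1 : Squarefree t1 := ht.squarefree_of_dvd ⟨b₀ ^ (i:ℕ), by rw [h1]; ring⟩
  obtain ⟨j, t2, h2, h2'⟩ := step ρ prime_ρ t1 ht1
  have hu : IsUnit t2 := by
    by_contra hn
    have h0 : t2 ≠ 0 := by
      rintro rfl; simp at h2'
    obtain ⟨π, hπ, hd⟩ := WfDvdMonoid.exists_irreducible_factor hn h0
    have hdt : π ∣ t := by rw [h1, h2]; exact (hd.mul_left _).mul_left _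
    rcases h π hπ.prime hdt with h3 | h3
    · have := (hπ.prime.associated_of_dvd prime_b₀ h3)
      exact h1' (this.symm.dvd.trans (by rw [h2]; exact hd.mul_left _))
    · have := (hπ.prime.associated_of_dvd prime_ρ h3)
      exact h2' (this.symm.dvd.trans hd)
  obtain ⟨w, rfl⟩ := hu
  exact ⟨w, i, j, by rw [h1, h2]; ring⟩

theorem norm_un (i : Fin 4) : Algebra.norm ℤ (un i : 𝓞 K) = 1 := by
  have h : Algebra.norm ℤ (oz (U i)) = 1 := by
    unfold oz
    apply eZ_norm
    fin_cases i <;> decide +kernel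
  exact h

/-- A unit of norm one is one of the four representatives modulo squares. -/
theorem units_norm_one (w : (𝓞 K)ˣ) (hw : Algebra.norm ℤ (w : 𝓞 K) = 1) :
    ∃ (i : Fin 4) (v : 𝓞 K), (w : 𝓞 K) = un i * v ^ 2 := by
  obtain ⟨i, s, v, hs, h⟩ := units_sq w
  rcases hs with rfl | rfl
  · exact ⟨i, v, by rw [h]; simp⟩
  · exfalso
    rw [h] at hw
    simp only [Units.val_mul, Units.val_pow_eq_pow_val, map_mul, map_pow, norm_un, Units.val_neg, Units.val_one] at hw
    have := norm_int (-1)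
    push_cast at this
    rw [this] at hw
    nlinarith [sq_nonneg (Algebra.norm ℤ (v : 𝓞 K))]

theorem NF (a0 a1 a2 b0 b1 m : ℤ) (V : ℤ[X]) (hm : m ≠ 0)
    (ha : ∀ p : ℕ, p.Prime → ¬ ((p:ℤ) ∣ a0 ∧ (p:ℤ) ∣ a1 ∧ (p:ℤ) ∣ a2))
    (hb : ∀ p : ℕ, p.Prime → ¬ ((p:ℤ) ∣ b0 ∧ (p:ℤ) ∣ b1 ∧ (p:ℤ) ∣ m))
    (h : q2 a0 a1 a2 * V = (q2 b0 b1 0) ^ 2 - C (m ^ 2) * fZ) :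
    kap a0 a1 a2 ≠ 0 ∧ ∃ (i : Fin 4) (ξ : K), evz ![kap a0 a1 a2 * a0, kap a0 a1 a2 * a1, kap a0 a1 a2 * a2, 0, 0] = evz (U i) * ξ ^ 2 := by
  have hκ : Algebra.norm ℤ (eZ a0 a1 a2 0 0) = kap a0 a1 a2 := eZ_norm (by exact_mod_cast nf_kap a0 a1 a2)
  have hA : eZ a0 a1 a2 0 0 ≠ 0 := by
    intro h0
    have h1 : oz ![a0, a1, a2, 0, 0] = oz ![0,0,0,0,0] := by
      have : oz ![a0, a1, a2, 0, 0] = eZ a0 a1 a2 0 0 := rfl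
      rw [this, h0]; simp [oz, eZ]
    have h2 : ![a0, a1, a2, 0, 0] = ![0,0,0,0,0] := by
      apply evz_inj; rw [← oz_coe, ← oz_coe, h1]
    have e0 := congrFun h2 0
    have e1 := congrFun h2 1
    have e2 := congrFun h2 2
    simp at e0 e1 e2
    exact ha 2 Nat.prime_two (by simp [e0, e1, e2])
  set κ := kap a0 a1 a2
  have hκ0 : κ ≠ 0 := by rw [← hκ]; exact Algebra.norm_ne_zero_iff.2 hA
  refine ⟨hκ0, ?_⟩
  obtain ⟨s, t, hst, ht⟩ := ex_sqf _ hA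
  obtain ⟨w, i, j, hw⟩ := sqf_form ht (by
    intro π hπ hd
    obtain ⟨p, hp, hpπ⟩ := exists_p hπ
    have h15 : p ∣ 15 := by
      refine core (a := q2 a0 a1 a2) (b := q2 b0 b1 0) (V := V) (m := m) hp hπ hpπ ?_ ?_ hm ?_ ?_ ?_ h
      · rw [q2_eZ]; exact odd_prop hA hst ht hπ hd
      · rw [q2_eZ, hst]; exact hd.mul_left _
      · rw [C_dvd_q2]; exact ha p hp
      · simp [q2]; compute_degree
      · intro h1 h2
        rw [C_dvd_q2] at h2
        exact hb p hp ⟨h2.1, h2.2.1, h1⟩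
    have : p ∣ 3 ∨ p ∣ 5 := hp.dvd_mul.1 (by simpa using h15)
    rcases this with h3 | h3
    · left
      have : π ∣ b₀ ^ 5 := by
        rw [b₀5]; exact hpπ.trans (by exact_mod_cast Nat.cast_dvd_cast h3)
      exact hπ.dvd_of_dvd_pow this
    · right
      have : π ∣ ρ ^ 5 := by
        rw [ρ5]; exact (hpπ.trans (by exact_mod_cast Nat.cast_dvd_cast h3)).mul_right _
      exact hπ.dvd_of_dvd_pow this)
  -- norm of the unit
  have hNw : Algebra.norm ℤ (w : 𝓞 K) = 1 ∨ Algebra.norm ℤ (w : 𝓞 K) = -1 := by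
    exact Int.isUnit_iff.1 (w.isUnit.map (Algebra.norm ℤ))
  obtain ⟨η, hη⟩ := unit_η'
  have hη5 : ρ ^ 5 = 5 * η := by rw [hη, ρ5]
  have h5ρ : (5 : 𝓞 K) * ρ = (η⁻¹ : (𝓞 K)ˣ) * (ρ ^ 3) ^ 2 := by
    have : (η : 𝓞 K) * (η⁻¹ : (𝓞 K)ˣ) = 1 := by simp
    linear_combination (5 * ρ * -this) - (η⁻¹ : (𝓞 K)ˣ) * ρ * hη5
  have h3β : (3 : 𝓞 K) * b₀ = (b₀ ^ 3) ^ 2 := by rw [← b₀5]; ring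
  have hNη : Algebra.norm ℤ ((η⁻¹ : (𝓞 K)ˣ) : 𝓞 K) = 1 := by
    have h1 : Algebra.norm ℤ ((η : 𝓞 K) * (η⁻¹ : (𝓞 K)ˣ)) = 1 := by simp
    rw [map_mul, hη, norm_η', one_mul] at h1; exact h1
  -- κ * A = w' * y^2
  have main : ∃ (w' : (𝓞 K)ˣ) (y : 𝓞 K), Algebra.norm ℤ (w' : 𝓞 K) = 1 ∧ (κ : 𝓞 K) * eZ a0 a1 a2 0 0 = w' * y ^ 2 := by
    have hs : ∃ σ : (𝓞 K)ˣ, (σ : 𝓞 K) = ((Algebra.norm ℤ (w : 𝓞 K) : ℤ) : 𝓞 K) ∧ Algebra.norm ℤ ((σ * w : (𝓞 K)ˣ) : 𝓞 K) = 1 := by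
      rcases hNw with h1 | h1
      · exact ⟨1, by rw [h1]; simp, by simp [h1]⟩
      · refine ⟨-1, by rw [h1]; simp, ?_⟩
        rw [Units.val_mul, map_mul, h1]
        have := norm_int (-1)
        push_cast at this ⊢
        rw [this]; norm_num
    obtain ⟨σ, hσ, hσw⟩ := hs
    refine ⟨σ * w * (η⁻¹) ^ (j:ℕ), s * (Algebra.norm ℤ s : ℤ) * (b₀ ^ 3) ^ (i:ℕ) * (ρ ^ 3) ^ (j:ℕ), ?_, ?_⟩
    · rw [Units.val_mul, map_mul, hσw, Units.val_pow_eq_pow_val, map_pow, hNη]; simp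
    · have hκ2 : (κ : 𝓞 K) = (Algebra.norm ℤ s : ℤ) ^ 2 * (σ * 3 ^ (i:ℕ) * 5 ^ (j:ℕ)) := by
        rw [← hκ, hst, hw]
        simp only [map_mul, map_pow, norm_b₀, norm_ρ]
        push_cast
        rw [← hσ]
      rw [hκ2, hst, hw]
      have e1 : (3 : 𝓞 K) ^ (i:ℕ) * b₀ ^ (i:ℕ) = ((b₀ ^ 3) ^ (i:ℕ)) ^ 2 := by
        rw [← mul_pow, h3β, ← pow_mul, ← pow_mul, ← pow_mul, ← pow_mul]; ring_nf
      have e2 : (5 : 𝓞 K) ^ (j:ℕ) * ρ ^ (j:ℕ) = ((η⁻¹ : (𝓞 K)ˣ) : 𝓞 K) ^ (j:ℕ) * ((ρ ^ 3) ^ (j:ℕ)) ^ 2 := by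
        rw [← mul_pow, h5ρ, mul_pow, ← pow_mul, ← pow_mul, ← pow_mul, ← pow_mul]; ring_nf
      push_cast
      generalize ((η⁻¹ : (𝓞 K)ˣ) : 𝓞 K) ^ (j:ℕ) = z at *
      generalize (b₀ ^ 3) ^ (i:ℕ) = z1 at *
      generalize (ρ ^ 3) ^ (j:ℕ) = z2 at *
      generalize (3 : 𝓞 K) ^ (i:ℕ) = z3 at *
      generalize (5 : 𝓞 K) ^ (j:ℕ) = z4 at *
      linear_combination ((Algebra.norm ℤ s : ℤ) : 𝓞 K) ^ 2 * σ * s ^ 2 * w * (z4 * ρ ^ (j:ℕ) * e1 + z1 ^ 2 * e2)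
  obtain ⟨w', y, hw', hy⟩ := main
  obtain ⟨l, v, hl⟩ := units_norm_one w' hw'
  refine ⟨l, algebraMap (𝓞 K) K (v * y), ?_⟩
  rw [← un_coe, ← map_pow, ← map_mul, mul_pow, ← mul_assoc, ← hl, ← hy, ← oz_coe]
  congr 1
  simp [oz, eZ]; ring
end RP


namespace RP
open Polynomial NumberField

theorem Us_even : ∀ i : Fin 4, ∀ s : Fin 5 → ZMod 2,
    (∀ j, 2 * m5 (fun j => ((U i j : ℤ) : ZMod 4)) (m5 (lift4 s) (lift4 s)) j = 0) → s = 0 := by decide +kernel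

theorem zmod4_even (x : ℤ) (h : (2:ZMod 4) * (x : ZMod 4) = 0) : 2 ∣ x := by
  have : ((2 * x : ℤ) : ZMod 4) = 0 := by push_cast; exact h
  have := (ZMod.intCast_zmod_eq_zero_iff_dvd _ 4).1 this
  omega

theorem odd_kap (i : Fin 4) (c : Fin 5 → ℤ) (hc : ∃ j, ¬ (2 ∣ c j)) (κ : ℤ) (hκ : κ ≠ 0) (ξ : K)
    (h : evz (fun j => κ * c j) = evz (U i) * ξ ^ 2) :
    ∃ (k : ℤ) (s : Fin 5 → ZMod 2), ¬ (2 ∣ k) ∧ (¬ (2 ∣ κ) → k = κ) ∧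
      (fun j => (k : ZMod 4) * (c j : ZMod 4)) = m5 (fun j => (U i j : ZMod 4)) (m5 (lift4 s) (lift4 s)) := by
  have key : ∀ n : ℕ, ∀ κ : ℤ, κ.natAbs = n → κ ≠ 0 → ∀ ξ : K, evz (fun j => κ * c j) = evz (U i) * ξ ^ 2 →
    ∃ (k : ℤ) (s : Fin 5 → ZMod 2), ¬ (2 ∣ k) ∧ (¬ (2 ∣ κ) → k = κ) ∧
      (fun j => (k : ZMod 4) * (c j : ZMod 4)) = m5 (fun j => (U i j : ZMod 4)) (m5 (lift4 s) (lift4 s)) := by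
    intro n
    induction n using Nat.strong_induction_on with
    | _ n ih =>
      intro κ hn hκ ξ h
      obtain ⟨s, hs⟩ := mod4 _ _ _ (UU' i) ξ h
      by_cases h2 : (2:ℤ) ∣ κ
      · obtain ⟨k, rfl⟩ := h2
        have hs0 : s = 0 := by
          apply Us_even i
          intro j
          rw [← congrFun hs j]
          push_cast
          have : (2:ZMod 4) * 2 = 0 := rfl
          linear_combination ((k:ZMod 4) * (c j : ZMod 4)) * this
        subst hs0
        obtain ⟨j, hj⟩ := hc
        have h4 : (2:ℤ) ∣ k := by
          have hz : (m5 (lift4 0) (lift4 0) : Fin 5 → ZMod 4) = 0 := by decide +kernel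
          rw [hz] at hs
          have hz2 : ∀ u : Fin 5 → ZMod 4, m5 u 0 = 0 := by
            intro u; ext j; fin_cases j <;> simp [m5]
          rw [hz2] at hs
          have := congrFun hs j
          have h5 : (2:ZMod 4) * ((k * c j : ℤ) : ZMod 4) = 0 := by
            simpa [mul_assoc] using this
          have := zmod4_even _ h5
          rcases Int.prime_two.dvd_or_dvd this with h | h
          · exact h
          · exact absurd h hj
        obtain ⟨l, rfl⟩ := h4
        have hl : l ≠ 0 := by rintro rfl; simp at hκ
        obtain ⟨k', s, h1, h2, h3⟩ := ih l.natAbs (by omega) l rfl hl (ξ / 2) (by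
          rw [evz_smul] at h ⊢
          push_cast at h
          linear_combination h / 4)
        exact ⟨k', s, h1, fun hh => absurd ⟨2 * l, rfl⟩ hh, h3⟩
      · refine ⟨κ, s, h2, fun _ => rfl, ?_⟩
        rw [← hs]; push_cast; rfl
  exact key _ κ rfl hκ ξ h

def od (k : ZMod 4) : Prop := k = 1 ∨ k = 3
instance (k : ZMod 4) : Decidable (od k) := by unfold od; infer_instance

theorem od_of {k : ℤ} (h : ¬ 2 ∣ k) : od (k : ZMod 4) := by
  have : k % 4 = 1 ∨ k % 4 = 3 := by omega
  rcases this with h | h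
  · left
    have : ((k : ℤ) : ZMod 4) = ((1 : ℤ) : ZMod 4) := (ZMod.intCast_eq_intCast_iff' _ _ _).2 (by simpa using h)
    simpa using this
  · right
    have : ((k : ℤ) : ZMod 4) = ((3 : ℤ) : ZMod 4) := (ZMod.intCast_eq_intCast_iff' _ _ _).2 (by simpa using h)
    simpa using this

theorem of_od {k : ℤ} (h : od (k : ZMod 4)) : ¬ 2 ∣ k := by
  rintro ⟨l, rfl⟩
  have : ∀ x : ZMod 4, ¬ od (2 * x) := by decide
  apply this l
  simpa using h

theorem G1tab : ∀ i : Fin 4, ∀ s : Fin 5 → ZMod 2, ∀ k b0 b1 : ZMod 4, od k → od b1 →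
   ![k * b0 ^ 2, k * (2 * b0 * b1), k * b1 ^ 2, 0, 0] = m5 (fun j => (U i j : ZMod 4)) (m5 (lift4 s) (lift4 s)) → i = 0 := by
  decide +kernel

theorem G2tab : ∀ i : Fin 4, ∀ s : Fin 5 → ZMod 2, ∀ k : ZMod 4, od k →
   ![k, 0, 0, 0, 0] = m5 (fun j => (U i j : ZMod 4)) (m5 (lift4 s) (lift4 s)) → i = 0 := by
  decide +kernel

theorem badtab : ∀ i : Fin 4, ∀ s : Fin 5 → ZMod 2, ∀ c : ZMod 4, od c →
   (∀ k, k = (c^5+3*c^5+9*c^5-15*c*c^3*c+15*c^2*c*c^2) → ![k*c, k*c, k*c, 0, 0] ≠ m5 (fun j => (U i j : ZMod 4)) (m5 (lift4 s) (lift4 s))) ∧ 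
   (∀ k, k = ((2*c)^5+3*(2*c)^5+9*c^5-15*(2*c)*(2*c)^3*c+15*(2*c)^2*(2*c)*c^2) → ![k*(2*c), k*(2*c), k*c, 0, 0] ≠ m5 (fun j => (U i j : ZMod 4)) (m5 (lift4 s) (lift4 s))) := by
  decide +kernel

structure Mum (a0 a1 a2 b0 b1 m v0 v1 v2 v3 v4 : ℤ) : Prop where
  hm : m ≠ 0
  ha : ∀ p : ℤ, Prime p → ¬ (p ∣ a0 ∧ p ∣ a1 ∧ p ∣ a2)
  hb : ∀ p : ℤ, Prime p → ¬ (p ∣ b0 ∧ p ∣ b1 ∧ p ∣ m)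
  e0 : a0 * v0 = b0 ^ 2 + 45 * m ^ 2
  e1 : a0 * v1 + a1 * v0 = 2 * b0 * b1
  e2 : a0 * v2 + a1 * v1 + a2 * v0 = b1 ^ 2
  e3 : a0 * v3 + a1 * v2 + a2 * v1 = 0
  e4 : a0 * v4 + a1 * v3 + a2 * v2 = 0
  e5 : a1 * v4 + a2 * v3 = - 15 * m ^ 2
  e6 : a2 * v4 = 0

noncomputable def V4 (v0 v1 v2 v3 v4 : ℤ) : ℤ[X] := C v4 * X ^ 4 + C v3 * X ^ 3 + C v2 * X ^ 2 + C v1 * X + C v0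

variable {a0 a1 a2 b0 b1 m v0 v1 v2 v3 v4 : ℤ}

theorem Mum.poly (h : Mum a0 a1 a2 b0 b1 m v0 v1 v2 v3 v4) :
    q2 a0 a1 a2 * V4 v0 v1 v2 v3 v4 = (q2 b0 b1 0) ^ 2 - C (m ^ 2) * fZ := by
  have e0 := congrArg (C : ℤ → ℤ[X]) h.e0
  have e1 := congrArg (C : ℤ → ℤ[X]) h.e1
  have e2 := congrArg (C : ℤ → ℤ[X]) h.e2
  have e3 := congrArg (C : ℤ → ℤ[X]) h.e3
  have e4 := congrArg (C : ℤ → ℤ[X]) h.e4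
  have e5 := congrArg (C : ℤ → ℤ[X]) h.e5
  have e6 := congrArg (C : ℤ → ℤ[X]) h.e6
  unfold q2 V4 fZ
  simp only [C_add, C_mul, C_pow, C_0, map_neg] at *
  have c45 : (C 45 : ℤ[X]) = 45 := rfl
  have c15 : (C 15 : ℤ[X]) = 15 := rfl
  have c2 : (C 2 : ℤ[X]) = 2 := rfl
  rw [c45] at e0
  rw [c15] at e5
  rw [c2] at e1
  rw [c45, c15]
  linear_combination e0 + X * e1 + X ^ 2 * e2 + X ^ 3 * e3 + X ^ 4 * e4 + X ^ 5 * e5 + X ^ 6 * e6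

theorem Mum.nf (h : Mum a0 a1 a2 b0 b1 m v0 v1 v2 v3 v4) : kap a0 a1 a2 ≠ 0 ∧
    ∃ (i : Fin 4) (ξ : K), evz (fun j => kap a0 a1 a2 * ![a0, a1, a2, 0, 0] j) = evz (U i) * ξ ^ 2 := by
  obtain ⟨h1, i, ξ, h2⟩ := NF a0 a1 a2 b0 b1 m _ h.hm (by
    intro p hp; simpa using h.ha p (Nat.prime_iff_prime_int.1 (by exact_mod_cast hp))) (by
    intro p hp; simpa using h.hb p (Nat.prime_iff_prime_int.1 (by exact_mod_cast hp))) h.poly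
  refine ⟨h1, i, ξ, ?_⟩
  rw [← h2]; congr 1; ext j; fin_cases j <;> simp
end RP


namespace RP
open Polynomial NumberField
variable {a0 a1 a2 b0 b1 m v0 v1 v2 v3 v4 : ℤ}

theorem zmod4_of {x y : ℤ} (h : (4:ℤ) ∣ x - y) : (x : ZMod 4) = (y : ZMod 4) := by
  rw [ZMod.intCast_eq_intCast_iff_dvd_sub]; 
  have : (((4:ℕ):ℤ)) = 4 := rfl
  rw [this]; omega

theorem four_dvd_of_odd {a x : ℤ} (ha : ¬ 2 ∣ a) (h : 4 ∣ a * x) : 4 ∣ x := by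
  have : IsCoprime (4:ℤ) a := by
    have h2 : IsCoprime (2:ℤ) a := (Int.prime_two.coprime_iff_not_dvd).2 ha
    have := h2.pow_left (m := 2)
    norm_num at this; exact this
  exact this.dvd_of_dvd_mul_left h

theorem two_dvd_of_sq {x : ℤ} (h : 2 ∣ x ^ 2) : 2 ∣ x := Int.prime_two.dvd_of_dvd_pow h

theorem Mum.sq_of_tab (h : Mum a0 a1 a2 b0 b1 m v0 v1 v2 v3 v4)
   (H : ∀ (i : Fin 4) (s : Fin 5 → ZMod 2) (k : ZMod 4), od k → 
     (fun j => k * ((![a0, a1, a2, 0, 0] : Fin 5 → ℤ) j : ZMod 4)) = m5 (fun j => (U i j : ZMod 4)) (m5 (lift4 s) (lift4 s)) → i = 0) :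
   kap a0 a1 a2 ≠ 0 ∧ ∃ ξ : K, (kap a0 a1 a2 : K) * evz ![a0, a1, a2, 0, 0] = ξ ^ 2 := by
  obtain ⟨h1, i, ξ, h2⟩ := h.nf
  have hc : ∃ j, ¬ 2 ∣ (![a0, a1, a2, 0, 0] : Fin 5 → ℤ) j := by
    by_contra! hc
    exact h.ha 2 Int.prime_two ⟨hc 0, hc 1, hc 2⟩
  obtain ⟨k, s, hk, -, hs⟩ := odd_kap i _ hc _ h1 ξ h2
  have := H i s k (od_of hk) hs
  subst this
  refine ⟨h1, ξ, ?_⟩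
  rw [← evz_smul, h2]
  simp [U, evz_one]

theorem Mum.g1_arith (h : Mum a0 a1 a2 b0 b1 m v0 v1 v2 v3 v4) (ha2 : ¬ 2 ∣ a2) (hm2 : 2 ∣ m) :
    v4 = 0 ∧ 4 ∣ v3 ∧ 4 ∣ v2 ∧ 4 ∣ v1 ∧ ¬ 2 ∣ b1 ∧ ¬ 2 ∣ v0 := by
  have h4 : v4 = 0 := by
    rcases mul_eq_zero.1 h.e6 with h | h
    · subst h; simp at ha2
    · exact h
  obtain ⟨n, rfl⟩ := hm2
  have e5 := h.e5; have e4 := h.e4; have e3 := h.e3; have e2 := h.e2; have e0 := h.e0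
  subst h4
  have h3 : 4 ∣ v3 := four_dvd_of_odd ha2 ⟨- 15 * n ^ 2, by linear_combination e5⟩
  have h2 : 4 ∣ v2 := by
    obtain ⟨w, rfl⟩ := h3
    exact four_dvd_of_odd ha2 ⟨- a1 * w, by linear_combination e4⟩
  have h1 : 4 ∣ v1 := by
    obtain ⟨w, rfl⟩ := h3
    obtain ⟨w', rfl⟩ := h2
    exact four_dvd_of_odd ha2 ⟨- a1 * w' - a0 * w, by linear_combination e3⟩
  have hb1 : ¬ 2 ∣ b1 := by
    rintro ⟨c, rfl⟩
    obtain ⟨w, rfl⟩ := h1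
    obtain ⟨w', rfl⟩ := h2
    have : 4 ∣ v0 := four_dvd_of_odd ha2 ⟨c ^ 2 - a1 * w - a0 * w', by linear_combination e2⟩
    obtain ⟨w0, rfl⟩ := this
    have : 2 ∣ b0 := two_dvd_of_sq ⟨2 * a0 * w0 - 45 * 2 * n ^ 2, by linear_combination - e0⟩
    exact h.hb 2 Int.prime_two ⟨this, ⟨c, rfl⟩, ⟨n, rfl⟩⟩
  refine ⟨rfl, h3, h2, h1, hb1, ?_⟩
  rintro ⟨c, rfl⟩
  apply hb1
  obtain ⟨w, rfl⟩ := h1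
  obtain ⟨w', rfl⟩ := h2
  exact two_dvd_of_sq ⟨a0 * (2 * w') + a1 * (2 * w) + a2 * c, by linear_combination - e2⟩

theorem Mum.g1 (h : Mum a0 a1 a2 b0 b1 m v0 v1 v2 v3 v4) (ha2 : ¬ 2 ∣ a2) (hm2 : 2 ∣ m) :
    kap a0 a1 a2 ≠ 0 ∧ ∃ ξ : K, (kap a0 a1 a2 : K) * evz ![a0, a1, a2, 0, 0] = ξ ^ 2 := by
  obtain ⟨h4, ⟨w3, rfl⟩, ⟨w2, rfl⟩, ⟨w1, rfl⟩, hb1, hv0⟩ := h.g1_arith ha2 hm2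
  apply h.sq_of_tab
  intro i s k hk hs
  have sq1 : (v0 : ZMod 4) ^ 2 = 1 := by
    have : ∀ x : ZMod 4, od x → x ^ 2 = 1 := by decide
    exact this _ (od_of hv0)
  obtain ⟨n, rfl⟩ := hm2
  have four : (4 : ZMod 4) = 0 := rfl
  have e0 := congrArg (Int.cast : ℤ → ZMod 4) h.e0
  have e1 := congrArg (Int.cast : ℤ → ZMod 4) h.e1
  have e2 := congrArg (Int.cast : ℤ → ZMod 4) h.e2
  push_cast at e0 e1 e2
  refine G1tab i s (k * v0) b0 b1 ?_ (od_of hb1) ?_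
  · have : ∀ x y : ZMod 4, od x → od y → od (x * y) := by decide
    exact this _ _ hk (od_of hv0)
  · rw [← hs]
    ext j; fin_cases j
    · simp
      linear_combination - k * v0 * e0 + k * a0 * sq1 - 45 * k * v0 * n ^ 2 * four
    · simp
      linear_combination - k * v0 * e1 + k * a1 * sq1 + k * v0 * a0 * w1 * four
    · simp
      linear_combination - k * v0 * e2 + k * a2 * sq1 + k * v0 * (a0 * w2 + a1 * w1) * four
    · simp
    · simp

theorem dvd_scale (B0 B1 m : ℤ) (hm : m ≠ 0) : ∃ (t : ℕ) (B0' B1' m' : ℤ), B0 = 2 ^ t * B0' ∧ B1 = 2 ^ t * B1' ∧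
    m = 2 ^ t * m' ∧ m' ≠ 0 ∧ ¬ (2 ∣ B0' ∧ 2 ∣ B1' ∧ 2 ∣ m') := by
  have key : ∀ n : ℕ, ∀ B0 B1 m : ℤ, m.natAbs = n → m ≠ 0 → ∃ (t : ℕ) (B0' B1' m' : ℤ), B0 = 2 ^ t * B0' ∧ B1 = 2 ^ t * B1' ∧
    m = 2 ^ t * m' ∧ m' ≠ 0 ∧ ¬ (2 ∣ B0' ∧ 2 ∣ B1' ∧ 2 ∣ m') := by
    intro n
    induction n using Nat.strong_induction_on with
    | _ n ih =>
      intro B0 B1 m hn hm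
      by_cases h : (2 ∣ B0 ∧ 2 ∣ B1 ∧ 2 ∣ m)
      · obtain ⟨⟨c0, rfl⟩, ⟨c1, rfl⟩, ⟨n, rfl⟩⟩ := h
        obtain ⟨t, x, y, z, h1, h2, h3, h4⟩ := ih n.natAbs (by omega) c0 c1 n rfl (by rintro rfl; simp at hm)
        exact ⟨t + 1, x, y, z, by rw [h1]; ring, by rw [h2]; ring, by rw [h3]; ring, h4⟩
      · exact ⟨0, B0, B1, m, by simp, by simp, by simp, hm, h⟩
  exact key _ B0 B1 m rfl hm

theorem Mum.g2_arith (h : Mum a0 a1 a2 b0 b1 m v0 v1 v2 v3 v4) (ha2 : 2 ∣ a2) (ha1 : 2 ∣ a1) :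
    ¬ 2 ∣ a0 ∧ 4 ∣ a1 ∧ 4 ∣ a2 ∧ ∃ (t : ℕ) (B0 B1 m' : ℤ), 2 ∣ B0 ∧ ¬ 2 ∣ B1 ∧ 2 ∣ m' ∧ m = 2 ^ t * m' ∧ m' ≠ 0 ∧ 
     - a0 * a1 * b1 + b0 * (a1 ^ 2 - a0 * a2) = 2 ^ t * B1 ∧ - a0 * a2 * b1 + b0 * a1 * a2 = 2 ^ t * B0 := by
  have ha0 : ¬ 2 ∣ a0 := fun h0 => h.ha 2 Int.prime_two ⟨h0, ha1, ha2⟩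
  obtain ⟨t, B0, B1, m', h0, h1, hm, hm0, hn⟩ := dvd_scale (- a0 * a2 * b1 + b0 * a1 * a2) (- a0 * a1 * b1 + b0 * (a1 ^ 2 - a0 * a2)) m h.hm
  have p3 : ∃ p, p = a1 ^ 2 - a0 * a2 := ⟨_, rfl⟩
  obtain ⟨p3, hp3⟩ := p3
  obtain ⟨q3, hq3⟩ : ∃ q, q = a1 * a2 := ⟨_, rfl⟩
  obtain ⟨p4, hp4⟩ : ∃ p, p = - a1 * p3 + a0 * q3 := ⟨_, rfl⟩
  obtain ⟨q4, hq4⟩ : ∃ p, p = - a2 * p3 := ⟨_, rfl⟩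
  obtain ⟨p5, hp5⟩ : ∃ p, p = - a1 * p4 + a0 * q4 := ⟨_, rfl⟩
  obtain ⟨q5, hq5⟩ : ∃ p, p = - a2 * p4 := ⟨_, rfl⟩
  obtain ⟨p6, hp6⟩ : ∃ p, p = - a1 * p5 + a0 * q5 := ⟨_, rfl⟩
  obtain ⟨q6, hq6⟩ : ∃ p, p = - a2 * p5 := ⟨_, rfl⟩
  have hp5e : 2 ∣ p6 := by
    obtain ⟨x, rfl⟩ := ha1
    obtain ⟨y, rfl⟩ := ha2
    rw [hp6, hq5]
    exact ⟨- x * p5 - a0 * y * p4, by ring⟩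
  have hq6e : 4 ∣ q6 := by
    obtain ⟨x, rfl⟩ := ha1
    obtain ⟨y, rfl⟩ := ha2
    rw [hq6, hp5, hq4]
    exact ⟨y * x * p4 + a0 * y * y * p3, by ring⟩
  have E1 : (2 ^ t * B1) * (2 * a0 * (2 ^ t * B0) - a1 * (2 ^ t * B1)) = (2 ^ t * m') ^ 2 * (15 * a0 ^ 5 - 45 * p6) := by
    rw [← h0, ← h1, ← hm]
    subst hp6 hp5 hq5 hp4 hq4 hp3 hq3
    linear_combination - a0 ^ 5 * h.e5 + a0 ^ 4 * a1 * h.e4 - a0 ^ 3 * (a1 ^ 2 - a0 * a2) * h.e3 - a0^2*(-a1^3+2*a0*a1*a2)*h.e2-a0*(a1^4-3*a0*a1^2*a2+a0^2*a2^2)*h.e1-(-a1*(a1^4-3*a0*a1^2*a2+a0^2*a2^2)+a0*(-a2*(-a1^3+2*a0*a1*a2)))*h.e0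
  have E0 : a0 * (2 ^ t * B0) ^ 2 - a2 * (2 ^ t * B1) ^ 2 = (2 ^ t * m') ^ 2 * (- 45 * q6) := by
    rw [← h0, ← h1, ← hm]
    subst hq6 hp5 hp4 hq4 hp3 hq3
    linear_combination - a0 ^ 5 * h.e6 + a0^4*a2*h.e4 - a0 ^ 3 * (a1*a2) * h.e3 - a0^2*(-a2*(a1^2-a0*a2))*h.e2-a0*(-a2*(-a1^3+2*a0*a1*a2))*h.e1-(-a2*(a1^4-3*a0*a1^2*a2+a0^2*a2^2))*h.e0
  have h2t : ((2:ℤ) ^ t) ^ 2 ≠ 0 := by positivity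
  replace E1 : B1 * (2 * a0 * B0 - a1 * B1) = m' ^ 2 * (15 * a0 ^ 5 - 45 * p6) := by
    apply mul_left_cancel₀ h2t; linear_combination E1
  replace E0 : a0 * B0 ^ 2 - a2 * B1 ^ 2 = m' ^ 2 * (- 45 * q6) := by
    apply mul_left_cancel₀ h2t; linear_combination E0
  clear hp6 hp5 hq5 hp4 hq4 hp3 hq3 hq6
  have hm' : 2 ∣ m' := by
    by_contra hm'
    obtain ⟨x, rfl⟩ := ha1
    obtain ⟨y, rfl⟩ := hp5e
    have : 2 ∣ m' ^ 2 * (15 * a0 ^ 5) := ⟨45 * m' ^ 2 * y + B1 * (a0 * B0 - x * B1), by linear_combination - E1⟩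
    rcases Int.prime_two.dvd_or_dvd this with h | h
    · exact hm' (two_dvd_of_sq h)
    · rcases Int.prime_two.dvd_or_dvd h with h | h
      · omega
      · exact ha0 (Int.prime_two.dvd_of_dvd_pow h)
  have hB0 : 2 ∣ B0 := by
    obtain ⟨y, rfl⟩ := ha2
    obtain ⟨n, rfl⟩ := hm'
    have : 2 ∣ a0 * B0 ^ 2 := ⟨y * B1 ^ 2 - 2 * n ^ 2 * 45 * q6, by linear_combination E0⟩
    rcases Int.prime_two.dvd_or_dvd this with h | h
    · exact absurd h ha0
    · exact two_dvd_of_sq h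
  have hB1 : ¬ 2 ∣ B1 := fun h => hn ⟨hB0, h, hm'⟩
  have hB12 : ¬ 2 ∣ B1 ^ 2 := fun h => hB1 (two_dvd_of_sq h)
  refine ⟨ha0, ?_, ?_, t, B0, B1, m', hB0, hB1, hm', hm, hm0, h1, h0⟩
  · obtain ⟨n, rfl⟩ := hm'
    obtain ⟨c, rfl⟩ := hB0
    exact four_dvd_of_odd hB12 ⟨B1 * a0 * c - n ^ 2 * (15 * a0 ^ 5 - 45 * p6), by linear_combination - E1⟩
  · obtain ⟨n, rfl⟩ := hm'
    obtain ⟨c, rfl⟩ := hB0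
    exact four_dvd_of_odd hB12 ⟨a0 * c ^ 2 + n ^ 2 * (45 * q6), by linear_combination - E0⟩

theorem Mum.g2 (h : Mum a0 a1 a2 b0 b1 m v0 v1 v2 v3 v4) (ha2 : 2 ∣ a2) (ha1 : 2 ∣ a1) :
    kap a0 a1 a2 ≠ 0 ∧ ∃ ξ : K, (kap a0 a1 a2 : K) * evz ![a0, a1, a2, 0, 0] = ξ ^ 2 := by
  obtain ⟨h0, ⟨x, rfl⟩, ⟨y, rfl⟩, -⟩ := h.g2_arith ha2 ha1
  apply h.sq_of_tab
  intro i s k hk hs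
  have four : (4 : ZMod 4) = 0 := rfl
  refine G2tab i s (k * a0) ?_ ?_
  · have : ∀ x y : ZMod 4, od x → od y → od (x * y) := by decide
    exact this _ _ hk (od_of h0)
  · rw [← hs]
    ext j; fin_cases j <;> simp [four]

theorem hens (a0 a1 a2 : ℤ) (h0 : 2 ∣ a0) (h1 : ¬ 2 ∣ a1) (k : ℕ) : ∃ e : ℤ, 2 ∣ e ∧ 2 ^ (k + 1) ∣ a2 * e ^ 2 + a1 * e + a0 := by
  induction k with
  | zero => exact ⟨0, by simp, by simpa using h0⟩
  | succ k ih =>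
    obtain ⟨e, he, c, hc⟩ := ih
    have h1' : ∃ d, a1 = 2 * d + 1 := ⟨a1 / 2, by omega⟩
    obtain ⟨d, rfl⟩ := h1'
    refine ⟨e + 2 ^ (k + 1) * c, ?_, ?_⟩
    · exact dvd_add he ⟨2 ^ k * c, by ring⟩
    · refine ⟨a2 * e * c + 2 ^ k * a2 * c ^ 2 + c * (d + 1), ?_⟩
      rw [pow_succ] at hc ⊢
      linear_combination hc

theorem sqno (t : ℕ) : ∀ (n m F : ℤ), ¬ 2 ∣ m → F % 8 = 3 → ¬ 2 ^ (2 * t + 3) ∣ n ^ 2 - 4 ^ t * m ^ 2 * F := by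
  induction t with
  | zero =>
    intro n m F hm hF h
    obtain ⟨c, hc⟩ := h
    obtain ⟨d, hd⟩ : ∃ d, F = 8 * d + 3 := ⟨F / 8, by omega⟩
    obtain ⟨w, rfl⟩ : ∃ w, m = 2 * w + 1 := ⟨m / 2, by omega⟩
    subst hd
    rcases Int.even_or_odd' n with ⟨u, rfl | rfl⟩
    · have : 4 * (u ^ 2 - (w ^ 2 + w) * (8 * d + 3) - 2 * d - 2 * c) = 3 := by linear_combination hc
      omega
    · have : 4 * (u ^ 2 + u - (w ^ 2 + w) * (8 * d + 3) - 2 * d - 2 * c) = 2 := by linear_combination hc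
      omega
  | succ t ih =>
    intro n m F hm hF ⟨c, hc⟩
    have : 2 ∣ n := two_dvd_of_sq ⟨2 ^ (2 * t + 4) * c + 2 * 4 ^ t * m ^ 2 * F, by
      rw [show 2 * (t + 1) + 3 = 2 * t + 4 + 1 by ring, pow_succ, pow_succ] at hc; linear_combination hc⟩
    obtain ⟨n, rfl⟩ := this
    refine ih n m F hm hF ⟨c, ?_⟩
    have : (4:ℤ) ≠ 0 := by norm_num
    apply mul_left_cancel₀ this
    rw [show 2 * (t + 1) + 3 = 2 * t + 3 + 2 by ring, pow_add, pow_succ] at hc; linear_combination hc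

theorem Mum.no_x (h : Mum a0 a1 a2 b0 b1 m v0 v1 v2 v3 v4) (h0 : 2 ∣ a0) (h1 : ¬ 2 ∣ a1) : False := by
  obtain ⟨t, x, y, m', hx, hy, hm, hm0, hn⟩ := dvd_scale 0 0 m h.hm
  have h2 : (2:ℤ) ^ t ≠ 0 := by positivity
  have hx0 : x = 0 := by
    rcases mul_eq_zero.1 hx.symm with h | h
    · exact absurd h h2
    · exact h
  have hy0 : y = 0 := by
    rcases mul_eq_zero.1 hy.symm with h | h
    · exact absurd h h2
    · exact h
  have hm' : ¬ 2 ∣ m' := fun h => hn ⟨by simp [hx0], by simp [hy0], h⟩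
  obtain ⟨e, ⟨e', he⟩, c, hc⟩ := hens a0 a1 a2 h0 h1 (2 * t + 2)
  apply sqno t (b0 + b1 * e) m' (15 * e ^ 5 - 45) hm'
  · have : 15 * e ^ 5 - 45 = 8 * (15 * 4 * e' ^ 5 - 6) + 3 := by rw [he]; ring
    omega
  · refine ⟨c * (v4 * e ^ 4 + v3 * e ^ 3 + v2 * e ^ 2 + v1 * e + v0), ?_⟩
    have e0 := h.e0; have e5 := h.e5
    have h4 : (4:ℤ) ^ t = (2 ^ t) ^ 2 := by rw [← pow_mul, mul_comm, pow_mul]; norm_num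
    rw [hm] at e0 e5
    rw [h4]
    linear_combination - e0 - e * h.e1 - e ^ 2 * h.e2 - e ^ 3 * h.e3 - e ^ 4 * h.e4 - e ^ 5 * e5 - e ^ 6 * h.e6 + (v4 * e ^ 4 + v3 * e ^ 3 + v2 * e ^ 2 + v1 * e + v0) * hc

theorem typtab : ∀ a2 m a0 a1 b1 b0 : ZMod 4, od a2 → od m → 
   let v3 := a2 * (-15 * m ^ 2)
   let v2 := - a2 * a1 * v3
   let v1 := - a2 * (a0 * v3 + a1 * v2)
   let v0 := a2 * (b1 ^ 2 - a0 * v2 - a1 * v1)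
   a0 * v1 + a1 * v0 = 2 * b0 * b1 → a0 * v0 = b0 ^ 2 + 45 * m ^ 2 → 
   (a0 = a2 ∧ a1 = a2) ∨ (a0 = 2 * a2 ∧ a1 = 2 * a2) := by decide +kernel

theorem Mum.no_modd (h : Mum a0 a1 a2 b0 b1 m v0 v1 v2 v3 v4) (ha2 : ¬ 2 ∣ a2) (hm2 : ¬ 2 ∣ m) : False := by
  have h4 : v4 = 0 := by
    rcases mul_eq_zero.1 h.e6 with h | h
    · subst h; simp at ha2
    · exact h
  have sq1 : (a2 : ZMod 4) ^ 2 = 1 := by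
    have : ∀ x : ZMod 4, od x → x ^ 2 = 1 := by decide
    exact this _ (od_of ha2)
  have e0 := congrArg (Int.cast : ℤ → ZMod 4) h.e0
  have e1 := congrArg (Int.cast : ℤ → ZMod 4) h.e1
  have e2 := congrArg (Int.cast : ℤ → ZMod 4) h.e2
  have e3 := congrArg (Int.cast : ℤ → ZMod 4) h.e3
  have e4 := congrArg (Int.cast : ℤ → ZMod 4) h.e4
  have e5 := congrArg (Int.cast : ℤ → ZMod 4) h.e5
  subst h4
  push_cast at e0 e1 e2 e3 e4 e5
  have hv3 : (v3 : ZMod 4) = a2 * (-15 * m ^ 2) := by linear_combination (a2 : ZMod 4) * e5 - v3 * sq1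
  have hv2 : (v2 : ZMod 4) = - a2 * a1 * (a2 * (-15 * m ^ 2)) := by
    rw [← hv3]; linear_combination (a2 : ZMod 4) * e4 - v2 * sq1
  have hv1 : (v1 : ZMod 4) = - a2 * (a0 * (a2 * (-15 * m ^ 2)) + a1 * (- a2 * a1 * (a2 * (-15 * m ^ 2)))) := by
    rw [← hv2, ← hv3]; linear_combination (a2 : ZMod 4) * e3 - v1 * sq1
  have hv0 : (v0 : ZMod 4) = a2 * (b1 ^ 2 - a0 * (- a2 * a1 * (a2 * (-15 * m ^ 2))) - a1 * (- a2 * (a0 * (a2 * (-15 * m ^ 2)) + a1 * (- a2 * a1 * (a2 * (-15 * m ^ 2)))))) := by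
    rw [← hv1, ← hv2]; linear_combination (a2 : ZMod 4) * e2 - v0 * sq1
  have T := typtab a2 m a0 a1 b1 b0 (od_of ha2) (od_of hm2)
  simp only at T
  rw [← hv0, ← hv1] at T
  replace T := T e1 e0
  obtain ⟨hκ, i, ξ, hx⟩ := h.nf
  have hc : ∃ j, ¬ 2 ∣ (![a0, a1, a2, 0, 0] : Fin 5 → ℤ) j := ⟨2, ha2⟩
  obtain ⟨k, s, hk, hkk, hs⟩ := odd_kap i _ hc _ hκ ξ hx
  obtain ⟨b1', b2'⟩ := badtab i s a2 (od_of ha2)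
  have odk : ¬ 2 ∣ kap a0 a1 a2 := by
    apply of_od
    unfold kap
    push_cast
    have : ∀ c : ZMod 4, od c → od (c^5+3*c^5+9*c^5-15*c*c^3*c+15*c^2*c*c^2) ∧ od ((2*c)^5+3*(2*c)^5+9*c^5-15*(2*c)*(2*c)^3*c+15*(2*c)^2*(2*c)*c^2) := by decide +kernel
    rcases T with ⟨t0, t1⟩ | ⟨t0, t1⟩
    · rw [t0, t1]; exact (this _ (od_of ha2)).1
    · rw [t0, t1]; exact (this _ (od_of ha2)).2
  have hk2 := hkk odk
  rcases T with ⟨t0, t1⟩ | ⟨t0, t1⟩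
  · refine b1' (k : ZMod 4) ?_ ?_
    · rw [hk2]; unfold kap; push_cast; rw [t0, t1]
    · rw [← hs]; ext j; fin_cases j <;> simp [t0, t1]
  · refine b2' (k : ZMod 4) ?_ ?_
    · rw [hk2]; unfold kap; push_cast; rw [t0, t1]
    · rw [← hs]; ext j; fin_cases j <;> simp [t0, t1]

theorem Mum.types (h : Mum a0 a1 a2 b0 b1 m v0 v1 v2 v3 v4) :
    (¬ 2 ∣ a2 ∧ 2 ∣ m) ∨ (2 ∣ a2 ∧ 2 ∣ a1) ∨ (2 ∣ a2 ∧ ¬ 2 ∣ a1 ∧ ¬ 2 ∣ a0) := by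
  by_cases h2 : 2 ∣ a2
  · by_cases h1 : 2 ∣ a1
    · exact Or.inr (Or.inl ⟨h2, h1⟩)
    · exact Or.inr (Or.inr ⟨h2, h1, fun h0 => h.no_x h0 h1⟩)
  · by_cases hm : 2 ∣ m
    · exact Or.inl ⟨h2, hm⟩
    · exact (h.no_modd h2 hm).elim
end RP


namespace RP
open Polynomial NumberField

section gen
variable {A B : Type*} [CommRing A] [CommRing B]

def mapQ (φ : A →+* B) (f : A) (g : B) (h : φ f = g) : QuadraticAlgebra A f 0 →+* QuadraticAlgebra B g 0 where
  toFun P := ⟨φ P.re, φ P.im⟩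
  map_one' := by ext <;> simp [QuadraticAlgebra.re_one, QuadraticAlgebra.im_one]
  map_zero' := by ext <;> simp
  map_add' := by intro x y; ext <;> simp
  map_mul' := by intro x y; ext <;> simp [h]

end gen

section dom
variable {k : Type*} [CommRing k] [IsDomain k]

theorem deg_ne {f A B : k[X]} (hf : Odd f.natDegree) (hA : A ≠ 0) (hB : B ≠ 0) : (A * A).natDegree ≠ (f * B * B).natDegree := by
  have hf0 : f ≠ 0 := by rintro rfl; simp at hf
  rw [natDegree_mul hA hA, natDegree_mul (mul_ne_zero hf0 hB) hB, natDegree_mul hf0 hB]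
  obtain ⟨j, hj⟩ := hf
  omega

theorem norm_ne_zero {f : k[X]} (hf : Odd f.natDegree) {P : QuadraticAlgebra k[X] f 0} (h : P.norm = 0) : P = 0 := by
  have hf0 : f ≠ 0 := by rintro rfl; simp at hf
  rw [QuadraticAlgebra.norm_def] at h
  have h' : P.re * P.re = f * P.im * P.im := by linear_combination h
  by_cases hA : P.re = 0
  · rw [hA] at h'
    have : P.im = 0 := by simpa [hf0] using h'
    ext1 <;> simp [*]
  · by_cases hB : P.im = 0
    · rw [hB] at h'
      exact absurd (by simpa using h') hA
    · exact absurd (congrArg natDegree h') (deg_ne hf hA hB)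

theorem qdom {f : k[X]} (hf : Odd f.natDegree) : IsDomain (QuadraticAlgebra k[X] f 0) := by
  have : NoZeroDivisors (QuadraticAlgebra k[X] f 0) := ⟨by
    intro x y h
    have := congrArg QuadraticAlgebra.norm h
    rw [map_mul, QuadraticAlgebra.norm_zero] at this
    rcases mul_eq_zero.1 this with h | h
    · exact Or.inl (norm_ne_zero hf h)
    · exact Or.inr (norm_ne_zero hf h)⟩
  exact NoZeroDivisors.to_isDomain _
end dom

noncomputable def toQ : ℤ[X] →+* ℚ[X] := mapRingHom (Int.castRingHom ℚ)
noncomputable def red : ℤ[X] →+* (ZMod 2)[X] := mapRingHom (Int.castRingHom (ZMod 2))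
noncomputable def fQ : ℚ[X] := toQ fZ
noncomputable def f2 : (ZMod 2)[X] := red fZ

@[simp] theorem toQ_C (n : ℤ) : toQ (C n) = C (n : ℚ) := by
  unfold toQ; exact map_C _
@[simp] theorem toQ_X : toQ X = X := by simp [toQ]
@[simp] theorem red_C (n : ℤ) : red (C n) = C (n : ZMod 2) := by
  unfold red; exact map_C _
@[simp] theorem red_X : red X = X := by simp [red]
theorem toQ_coeff (p : ℤ[X]) (i : ℕ) : (toQ p).coeff i = (p.coeff i : ℚ) := by simp [toQ]
theorem red_coeff (p : ℤ[X]) (i : ℕ) : (red p).coeff i = (p.coeff i : ZMod 2) := by simp [red]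

theorem fZ_deg : fZ.natDegree = 5 := by
  unfold fZ; compute_degree!
theorem fZ_lead : fZ.leadingCoeff = 15 := by
  rw [leadingCoeff, fZ_deg]; simp only [fZ, coeff_sub, coeff_C_mul, coeff_X_pow, coeff_C]; norm_num
theorem fQ_eq : fQ = C 15 * X ^ 5 - C 45 := by
  simp only [fQ, fZ, map_sub, map_mul, map_pow, toQ_C, toQ_X]; norm_num
theorem f2_eq : f2 = X ^ 5 + 1 := by
  have h15 : ((15 : ℤ) : ZMod 2) = 1 := rfl
  have h45 : ((45 : ℤ) : ZMod 2) = -1 := rfl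
  simp only [f2, fZ, map_sub, map_mul, map_pow, red_C, red_X, h15, h45]
  rw [C_neg, C_1]; ring
theorem fQ_deg : fQ.natDegree = 5 := by rw [fQ_eq]; compute_degree!
theorem f2_deg : f2.natDegree = 5 := by rw [f2_eq]; compute_degree!
theorem fQ_odd : Odd fQ.natDegree := by rw [fQ_deg]; decide
theorem f2_odd : Odd f2.natDegree := by rw [f2_deg]; decide
theorem fZ_odd : Odd fZ.natDegree := by rw [fZ_deg]; decide

abbrev QA := QuadraticAlgebra ℤ[X] fZ 0
abbrev R := QuadraticAlgebra ℚ[X] fQ 0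
abbrev R2 := QuadraticAlgebra (ZMod 2)[X] f2 0

instance : IsDomain R := qdom fQ_odd
instance : IsDomain R2 := qdom f2_odd
instance : IsDomain QA := qdom fZ_odd

noncomputable def eQ : QA →+* R := mapQ toQ fZ fQ rfl
noncomputable def rQ : QA →+* R2 := mapQ red fZ f2 rfl
noncomputable abbrev ι : ℚ[X] →+* R := algebraMap ℚ[X] R
noncomputable abbrev ιZ : ℤ[X] →+* QA := algebraMap ℤ[X] QA

section
variable (P : QA)
@[simp] theorem eQ_re : (eQ P).re = toQ P.re := rfl
@[simp] theorem eQ_im : (eQ P).im = toQ P.im := rfl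
@[simp] theorem rQ_re : (rQ P).re = red P.re := rfl
@[simp] theorem rQ_im : (rQ P).im = red P.im := rfl
theorem eQ_norm : (eQ P).norm = toQ P.norm := by
  rw [QuadraticAlgebra.norm_def, QuadraticAlgebra.norm_def]; simp [fQ]
theorem rQ_norm : (rQ P).norm = red P.norm := by
  rw [QuadraticAlgebra.norm_def, QuadraticAlgebra.norm_def]; simp [f2]
theorem eQ_star : eQ (star P) = star (eQ P) := by ext <;> simp
theorem rQ_star : rQ (star P) = star (rQ P) := by ext <;> simp
theorem eQ_alg (a : ℤ[X]) : eQ (ιZ a) = ι (toQ a) := by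
  ext1
  · rfl
  · exact map_zero toQ
theorem rQ_alg (a : ℤ[X]) : rQ (ιZ a) = algebraMap _ R2 (red a) := by
  ext1
  · rfl
  · exact map_zero red
theorem eQ_inj : Function.Injective eQ := by
  have toQ_inj : Function.Injective toQ := map_injective _ Int.cast_injective
  intro x y hxy
  ext1
  · exact toQ_inj (congrArg QuadraticAlgebra.re hxy)
  · exact toQ_inj (congrArg QuadraticAlgebra.im hxy)
end

theorem toQ_inj : Function.Injective toQ := map_injective _ Int.cast_injective

theorem red_zero {p : ℤ[X]} (h : red p = 0) : ∃ q, p = C 2 * q := by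
  have : (C 2 : ℤ[X]) ∣ p := by
    rw [C_dvd_iff_dvd_coeff]
    intro i
    have := congrArg (fun q => coeff q i) h
    simp only [red_coeff, coeff_zero] at this
    exact (ZMod.intCast_zmod_eq_zero_iff_dvd _ 2).1 this
  exact this

theorem red_C2 : red (C 2) = 0 := by rw [red_C, show ((2:ℤ) : ZMod 2) = 0 from rfl, C_0]

theorem rQ_zero {P : QA} (h : rQ P = 0) : ∃ Q, P = ιZ (C 2) * Q := by
  obtain ⟨a, ha⟩ := red_zero (congrArg QuadraticAlgebra.re h)
  obtain ⟨b, hb⟩ := red_zero (congrArg QuadraticAlgebra.im h)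
  refine ⟨⟨a, b⟩, ?_⟩
  ext1 <;> simp [*]

theorem odd_intCast2 {p : ℤ} (hp : ¬ 2 ∣ p) : ((p : ℤ) : ZMod 2) = 1 := by
  have h0 : ((p : ℤ) : ZMod 2) ≠ 0 := fun h => hp ((ZMod.intCast_zmod_eq_zero_iff_dvd _ 2).1 h)
  have : ∀ x : ZMod 2, x ≠ 0 → x = 1 := by decide
  exact this _ h0

theorem red_odd {p : ℤ} (hp : ¬ 2 ∣ p) : red (C p) = 1 := by
  rw [red_C, odd_intCast2 hp, C_1]

/-- if `A = c B` rationally with both nonzero mod 2, then c is a ratio of odd integers -/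
theorem ratio {A B : QA} (hA : rQ A ≠ 0) (hB : rQ B ≠ 0) {c : ℚ} (h : eQ A = ι (C c) * eQ B) :
    ∃ p q : ℤ, ¬ 2 ∣ p ∧ ¬ 2 ∣ q ∧ ιZ (C p) * A = ιZ (C q) * B := by
  have e : ιZ (C (c.den : ℤ)) * A = ιZ (C c.num) * B := by
    have hc : (c.den : ℚ) * c = c.num := Rat.den_mul_eq_num c
    apply eQ_inj
    rw [map_mul, map_mul, h, ← mul_assoc, eQ_alg, eQ_alg, ← map_mul, toQ_C, toQ_C, ← C_mul, Int.cast_natCast, hc]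
  have e2 := congrArg rQ e
  rw [map_mul, map_mul] at e2
  have h0 : ∀ n : ℤ, 2 ∣ n → rQ (ιZ (C n)) = 0 := by
    rintro n ⟨k, rfl⟩
    rw [rQ_alg, C_mul, map_mul, red_C2, zero_mul, map_zero]
  have h1 : ∀ n : ℤ, ¬ 2 ∣ n → rQ (ιZ (C n)) = 1 := by
    intro n hn
    rw [rQ_alg, red_odd hn, map_one]
  refine ⟨c.den, c.num, ?_, ?_, e⟩
  · intro hd
    have hn : ¬ 2 ∣ c.num := by
      intro hn
      have := c.reduced
      have h2 : 2 ∣ c.num.natAbs := by omega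
      have h3 : 2 ∣ c.den := by omega
      have := Nat.dvd_gcd h2 h3
      rw [c.reduced] at this
      omega
    rw [h0 _ hd, h1 _ hn, zero_mul, one_mul] at e2
    exact hB e2.symm
  · intro hn
    have hd : ¬ (2:ℤ) ∣ c.den := by
      intro hd
      have h2 : 2 ∣ c.num.natAbs := by omega
      have h3 : 2 ∣ c.den := by omega
      have := Nat.dvd_gcd h2 h3
      rw [c.reduced] at this
      omega
    rw [h1 _ hd, h0 _ hn, zero_mul, one_mul] at e2
    exact hA e2

theorem ratioP {A B : ℤ[X]} (hA : red A ≠ 0) (hB : red B ≠ 0) {c : ℚ} (h : toQ A = C c * toQ B) :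
    ∃ p q : ℤ, ¬ 2 ∣ p ∧ ¬ 2 ∣ q ∧ C p * A = C q * B := by
  obtain ⟨p, q, hp, hq, h⟩ := ratio (A := ιZ A) (B := ιZ B) (c := c) (fun h => hA (congrArg QuadraticAlgebra.re h))
    (fun h => hB (congrArg QuadraticAlgebra.re h)) (by
      rw [eQ_alg, eQ_alg, h, map_mul])
  refine ⟨p, q, hp, hq, ?_⟩
  have := congrArg QuadraticAlgebra.re h
  simpa using this

theorem int_mult (p : ℚ[X]) : ∃ n : ℤ, n ≠ 0 ∧ ∃ q : ℤ[X], toQ q = C (n:ℚ) * p := by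
  obtain ⟨b, hb, h⟩ := IsLocalization.integerNormalization_spec (nonZeroDivisors ℤ) p
  refine ⟨b, by simpa using hb, _, h.trans ?_⟩
  ext i
  simp

theorem div_two (P : QA) (hP : P ≠ 0) : ∃ (t : ℕ) (Q : QA), P = ιZ (C (2 ^ t)) * Q ∧ rQ Q ≠ 0 := by
  obtain ⟨i, hi⟩ : ∃ i, ¬ (P.re.coeff i = 0 ∧ P.im.coeff i = 0) := by
    by_contra! h
    apply hP
    ext i
    · simpa using (h i).1
    · simpa using (h i).2
  have key : ∀ n : ℕ, ∀ P : QA, (P.re.coeff i).natAbs + (P.im.coeff i).natAbs = n → ¬ (P.re.coeff i = 0 ∧ P.im.coeff i = 0) →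
      ∃ (t : ℕ) (Q : QA), P = ιZ (C (2 ^ t)) * Q ∧ rQ Q ≠ 0 := by
    intro n
    induction n using Nat.strong_induction_on with
    | _ n ih =>
      intro P hn h
      by_cases hr : rQ P = 0
      · obtain ⟨Q, rfl⟩ := rQ_zero hr
        have e1 : (ιZ (C 2) * Q).re = C 2 * Q.re := by simp
        have e2 : (ιZ (C 2) * Q).im = C 2 * Q.im := by simp
        rw [e1, e2, coeff_C_mul, coeff_C_mul] at hn h
        obtain ⟨t, Q', h1, h2⟩ := ih _ (by omega) Q rfl (by omega)
        refine ⟨t + 1, Q', ?_, h2⟩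
        conv_lhs => rw [h1]
        rw [← mul_assoc, ← map_mul, ← C_mul, pow_succ']
      · exact ⟨0, P, by simp, hr⟩
  exact key _ P rfl hi

theorem primitive (x : R) (hx : x ≠ 0) : ∃ (c : ℚ) (P : QA), c ≠ 0 ∧ rQ P ≠ 0 ∧ eQ P = ι (C c) * x := by
  obtain ⟨n1, h1, q1, e1⟩ := int_mult x.re
  obtain ⟨n2, h2, q2, e2⟩ := int_mult x.im
  have h12 : (n1 : ℚ) * n2 ≠ 0 := by exact_mod_cast mul_ne_zero h1 h2
  have hP : eQ ⟨C n2 * q1, C n1 * q2⟩ = ι (C ((n1 : ℚ) * n2)) * x := by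
    ext1
    · simp only [eQ_re, map_mul, toQ_C, e1]; simp; ring
    · simp only [eQ_im, map_mul, toQ_C, e2]; simp; ring
  obtain ⟨t, Q, h3, h4⟩ := div_two ⟨C n2 * q1, C n1 * q2⟩ (by
    intro h
    rw [h, map_zero] at hP
    rcases mul_eq_zero.1 hP.symm with h | h
    · have := congrArg QuadraticAlgebra.re h
      rw [QuadraticAlgebra.algebraMap_re, QuadraticAlgebra.re_zero, C_eq_zero] at this
      exact h12 this
    · exact hx h)
  refine ⟨(n1 : ℚ) * n2 / 2 ^ t, Q, by positivity, h4, ?_⟩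
  rw [h3, map_mul, eQ_alg, toQ_C] at hP
  have h2t : ((2:ℚ) ^ t) ≠ 0 := by positivity
  have : ι (C ((2:ℚ) ^ t)) ≠ 0 := by
    intro h
    have := congrArg QuadraticAlgebra.re h
    rw [QuadraticAlgebra.algebraMap_re, QuadraticAlgebra.re_zero, C_eq_zero] at this
    exact h2t this
  apply mul_left_cancel₀ this
  push_cast at hP
  rw [hP, ← mul_assoc, ← map_mul, ← C_mul]
  congr 3
  field_simp
end RP


namespace RP
open Polynomial NumberField
open QuadraticAlgebra (norm)

def SS (P : QA) : Prop := red P.re ≠ 0 ∧ red P.im = 0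
def Inn (P : QA) : Prop := ¬ 2 ∣ P.re.leadingCoeff ∧ red P.im = 0 ∧ (P.im = 0 ∨ P.im.natDegree + 3 ≤ P.re.natDegree)
def Out (P : QA) : Prop := red P.re = 1 ∧ red P.im = 0

structure Ell {T : Type*} [AddCommGroup T] (ℓ : QA → T) : Prop where
  mul : ∀ P Q, SS P → SS Q → ℓ (P * Q) = ℓ P + ℓ Q
  poly : ∀ p, red p ≠ 0 → ℓ (ιZ p) = 0
  inner : ∀ P, Inn P → ℓ P = 0
  outer : ∀ P, Out P → ℓ P = 0

variable {T : Type*} [AddCommGroup T] {ℓ : QA → T}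

theorem red_lead {p : ℤ[X]} (h : ¬ 2 ∣ p.leadingCoeff) : red p ≠ 0 := by
  intro h0
  have := congrArg (fun q => coeff q p.natDegree) h0
  simp only [red_coeff, coeff_zero] at this
  exact h ((ZMod.intCast_zmod_eq_zero_iff_dvd _ 2).1 this)

theorem SS.mul {P Q : QA} (hP : SS P) (hQ : SS Q) : SS (P * Q) := by
  refine ⟨?_, ?_⟩
  · simp [hP.2, hQ.2, hP.1, hQ.1]
  · simp [hP.2, hQ.2]
theorem SS.star {P : QA} (hP : SS P) : SS (star P) := by
  refine ⟨?_, ?_⟩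
  · simpa using hP.1
  · simpa using hP.2
theorem SS.alg {p : ℤ[X]} (h : red p ≠ 0) : SS (ιZ p) := by
  refine ⟨?_, ?_⟩
  · simpa using h
  · simp
theorem Inn.ss {P : QA} (h : Inn P) : SS P := ⟨red_lead h.1, h.2.1⟩
theorem Out.ss {P : QA} (h : Out P) : SS P := ⟨by rw [h.1]; exact one_ne_zero, h.2⟩
theorem SS.rQ {P : QA} (h : SS P) : rQ P ≠ 0 := fun h0 => h.1 (congrArg QuadraticAlgebra.re h0)
theorem SS.norm {P : QA} (h : SS P) : red (norm P) ≠ 0 := by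
  rw [QuadraticAlgebra.norm_def]
  simp [h.1, h.2]

theorem Ell.star (H : Ell ℓ) {P : QA} (hP : SS P) : ℓ (star P) = - ℓ P := by
  have h1 := H.mul P (Star.star P) hP hP.star
  rw [← QuadraticAlgebra.algebraMap_norm_eq_mul_star, H.poly _ hP.norm] at h1
  exact (neg_eq_of_add_eq_zero_right h1.symm).symm

def Good (ℓ : QA → T) (I : Ideal R) (a : ℚ[X]) (v : T) : Prop :=
  ∃ (P Q : QA) (d e n r : ℤ[X]) (κ κ' : ℚ), SS P ∧ SS Q ∧ red d ≠ 0 ∧ red e ≠ 0 ∧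
    (∀ x ∈ I, ι (toQ d) ∣ eQ P * x) ∧ (∀ x ∈ I, ι (toQ e) ∣ eQ Q * x) ∧ κ ≠ 0 ∧ κ' ≠ 0 ∧
    norm (eQ P) * a = C κ * toQ (d ^ 2 * n) ∧ norm (eQ Q) * a = C κ' * toQ (e ^ 2 * r) ∧
    ¬ 2 ∣ n.leadingCoeff ∧ red r = 1 ∧ v = ℓ Q - ℓ P

theorem mul_dvd_ideal {I J : Ideal R} {p q d e : R} (h1 : ∀ x ∈ I, d ∣ p * x) (h2 : ∀ x ∈ J, e ∣ q * x) :
    ∀ x ∈ I * J, d * e ∣ (p * q) * x := by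
  intro x hx
  induction hx using Submodule.mul_induction_on' with
  | mem_mul_mem m hm n hn =>
    have := mul_dvd_mul (h1 m hm) (h2 n hn)
    rwa [show p * m * (q * n) = p * q * (m * n) by ring] at this
  | add x hx y hy h h' => rw [mul_add]; exact dvd_add h h'

theorem Good.mul (H : Ell ℓ) {I J : Ideal R} {a b : ℚ[X]} {v w : T} (h1 : Good ℓ I a v) (h2 : Good ℓ J b w) :
    Good ℓ (I * J) (a * b) (v + w) := by
  obtain ⟨P, Q, d, e, n, r, κ, κ', c1, c2, c3, c4, c5, c6, c7, c8, c9, c10, c11, c12, c13⟩ := h1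
  obtain ⟨P', Q', d', e', n', r', l, l', c1', c2', c3', c4', c5', c6', c7', c8', c9', c10', c11', c12', c13'⟩ := h2
  refine ⟨P * P', Q * Q', d * d', e * e', n * n', r * r', κ * l, κ' * l', c1.mul c1', c2.mul c2', ?_, ?_, ?_, ?_, ?_, ?_, ?_, ?_, ?_, ?_, ?_⟩
  · rw [map_mul]; exact mul_ne_zero c3 c3'
  · rw [map_mul]; exact mul_ne_zero c4 c4'
  · rw [map_mul, map_mul, map_mul]; exact mul_dvd_ideal c5 c5'
  · rw [map_mul, map_mul, map_mul]; exact mul_dvd_ideal c6 c6'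
  · exact mul_ne_zero c7 c7'
  · exact mul_ne_zero c8 c8'
  · simp only [map_mul, map_pow] at c9 c9' ⊢
    linear_combination norm (eQ P') * b * c9 + C κ * (toQ d ^ 2 * toQ n) * c9'
  · simp only [map_mul, map_pow] at c10 c10' ⊢
    linear_combination norm (eQ Q') * b * c10 + C κ' * (toQ e ^ 2 * toQ r) * c10'
  · rw [leadingCoeff_mul]; intro h
    rcases Int.prime_two.dvd_or_dvd h with h | h
    · exact c11 h
    · exact c11' h
  · rw [map_mul, c12, c12', one_mul]
  · rw [c13, c13', H.mul _ _ c1 c1', H.mul _ _ c2 c2']; abel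

noncomputable def cj (I : Ideal R) : Ideal R := I.map (starRingEnd R)

theorem mem_cj {I : Ideal R} {x : R} : x ∈ cj I ↔ star x ∈ I := by
  constructor
  · intro h
    have h2 := Ideal.mem_map_of_mem (starRingEnd R) h
    rw [cj, Ideal.map_map] at h2
    have : (starRingEnd R).comp (starRingEnd R) = RingHom.id R := by ext1 x; simp
    rw [this, Ideal.map_id] at h2
    exact h2
  · intro h
    have h2 := Ideal.mem_map_of_mem (starRingEnd R) h
    rw [starRingEnd_apply, star_star] at h2
    exact h2

theorem Good.cj (H : Ell ℓ) {I : Ideal R} {a : ℚ[X]} {v : T} (h1 : Good ℓ I a v) : Good ℓ (cj I) a (- v) := by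
  obtain ⟨P, Q, d, e, n, r, κ, κ', c1, c2, c3, c4, c5, c6, c7, c8, c9, c10, c11, c12, c13⟩ := h1
  have hd : ∀ (p : ℚ[X]) (x : R), ι p ∣ x → ι p ∣ star x := by
    rintro p x ⟨y, rfl⟩
    refine ⟨star y, ?_⟩
    rw [star_mul', ]
    congr 1
    ext1 <;> simp
  refine ⟨star P, star Q, d, e, n, r, κ, κ', c1.star, c2.star, c3, c4, ?_, ?_, c7, c8, ?_, ?_, c11, c12, ?_⟩
  · intro x hx
    have := hd _ _ (c5 _ (mem_cj.1 hx))
    rwa [star_mul', star_star, ← eQ_star] at this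
  · intro x hx
    have := hd _ _ (c6 _ (mem_cj.1 hx))
    rwa [star_mul', star_star, ← eQ_star] at this
  · rw [eQ_star, QuadraticAlgebra.norm_star, c9]
  · rw [eQ_star, QuadraticAlgebra.norm_star, c10]
  · rw [c13, H.star c1, H.star c2]; abel

theorem Good.top (H : Ell ℓ) : Good ℓ ⊤ 1 (0:T) := by
  refine ⟨1, 1, 1, 1, 1, 1, 1, 1, ?_, ?_, ?_, ?_, ?_, ?_, ?_, ?_, ?_, ?_, ?_, ?_, ?_⟩ <;> try simp [SS, QuadraticAlgebra.re_one, QuadraticAlgebra.im_one]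

theorem Out_of {G : QA} (h : red (norm G) = 1) : Out G := by
  rw [QuadraticAlgebra.norm_def] at h
  simp only [map_sub, map_add, map_mul, map_zero, zero_mul, add_zero] at h
  rw [show red fZ = f2 from rfl] at h
  have hB : red G.im = 0 := by
    by_contra hB
    have hf0 : f2 ≠ 0 := by intro h; have := f2_deg; rw [h] at this; simp at this
    have hA : red G.re ≠ 0 := by
      intro hA
      have h1 : f2 * red G.im * red G.im = - 1 := by rw [hA] at h; linear_combination - h
      have := congrArg natDegree h1
      rw [natDegree_mul (mul_ne_zero hf0 hB) hB, natDegree_mul hf0 hB, f2_deg, natDegree_neg, natDegree_one] at this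
      omega
    have hne := deg_ne f2_odd hA hB
    have hle : (f2 * red G.im * red G.im).natDegree ≥ 5 := by
      rw [natDegree_mul (mul_ne_zero hf0 hB) hB, natDegree_mul hf0 hB, f2_deg]; omega
    have := congrArg natDegree h
    rw [natDegree_one] at this
    rcases lt_or_gt_of_ne hne with hl | hl
    · rw [natDegree_sub_eq_right_of_natDegree_lt hl] at this; omega
    · rw [natDegree_sub_eq_left_of_natDegree_lt hl] at this; omega
  refine ⟨?_, hB⟩
  rw [hB] at h
  have h2 : (red G.re - 1) * (red G.re - 1) = 0 := by
    have two : (2 : (ZMod 2)[X]) = 0 := by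
      exact CharTwo.two_eq_zero
    linear_combination h + (1 - red G.re) * two
  exact sub_eq_zero.1 (mul_self_eq_zero.1 h2)

theorem Inn_of {F : QA} (h : ¬ 2 ∣ (norm F).leadingCoeff) (hB : red F.im = 0) : Inn F := by
  rw [QuadraticAlgebra.norm_def] at h
  simp only [zero_mul, add_zero] at h
  have hf0 : fZ ≠ 0 := by intro h; have := fZ_deg; rw [h] at this; simp at this
  by_cases hB0 : F.im = 0
  · refine ⟨?_, hB, Or.inl hB0⟩
    rw [hB0] at h
    simp only [mul_zero, sub_zero, leadingCoeff_mul] at h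
    intro h2; exact h (Dvd.dvd.mul_right h2 _)
  · have hl2 : 2 ∣ F.im.leadingCoeff := by
      have := congrArg (fun q => coeff q F.im.natDegree) hB
      simp only [red_coeff, coeff_zero] at this
      exact (ZMod.intCast_zmod_eq_zero_iff_dvd _ 2).1 this
    have hlB : 2 ∣ (fZ * F.im * F.im).leadingCoeff := by
      rw [leadingCoeff_mul]; exact Dvd.dvd.mul_left hl2 _
    by_cases hA : F.re = 0
    · rw [hA] at h
      simp only [mul_zero, zero_sub, leadingCoeff_neg] at h
      exact absurd ((dvd_neg).2 hlB) h
    · have hne := deg_ne fZ_odd hA hB0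
      rcases lt_or_gt_of_ne hne with hl | hl
      · rw [leadingCoeff_sub_of_degree_lt' (degree_lt_degree hl)] at h
        exact absurd ((dvd_neg).2 hlB) h
      · rw [leadingCoeff_sub_of_degree_lt (degree_lt_degree hl), leadingCoeff_mul] at h
        refine ⟨fun h2 => h (Dvd.dvd.mul_right h2 _), hB, Or.inr ?_⟩
        rw [natDegree_mul hA hA, natDegree_mul (mul_ne_zero hf0 hB0) hB0, natDegree_mul hf0 hB0, fZ_deg] at hl
        omega

theorem ι_inj {p q : ℚ[X]} (h : ι p = ι q) : p = q := congrArg QuadraticAlgebra.re h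

theorem red_ne_toQ {p : ℤ[X]} (h : red p ≠ 0) : toQ p ≠ 0 := by
  intro h0
  have : p = 0 := toQ_inj (by rw [h0, map_zero])
  rw [this, map_zero] at h; exact h rfl

/-- helper: quotient function -/
theorem quot (P : QA) (d n : ℤ[X]) (hP : SS P) (hd : red d ≠ 0) (hn : red n ≠ 0) (h : R) (hh : h ≠ 0) (hdvd : ι (toQ d) ∣ eQ P * h)
    (a : ℚ[X]) (κ l : ℚ) (hN : norm h = C l * a) (hPa : norm (eQ P) * a = C κ * toQ (d ^ 2 * n)) :
    ∃ (F : QA) (c : ℚ) (p q : ℤ), rQ F ≠ 0 ∧ c ≠ 0 ∧ ¬ 2 ∣ p ∧ ¬ 2 ∣ q ∧ C p * norm F = C q * n ∧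
      eQ (ιZ d) * eQ F = ι (C c) * (eQ P * h) := by
  obtain ⟨F0, hF0⟩ := hdvd
  have hePne : eQ P ≠ 0 := by
    intro h0; exact hP.rQ (by rw [eQ_inj (h0.trans (map_zero eQ).symm), map_zero])
  have hF0ne : F0 ≠ 0 := by
    rintro rfl
    rw [mul_zero] at hF0
    exact (mul_ne_zero hePne hh) hF0
  obtain ⟨c, F, hc, hF, he⟩ := primitive F0 hF0ne
  have hN2 : toQ (norm F) = C (c ^ 2 * l * κ) * toQ n := by
    rw [← eQ_norm, he, map_mul, QuadraticAlgebra.norm_algebraMap]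
    have h1 := congrArg QuadraticAlgebra.norm hF0
    rw [map_mul, map_mul, QuadraticAlgebra.norm_algebraMap, hN] at h1
    have hd2 : toQ d ^ 2 ≠ 0 := pow_ne_zero _ (red_ne_toQ hd)
    apply mul_left_cancel₀ hd2
    simp only [map_mul, map_pow] at hPa ⊢
    linear_combination - C c ^ 2 * h1 + C c ^ 2 * C l * hPa
  have hnF : red (norm F) ≠ 0 := by
    rw [← rQ_norm]; intro h0; exact hF (norm_ne_zero f2_odd h0)
  obtain ⟨p, q, hp, hq, hpq⟩ := ratioP hnF hn hN2
  refine ⟨F, c, p, q, hF, hc, hp, hq, hpq, ?_⟩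
  rw [he, hF0, eQ_alg]; ring

theorem Good.close (H : Ell ℓ) {I : Ideal R} {a : ℚ[X]} {v : T} (h1 : Good ℓ I a v) (h : R) (hI : h ∈ I) (hh : h ≠ 0)
    (l : ℚ) (hN : norm h = C l * a) : v = 0 := by
  obtain ⟨P, Q, d, e, n, r, κ, κ', c1, c2, c3, c4, c5, c6, c7, c8, c9, c10, c11, c12, c13⟩ := h1
  have hr : red r ≠ 0 := by rw [c12]; exact one_ne_zero
  obtain ⟨F, cF, p, q, f1, f2, f3, f4, f5, f6⟩ := quot P d n c1 c3 (red_lead c11) h hh (c5 h hI) a κ l hN c9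
  obtain ⟨G, cG, p', q', g1, g2, g3, g4, g5, g6⟩ := quot Q e r c2 c4 hr h hh (c6 h hI) a κ' l hN c10
  have hG : Out G := by
    apply Out_of
    have := congrArg red g5
    rwa [map_mul, map_mul, red_odd g3, red_odd g4, c12, one_mul, one_mul] at this
  have hd' := (SS.alg c3).rQ
  have he' := (SS.alg c4).rQ
  -- relation
  have hrel : eQ (ιZ d * F * Q) = ι (C (cF / cG)) * eQ (ιZ e * G * P) := by
    have hcc : ι (C (cF / cG)) * ι (C cG) = ι (C cF) := by
      rw [← map_mul, ← C_mul]; congr 2; field_simp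
    rw [map_mul, map_mul, map_mul, map_mul, f6, g6]
    linear_combination - (eQ Q * h * eQ P) * hcc
  obtain ⟨s, t, hs, ht, hst⟩ := ratio (A := ιZ d * F * Q) (B := ιZ e * G * P) (by
      rw [map_mul, map_mul]; exact mul_ne_zero (mul_ne_zero hd' f1) c2.rQ) (by
      rw [map_mul, map_mul]; exact mul_ne_zero (mul_ne_zero he' g1) c1.rQ) hrel
  have hsC : red (C s) ≠ 0 := by rw [red_odd hs]; exact one_ne_zero
  have htC : red (C t) ≠ 0 := by rw [red_odd ht]; exact one_ne_zero
  have hRHS : SS (ιZ (C t) * (ιZ e * G * P)) := (SS.alg htC).mul (((SS.alg c4).mul hG.ss).mul c1)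
  have hFim : red F.im = 0 := by
    have h2 := hRHS.2
    rw [← hst] at h2
    have h3 : red ((ιZ (C s) * (ιZ d * F * Q)).im) = red (C s) * (red d * red F.im * red Q.re) := by
      have : red Q.im = 0 := c2.2
      simp [this]
    rw [h3] at h2
    have h4 := c2.1
    simp only [mul_eq_zero] at h2
    tauto
  have hF : Inn F := by
    apply Inn_of _ hFim
    have := congrArg leadingCoeff f5
    rw [leadingCoeff_mul, leadingCoeff_mul, leadingCoeff_C, leadingCoeff_C] at this
    intro h2
    have h3 : 2 ∣ q * n.leadingCoeff := by rw [← this]; exact Dvd.dvd.mul_left h2 _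
    rcases Int.prime_two.dvd_or_dvd h3 with h | h
    · exact f4 h
    · exact c11 h
  have := congrArg ℓ hst
  rw [H.mul _ _ (SS.alg hsC) (((SS.alg c3).mul hF.ss).mul c2), H.mul _ _ ((SS.alg c3).mul hF.ss) c2, H.mul _ _ (SS.alg c3) hF.ss,
    H.mul _ _ (SS.alg htC) (((SS.alg c4).mul hG.ss).mul c1), H.mul _ _ ((SS.alg c4).mul hG.ss) c1, H.mul _ _ (SS.alg c4) hG.ss,
    H.poly _ hsC, H.poly _ htC, H.poly _ c3, H.poly _ c4, H.inner _ hF, H.outer _ hG] at this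
  rw [c13]
  simp only [zero_add] at this
  rw [this, sub_self]
end RP


namespace RP
open Polynomial NumberField
open QuadraticAlgebra (norm)

variable {T : Type*} [AddCommGroup T] {ℓ : QA → T}

noncomputable def gy (b : ℚ[X]) : R := ⟨-b, 1⟩
noncomputable def Iab (a b : ℚ[X]) : Ideal R := Ideal.span {ι a, gy b}

theorem mem_Iab_a (a b : ℚ[X]) : ι a ∈ Iab a b := Ideal.subset_span (by simp)
theorem mem_Iab_g (a b : ℚ[X]) : gy b ∈ Iab a b := Ideal.subset_span (by simp)

theorem Iab_le {a b : ℚ[X]} {J : Ideal R} (h1 : ι a ∈ J) (h2 : gy b ∈ J) : Iab a b ≤ J := by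
  rw [Iab, Ideal.span_le]
  rintro x (rfl | rfl)
  · exact h1
  · exact h2

theorem gy_add (b c : ℚ[X]) : gy (b + c) = gy b - ι c := by
  unfold gy; ext1 <;> simp; ring
theorem gy_star_mul (b : ℚ[X]) : star (gy b) * gy b = ι (b ^ 2 - fQ) := by
  unfold gy; ext1 <;> simp [-map_pow, -map_sub]; ring
theorem gy_norm (b : ℚ[X]) : norm (gy b) = b ^ 2 - fQ := by
  unfold gy; rw [QuadraticAlgebra.norm_def]; simp; ring
theorem gy_sq (b : ℚ[X]) : gy b * gy b = - ι (C 2 * b) * gy b - ι (b ^ 2 - fQ) := by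
  unfold gy
  have two : (C 2 : ℚ[X]) = 2 := rfl
  ext1
  · simp [-map_pow, -map_sub]; linear_combination -b ^ 2 * two
  · simp [-map_pow, -map_sub]; linear_combination b * two
theorem gy_star (b : ℚ[X]) : star (gy b) = - gy (-b) := by
  unfold gy; ext1 <;> simp
theorem star_ι (a : ℚ[X]) : star (ι a) = ι a := by ext1 <;> simp
theorem gy_ne (b : ℚ[X]) : gy b ≠ 0 := fun h => one_ne_zero (congrArg QuadraticAlgebra.im h)

theorem Iab_congr_le {a b b' : ℚ[X]} (h : a ∣ b - b') : Iab a b' ≤ Iab a b := by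
  obtain ⟨q, hq⟩ := h
  refine Iab_le (mem_Iab_a _ _) ?_
  rw [show b' = b + - (a * q) by rw [← hq]; ring, gy_add, map_neg, map_mul]
  exact sub_mem (mem_Iab_g _ _) (neg_mem (Ideal.mul_mem_right _ _ (mem_Iab_a _ _)))

theorem Iab_congr {a b b' : ℚ[X]} (h : a ∣ b - b') : Iab a b = Iab a b' :=
  le_antisymm (Iab_congr_le (by rw [← neg_sub]; exact (dvd_neg).2 h)) (Iab_congr_le h)

theorem Iab_scale {a b : ℚ[X]} {c : ℚ} (hc : c ≠ 0) : Iab (C c * a) b = Iab a b := by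
  apply le_antisymm
  · refine Iab_le ?_ (mem_Iab_g _ _)
    rw [map_mul]; exact Ideal.mul_mem_left _ _ (mem_Iab_a _ _)
  · refine Iab_le ?_ (mem_Iab_g _ _)
    have := Ideal.mul_mem_left (Iab (C c * a) b) (ι (C c⁻¹)) (mem_Iab_a _ _)
    rwa [← map_mul, ← mul_assoc, ← C_mul, inv_mul_cancel₀ hc, C_1, one_mul] at this

theorem Iab_mul_le (a1 a2 b : ℚ[X]) : Iab a1 b * Iab a2 b ≤ Iab (a1 * a2) b := by
  rw [Iab, Iab, Ideal.span_pair_mul_span_pair, Ideal.span_le]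
  rintro x (rfl | rfl | rfl | rfl)
  · rw [← map_mul]; exact mem_Iab_a _ _
  · exact Ideal.mul_mem_left _ _ (mem_Iab_g _ _)
  · exact Ideal.mul_mem_right _ _ (mem_Iab_g _ _)
  · exact Ideal.mul_mem_right _ _ (mem_Iab_g _ _)

theorem cj_Iab (a b : ℚ[X]) : cj (Iab a b) = Iab a (-b) := by
  rw [cj, Iab, Ideal.map_span, Set.image_pair, starRingEnd_apply, starRingEnd_apply, star_ι, gy_star, Iab]
  apply le_antisymm
  · rw [Ideal.span_le]
    rintro x (rfl | rfl)
    · exact Ideal.subset_span (by simp)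
    · exact neg_mem (Ideal.subset_span (by simp))
  · rw [Ideal.span_le]
    rintro x (rfl | rfl)
    · exact Ideal.subset_span (by simp)
    · rw [← neg_neg (gy (-b))]
      exact neg_mem (Ideal.subset_span (by simp))

theorem Good.anti {I J : Ideal R} {a : ℚ[X]} {v : T} (h : Good ℓ J a v) (hIJ : I ≤ J) : Good ℓ I a v := by
  obtain ⟨P, Q, d, e, n, r, κ, κ', c1, c2, c3, c4, c5, c6, c7⟩ := h
  exact ⟨P, Q, d, e, n, r, κ, κ', c1, c2, c3, c4, fun x hx => c5 x (hIJ hx), fun x hx => c6 x (hIJ hx), c7⟩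

theorem Good.scale {I : Ideal R} {a : ℚ[X]} {v : T} (h : Good ℓ I a v) {c : ℚ} (hc : c ≠ 0) : Good ℓ I (C c * a) v := by
  obtain ⟨P, Q, d, e, n, r, κ, κ', c1, c2, c3, c4, c5, c6, c7, c8, c9, c10, c11, c12, c13⟩ := h
  refine ⟨P, Q, d, e, n, r, c * κ, c * κ', c1, c2, c3, c4, c5, c6, mul_ne_zero hc c7, mul_ne_zero hc c8, ?_, ?_, c11, c12, c13⟩
  · rw [C_mul]; linear_combination C c * c9
  · rw [C_mul]; linear_combination C c * c10

theorem Iab_dvd {a b : ℚ[X]} {D p : R} (h1 : D ∣ p * ι a) (h2 : D ∣ p * gy b) : ∀ x ∈ Iab a b, D ∣ p * x := by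
  have : Iab a b ≤ (Ideal.span {D}).colon {p} := by
    refine Iab_le ?_ ?_
    · rw [Submodule.mem_colon_singleton, Ideal.mem_span_singleton, smul_eq_mul, mul_comm]; exact h1
    · rw [Submodule.mem_colon_singleton, Ideal.mem_span_singleton, smul_eq_mul, mul_comm]; exact h2
  intro x hx
  have := this hx
  rwa [Submodule.mem_colon_singleton, Ideal.mem_span_singleton, smul_eq_mul, mul_comm] at this

variable {a0 a1 a2 b0 b1 m v0 v1 v2 v3 v4 : ℤ}

theorem Ell.one (H : Ell ℓ) : ℓ 1 = 0 := by
  have := H.poly 1 (by rw [map_one]; exact one_ne_zero)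
  rwa [map_one] at this

theorem SS.one : SS 1 := by simp [SS, QuadraticAlgebra.re_one, QuadraticAlgebra.im_one]

theorem red_even {p : ℤ} (h : 2 ∣ p) : red (C p) = 0 := by
  obtain ⟨k, rfl⟩ := h
  rw [C_mul, map_mul, red_C2, zero_mul]

theorem toQ_ι_ne {c : ℚ} (hc : c ≠ 0) : ι (C c) ≠ 0 := by
  intro h
  have := congrArg QuadraticAlgebra.re h
  rw [QuadraticAlgebra.algebraMap_re, QuadraticAlgebra.re_zero, C_eq_zero] at this
  exact hc this

noncomputable def bQ (b0 b1 m : ℤ) : ℚ[X] := C (m : ℚ)⁻¹ * toQ (q2 b0 b1 0)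

theorem bQ_mul (hm : m ≠ 0) : C (m : ℚ) * bQ b0 b1 m = toQ (q2 b0 b1 0) := by
  rw [bQ, ← mul_assoc, ← C_mul, mul_inv_cancel₀ (by exact_mod_cast hm), C_1, one_mul]

theorem Mum.polyQ (h : Mum a0 a1 a2 b0 b1 m v0 v1 v2 v3 v4) :
    toQ (q2 a0 a1 a2) * toQ (V4 v0 v1 v2 v3 v4) = C (m:ℚ) ^ 2 * ((bQ b0 b1 m) ^ 2 - fQ) := by
  have := congrArg toQ h.poly
  rw [map_mul, map_sub, map_pow, map_mul, toQ_C, ← bQ_mul h.hm, ← show fQ = toQ fZ from rfl] at this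
  rw [this]; push_cast; rw [C_pow]; ring

theorem Mum.good1 (H : Ell ℓ) (h : Mum a0 a1 a2 b0 b1 m v0 v1 v2 v3 v4) (ha2 : ¬ 2 ∣ a2) (hm2 : 2 ∣ m) :
    Good ℓ (Iab (toQ (q2 a0 a1 a2)) (bQ b0 b1 m)) (toQ (q2 a0 a1 a2)) (ℓ ⟨q2 b0 b1 0, C m⟩) := by
  obtain ⟨h4, w3, w2, w1, hb1, hv0⟩ := h.g1_arith ha2 hm2
  have hlc : (q2 a0 a1 a2).leadingCoeff = a2 := leadingCoeff_quadratic (by rintro rfl; simp at ha2)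
  have hlc' : ¬ 2 ∣ (q2 a0 a1 a2).leadingCoeff := by rwa [hlc]
  have hmQ : (m:ℚ) ≠ 0 := by exact_mod_cast h.hm
  have hQ : eQ ⟨q2 b0 b1 0, C m⟩ = - ι (C (m:ℚ)) * star (gy (bQ b0 b1 m)) := by
    ext1
    · rw [eQ_re]
      show toQ (q2 b0 b1 0) = _
      rw [← bQ_mul h.hm, gy]; simp
    · rw [eQ_im]
      show toQ (C m) = _
      rw [toQ_C, gy]; simp
  refine ⟨1, ⟨q2 b0 b1 0, C m⟩, 1, q2 a0 a1 a2, q2 a0 a1 a2, V4 v0 v1 v2 v3 v4, 1, 1, SS.one, ⟨?_, ?_⟩, ?_, red_lead hlc', ?_, ?_, one_ne_zero, one_ne_zero, ?_, ?_, hlc', ?_, ?_⟩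
  · intro h
    have := congrArg (fun p => coeff p 1) h
    simp only [red_coeff, coeff_zero] at this
    rw [ZMod.intCast_zmod_eq_zero_iff_dvd] at this
    simp only [q2, coeff_add, coeff_C_mul, coeff_X, coeff_C, coeff_X_pow] at this
    norm_num at this
    exact hb1 this
  · exact red_even hm2
  · rw [map_one]; exact one_ne_zero
  · intro x hx; rw [map_one, map_one]; exact one_dvd _
  · apply Iab_dvd
    · exact Dvd.intro_left _ rfl
    · rw [hQ, mul_assoc, gy_star_mul]
      have := congrArg ι h.polyQ
      rw [map_mul, map_mul, map_pow] at this
      refine ⟨- ι (C (m:ℚ)⁻¹) * ι (toQ (V4 v0 v1 v2 v3 v4)), ?_⟩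
      have hmm : ι (C (m:ℚ)⁻¹) * ι (C (m:ℚ)) = 1 := by
        rw [← map_mul, ← C_mul, inv_mul_cancel₀ hmQ, C_1, map_one]
      linear_combination ι (C (m:ℚ)⁻¹) * this + ι (C (m:ℚ)) * ι (bQ b0 b1 m ^ 2 - fQ) * hmm
  · rw [map_one, map_one, C_1, one_pow, one_mul, one_mul, one_mul]
  · rw [eQ_norm, QuadraticAlgebra.norm_def, C_1, one_mul, ← map_mul]
    congr 1
    have := h.poly
    rw [C_pow] at this
    simp only [zero_mul, add_zero]
    linear_combination - q2 a0 a1 a2 * this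
  · have two : (2:ℤ) ∣ 4 := by norm_num
    rw [V4, h4]
    simp only [map_add, map_mul, map_pow, red_odd hv0, red_even (two.trans w1), red_even (two.trans w2), red_even (two.trans w3), C_0, map_zero]
    ring
  · rw [H.one, sub_zero]

theorem Mum.good2 (H : Ell ℓ) (h : Mum a0 a1 a2 b0 b1 m v0 v1 v2 v3 v4) (ha2 : 2 ∣ a2) (ha1 : 2 ∣ a1) 
    {t : ℕ} {B0 B1 m' : ℤ} (w1 : 2 ∣ B0) (w2 : ¬ 2 ∣ B1) (w3 : 2 ∣ m') (w4 : m = 2 ^ t * m') 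
    (w6 : - a0 * a1 * b1 + b0 * (a1 ^ 2 - a0 * a2) = 2 ^ t * B1) (w7 : - a0 * a2 * b1 + b0 * a1 * a2 = 2 ^ t * B0) :
    Good ℓ (Iab (toQ (q2 a0 a1 a2)) (bQ b0 b1 m)) (toQ (q2 a0 a1 a2)) (- ℓ ⟨C B1 * X ^ 2 + C B0 * X ^ 3, C (a0 ^ 2 * m')⟩) := by
  have ha0 : ¬ 2 ∣ a0 := fun h0 => h.ha 2 Int.prime_two ⟨h0, ha1, ha2⟩
  have hmQ : (m:ℚ) ≠ 0 := by exact_mod_cast h.hm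
  have hra : red (q2 a0 a1 a2) = 1 := by
    rw [q2]; simp only [map_add, map_mul, map_pow, red_odd ha0, red_even ha1, red_even ha2]; ring
  have hra0 : red (q2 a0 a1 a2) ≠ 0 := by rw [hra]; exact one_ne_zero
  obtain ⟨q, hq⟩ : ∃ q, q = C (a0 * b0) + C (a0 * b1 - a1 * b0) * X := ⟨_, rfl⟩
  obtain ⟨S, hS⟩ : ∃ S, S = C B1 * X ^ 2 + C B0 * X ^ 3 := ⟨_, rfl⟩
  have key : C (a0 ^ 2) * q2 b0 b1 0 = q * q2 a0 a1 a2 + C (2 ^ t) * S := by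
    have e6 := congrArg (C : ℤ → ℤ[X]) w6
    have e7 := congrArg (C : ℤ → ℤ[X]) w7
    rw [hq, hS, q2, q2]
    simp only [C_mul, C_add, C_sub, C_pow, C_neg, C_0] at e6 e7 ⊢
    linear_combination X ^ 2 * e6 + X ^ 3 * e7
  obtain ⟨W, hW⟩ : ∃ W, W = C (a0 ^ 4) * V4 v0 v1 v2 v3 v4 - C (2 * a0 ^ 2) * q2 b0 b1 0 * q + q ^ 2 * q2 a0 a1 a2 := ⟨_, rfl⟩
  have hnW : C 2 ^ (2 * t) * (S ^ 2 - C (a0 ^ 2 * m') ^ 2 * fZ) = q2 a0 a1 a2 * W := by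
    have hp := h.poly
    have two : (C 2 : ℤ[X]) = 2 := rfl
    have hm := congrArg (C : ℤ → ℤ[X]) w4
    rw [hW]
    simp only [C_mul, C_pow] at hm key hp ⊢
    rw [pow_mul, ← pow_mul, mul_comm 2 t, pow_mul]
    linear_combination - C a0 ^ 4 * hp - (C a0 ^2 * q2 b0 b1 0 - q * q2 a0 a1 a2 + C 2 ^ t * S) * key + C a0 ^ 4 * fZ * (C m + C 2 ^ t * C m') * hm + C a0 ^ 2 * q2 b0 b1 0 * q * q2 a0 a1 a2 * two
  have hC2 : Prime (C (2:ℤ)) := Polynomial.prime_C_iff.2 Int.prime_two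
  obtain ⟨n, hn⟩ : C 2 ^ (2 * t) ∣ W := by
    have hnd : ¬ C 2 ∣ q2 a0 a1 a2 := by
      rintro ⟨z, hz⟩
      apply hra0; rw [hz, map_mul, red_C2, zero_mul]
    exact hC2.pow_dvd_of_dvd_mul_left (2 * t) hnd ⟨_, hnW.symm⟩
  have hN : S ^ 2 - C (a0 ^ 2 * m') ^ 2 * fZ = q2 a0 a1 a2 * n := by
    apply mul_left_cancel₀ (pow_ne_zero (2 * t) hC2.ne_zero)
    rw [hnW, hn]; ring
  have hrS : red S = X ^ 2 := by
    rw [hS]; simp only [map_add, map_mul, map_pow, red_odd w2, red_even w1, red_X]; ring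
  have hrm : red (C (a0 ^ 2 * m')) = 0 := red_even (Dvd.dvd.mul_left w3 _)
  have hrn : red n = X ^ 4 := by
    have := congrArg red hN
    rw [map_sub, map_mul red, map_mul red, hra, map_pow, map_pow, hrS, hrm] at this
    linear_combination -this
  have hndeg : n.natDegree ≤ 4 := by
    have hWd : W.natDegree ≤ 4 := by
      rw [hW, hq, q2, q2, V4]
      compute_degree
    rw [hn, ← C_pow, natDegree_C_mul (pow_ne_zero _ two_ne_zero)] at hWd
    exact hWd
  have hn4 : ¬ 2 ∣ n.coeff 4 := by
    have := congrArg (fun p => coeff p 4) hrn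
    simp only [red_coeff, coeff_X_pow] at this
    intro hh
    rw [(ZMod.intCast_zmod_eq_zero_iff_dvd _ 2).2 hh] at this
    simp at this
  have hnl : ¬ 2 ∣ n.leadingCoeff := by
    have : n.natDegree = 4 := le_antisymm hndeg (le_natDegree_of_ne_zero (by intro h0; rw [h0] at hn4; simp at hn4))
    rw [leadingCoeff, this]; exact hn4
  rw [← hS]
  have h2t : ((2:ℚ)^t) ≠ 0 := by positivity
  have hP : ι (C ((2:ℚ) ^ t)) * eQ ⟨S, C (a0 ^ 2 * m')⟩ = - ι (C ((a0 : ℚ) ^ 2 * m)) * star (gy (bQ b0 b1 m)) - ι (toQ q) * ι (toQ (q2 a0 a1 a2)) := by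
    have key' := congrArg toQ key
    rw [map_mul, map_add, map_mul, map_mul, toQ_C, toQ_C, ← bQ_mul h.hm] at key'
    push_cast at key'
    have him : (eQ ⟨S, C (a0 ^ 2 * m')⟩).im = C ((a0 ^ 2 * m' : ℤ) : ℚ) := by rw [eQ_im]; exact toQ_C _
    have hre : (eQ ⟨S, C (a0 ^ 2 * m')⟩).re = toQ S := rfl
    generalize eQ ⟨S, C (a0 ^ 2 * m')⟩ = E at him hre ⊢
    ext1
    · rw [gy]; simp [-map_pow, -map_mul]; rw [C_mul, hre]; linear_combination - key'
    · rw [gy]; simp [-map_pow, -map_mul]; rw [him, ← C_mul, w4]; push_cast; congr 1; ring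
  refine ⟨⟨S, C (a0 ^ 2 * m')⟩, 1, q2 a0 a1 a2, 1, n, q2 a0 a1 a2, 1, 1, ⟨?_, hrm⟩, SS.one, hra0, ?_, ?_, ?_, one_ne_zero, one_ne_zero, ?_, ?_, hnl, hra, ?_⟩
  · show red S ≠ 0
    rw [hrS]; exact pow_ne_zero _ X_ne_zero
  · rw [map_one]; exact one_ne_zero
  · apply Iab_dvd
    · exact Dvd.intro_left _ rfl
    · have h1 := congrArg ι h.polyQ
      rw [map_mul, map_mul, map_pow] at h1
      have i1 : ι (C ((2:ℚ) ^ t)⁻¹) * ι (C ((2:ℚ) ^ t)) = 1 := by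
        rw [← map_mul, ← C_mul, inv_mul_cancel₀ h2t, C_1, map_one]
      have i2 : ι (C (m:ℚ)⁻¹) * ι (C (m:ℚ)) = 1 := by
        rw [← map_mul, ← C_mul, inv_mul_cancel₀ hmQ, C_1, map_one]
      have h3 := gy_star_mul (bQ b0 b1 m)
      have hP' := hP
      rw [C_mul (a := (a0:ℚ)^2), map_mul ι (C ((a0:ℚ)^2))] at hP'
      refine ⟨ι (C ((2:ℚ) ^ t)⁻¹) * (- ι (C ((a0:ℚ)^2)) * ι (C (m:ℚ)⁻¹) * ι (toQ (V4 v0 v1 v2 v3 v4)) - ι (toQ q) * gy (bQ b0 b1 m)), ?_⟩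
      linear_combination (- eQ ⟨S, C (a0 ^ 2 * m')⟩ * gy (bQ b0 b1 m)) * i1 + ι (C ((2:ℚ) ^ t)⁻¹) * gy (bQ b0 b1 m) * hP' - ι (C ((2:ℚ) ^ t)⁻¹) * ι (C ((a0:ℚ)^2)) * ι (C (m:ℚ)) * h3 + ι (C ((2:ℚ) ^ t)⁻¹) * ι (C ((a0:ℚ)^2)) * ι (C (m:ℚ)⁻¹) * h1 + ι (C ((2:ℚ) ^ t)⁻¹) * ι (C ((a0:ℚ)^2)) * ι (C (m:ℚ)) * ι (bQ b0 b1 m ^ 2 - fQ) * i2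
  · intro x hx; rw [map_one, map_one]; exact one_dvd _
  · rw [eQ_norm, QuadraticAlgebra.norm_def, C_1, one_mul, ← map_mul]
    congr 1
    simp only [zero_mul, add_zero]
    linear_combination q2 a0 a1 a2 * hN
  · rw [map_one, map_one, C_1, one_pow, one_mul, one_mul, one_mul]
  · rw [H.one, zero_sub]

end RP


namespace RP
open Polynomial NumberField
open QuadraticAlgebra (norm)

structure MQ (a b : ℚ[X]) : Prop where
  ne : a ≠ 0
  deg : a.natDegree ≤ 2
  dvd : a ∣ b ^ 2 - fQ

theorem fQ_irr : Irreducible fQ := by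
  have : fQ = C 15 * (X ^ 5 - C 3) := by
    rw [fQ_eq, mul_sub, ← C_mul]; norm_num
  rw [this, irreducible_isUnit_mul (isUnit_C.2 (by norm_num))]
  exact g_irred

theorem cop_f {a : ℚ[X]} (h0 : a ≠ 0) (h : a.natDegree ≤ 2) : IsCoprime fQ a := by
  rw [fQ_irr.coprime_iff_not_dvd]
  intro hd
  have := natDegree_le_of_dvd hd h0
  rw [fQ_deg] at this; omega

theorem MQ.cop {a b : ℚ[X]} (h : MQ a b) : IsCoprime b a := by
  obtain ⟨q, hq⟩ := h.dvd
  have h1 := cop_f h.ne h.deg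
  have h2 : IsCoprime (b ^ 2) a := by
    rw [show b ^ 2 = fQ + a * q by rw [← hq]; ring]
    exact h1.add_mul_left_left q
  exact (IsCoprime.pow_left_iff (by norm_num)).1 h2

theorem MQ.of_dvd {a b a' : ℚ[X]} (h : MQ a b) (hd : a' ∣ a) : MQ a' b :=
  ⟨fun h0 => h.ne (by rw [h0] at hd; exact zero_dvd_iff.1 hd), (natDegree_le_of_dvd hd h.ne).trans h.deg, hd.trans h.dvd⟩

theorem MQ.congr {a b b' : ℚ[X]} (h : MQ a b) (hd : a ∣ b - b') : MQ a b' := by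
  refine ⟨h.ne, h.deg, ?_⟩
  have := dvd_sub h.dvd (hd.mul_right (b + b'))
  rwa [show b ^ 2 - fQ - (b - b') * (b + b') = b' ^ 2 - fQ by ring] at this

theorem MQ.neg {a b : ℚ[X]} (h : MQ a b) : MQ a (-b) := ⟨h.ne, h.deg, by rw [neg_sq]; exact h.dvd⟩

theorem Iab_le_mul {a1 a2 b : ℚ[X]} (hc : IsCoprime b (a1 * a2)) (hd : a1 * a2 ∣ b ^ 2 - fQ) :
    Iab (a1 * a2) b ≤ Iab a1 b * Iab a2 b := by
  have hA : ι (a1 * a2) ∈ Iab a1 b * Iab a2 b := by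
    rw [map_mul]; exact Ideal.mul_mem_mul (mem_Iab_a _ _) (mem_Iab_a _ _)
  refine Iab_le hA ?_
  obtain ⟨s, t, hst⟩ := hc
  obtain ⟨q, hq⟩ := hd
  have h1 : gy b = - ι (C 2⁻¹ * s) * (gy b * gy b) - ι (C 2⁻¹ * s * q) * ι (a1 * a2) + ι t * gy b * ι (a1 * a2) := by
    have e1 := congrArg ι hst
    have e3 := congrArg ι hq
    have i2 : ι (C 2⁻¹) * ι (C 2) = 1 := by
      rw [← map_mul, ← C_mul, inv_mul_cancel₀ two_ne_zero, C_1, map_one]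
    rw [gy_sq]
    simp only [map_mul, map_add, map_one] at e1 e3 i2 ⊢
    linear_combination - gy b * e1 - ι (C 2⁻¹) * ι s * e3 - ι s * ι b * gy b * i2
  rw [h1]
  refine add_mem (sub_mem ?_ ?_) ?_
  · exact Ideal.mul_mem_left _ _ (Ideal.mul_mem_mul (mem_Iab_g _ _) (mem_Iab_g _ _))
  · exact Ideal.mul_mem_left _ _ hA
  · exact Ideal.mul_mem_left _ _ hA

theorem MQ.mem_cj_mul {a b : ℚ[X]} (h : MQ a b) : ι a ∈ Iab a b * Iab a (-b) := by
  obtain ⟨s, t, hst⟩ := h.cop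
  have h1 : ι a = - ι (C 2⁻¹ * s) * (gy b * ι a) + ι (C 2⁻¹ * s) * (ι a * gy (-b)) + ι t * (ι a * ι a) := by
    have e1 := congrArg ι hst
    have i2 : ι (C 2⁻¹) * ι (C 2) = 1 := by
      rw [← map_mul, ← C_mul, inv_mul_cancel₀ two_ne_zero, C_1, map_one]
    have e2 : gy (-b) = gy b + ι (C 2) * ι b := by
      rw [show (-b) = b + - (C 2 * b) by rw [show (C 2 : ℚ[X]) = 2 from rfl]; ring, gy_add, map_neg, map_mul]; ring
    rw [e2]
    simp only [map_mul, map_add, map_one] at e1 i2 ⊢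
    linear_combination - ι a * e1 - ι s * ι b * ι a * i2
  rw [h1]
  refine add_mem (add_mem ?_ ?_) ?_
  · exact Ideal.mul_mem_left _ _ (Ideal.mul_mem_mul (mem_Iab_g _ _) (mem_Iab_a _ _))
  · exact Ideal.mul_mem_left _ _ (Ideal.mul_mem_mul (mem_Iab_a _ _) (mem_Iab_g _ _))
  · exact Ideal.mul_mem_left _ _ (Ideal.mul_mem_mul (mem_Iab_a _ _) (mem_Iab_a _ _))

theorem MQ.cj_mul_le {a b : ℚ[X]} (h : MQ a b) : Iab a b * Iab a (-b) ≤ Ideal.span {ι a} := by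
  rw [Iab, Iab, Ideal.span_pair_mul_span_pair, Ideal.span_le]
  rintro x (rfl | rfl | rfl | rfl)
  · exact Ideal.mem_span_singleton.2 (dvd_mul_right _ _)
  · exact Ideal.mem_span_singleton.2 (dvd_mul_right _ _)
  · exact Ideal.mem_span_singleton.2 (dvd_mul_left _ _)
  · apply Ideal.mem_span_singleton.2
    have h2 := gy_star_mul b
    rw [gy_star] at h2
    rw [show gy b * gy (-b) = - ι (b ^ 2 - fQ) by linear_combination - h2]
    exact (dvd_neg).2 (map_dvd ι h.dvd)

/-! ### integral models -/

theorem toQ_prim {a : ℚ[X]} (ha : a ≠ 0) : ∃ (c : ℚ) (z : ℤ[X]), c ≠ 0 ∧ z.IsPrimitive ∧ toQ z = C c * a ∧ z.natDegree = a.natDegree := by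
  obtain ⟨n, hn, q, hq⟩ := int_mult a
  have hnQ : (n:ℚ) ≠ 0 := by exact_mod_cast hn
  have hq0 : q ≠ 0 := by
    rintro rfl
    rw [map_zero] at hq
    rcases mul_eq_zero.1 hq.symm with h | h
    · exact hnQ (C_eq_zero.1 h)
    · exact ha h
  have hc : (q.content : ℚ) ≠ 0 := by
    have : q.content ≠ 0 := by rwa [Ne, content_eq_zero_iff]
    exact_mod_cast this
  have h1 : toQ q = C (q.content : ℚ) * toQ q.primPart := by
    conv_lhs => rw [q.eq_C_content_mul_primPart]
    rw [map_mul, toQ_C]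
  refine ⟨(q.content : ℚ)⁻¹ * n, q.primPart, mul_ne_zero (inv_ne_zero hc) hnQ, q.isPrimitive_primPart, ?_, ?_⟩
  · rw [C_mul, mul_assoc, ← hq, h1, ← mul_assoc, ← C_mul, inv_mul_cancel₀ hc, C_1, one_mul]
  · rw [natDegree_primPart]
    have := congrArg natDegree hq
    rw [natDegree_C_mul hnQ] at this
    rw [← this, toQ, coe_mapRingHom, natDegree_map_eq_of_injective Int.cast_injective]

theorem prim_dvd {z q : ℤ[X]} (hz : z.IsPrimitive) (h : toQ z ∣ toQ q) : z ∣ q := by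
  exact (IsPrimitive.Int.dvd_iff_map_cast_dvd_map_cast z q hz).2 h

theorem q2_coeffs {z : ℤ[X]} (h : z.natDegree ≤ 2) : z = q2 (z.coeff 0) (z.coeff 1) (z.coeff 2) := by
  conv_lhs => rw [z.as_sum_range_C_mul_X_pow' (n := 3) (by omega)]
  simp [Finset.sum_range_succ, q2]; ring

theorem prim_coeffs {a0 a1 a2 : ℤ} (h : (q2 a0 a1 a2).IsPrimitive) (p : ℤ) (hp : Prime p) : ¬ (p ∣ a0 ∧ p ∣ a1 ∧ p ∣ a2) := by
  rintro ⟨⟨x, rfl⟩, ⟨y, rfl⟩, ⟨w, rfl⟩⟩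
  apply hp.not_isUnit
  apply h
  refine ⟨q2 x y w, ?_⟩
  simp only [q2, C_mul]; ring

theorem toMum {a b : ℚ[X]} (h : MQ a b) (hd : 1 ≤ a.natDegree) : ∃ (a0 a1 a2 b0 b1 m v0 v1 v2 v3 v4 : ℤ) (c : ℚ),
    Mum a0 a1 a2 b0 b1 m v0 v1 v2 v3 v4 ∧ c ≠ 0 ∧ toQ (q2 a0 a1 a2) = C c * a ∧ a ∣ b - bQ b0 b1 m := by
  obtain ⟨c, z, hc, hz, hza, hzd⟩ := toQ_prim h.ne
  have hzd2 : z.natDegree ≤ 2 := by rw [hzd]; exact h.deg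
  obtain ⟨n, hn, q, hq⟩ := int_mult (b % a)
  have hnQ : (n:ℚ) ≠ 0 := by exact_mod_cast hn
  have hqd : q.natDegree ≤ 1 := by
    have h1 : (toQ q).natDegree = q.natDegree := by
      rw [toQ, coe_mapRingHom, natDegree_map_eq_of_injective Int.cast_injective]
    rw [← h1, hq, natDegree_C_mul hnQ]
    have := natDegree_mod_lt b (q := a) (by omega)
    have := h.deg
    omega
  obtain ⟨w, hw⟩ : ∃ w, w = q + C n * X ^ 2 := ⟨_, rfl⟩
  have hq2 : q.coeff 2 = 0 := coeff_eq_zero_of_natDegree_lt (by omega)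
  have hwc : w.coeff 2 = n := by rw [hw]; simp [hq2]
  have hwd : w.natDegree ≤ 2 := by
    rw [hw]
    refine (natDegree_add_le _ _).trans (max_le (by omega) ((natDegree_C_mul_X_pow_le _ _)))
  have hw0 : w ≠ 0 := by rintro h0; rw [h0] at hwc; exact hn (by simpa using hwc.symm)
  obtain ⟨u, hu⟩ : ∃ u, u = w.primPart := ⟨_, rfl⟩
  have hup : u.IsPrimitive := hu ▸ w.isPrimitive_primPart
  have hud : u.natDegree ≤ 2 := by rw [hu, natDegree_primPart]; exact hwd
  have hwu : w = C w.content * u := by rw [hu]; exact w.eq_C_content_mul_primPart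
  have hwcn : w.content ≠ 0 := by rwa [Ne, content_eq_zero_iff]
  generalize w.content = k at *
  have hk2 : n = k * u.coeff 2 := by rw [← hwc, hwu, coeff_C_mul]
  have hqu : q = C k * q2 (u.coeff 0) (u.coeff 1) 0 := by
    have h1 : q = w - C n * X ^ 2 := by rw [hw]; ring
    have h2 := q2_coeffs hud
    rw [h1, hwu, hk2]
    simp only [q2, C_mul, C_0] at h2 ⊢
    linear_combination C k * h2
  have hm0 : u.coeff 2 ≠ 0 := by rintro h0; rw [h0, mul_zero] at hk2; exact hn hk2
  have hkQ : (k:ℚ) ≠ 0 := by exact_mod_cast hwcn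
  have hbmod : b % a = bQ (u.coeff 0) (u.coeff 1) (u.coeff 2) := by
    have hmQ : ((u.coeff 2 : ℤ):ℚ) ≠ 0 := by exact_mod_cast hm0
    have h1 : C (n:ℚ) ≠ 0 := by rwa [Ne, C_eq_zero]
    apply mul_left_cancel₀ h1
    rw [← hq, hqu, map_mul, toQ_C, ← bQ_mul hm0, hk2, ← mul_assoc, ← C_mul]; push_cast; rfl
  have hdb : a ∣ b - bQ (u.coeff 0) (u.coeff 1) (u.coeff 2) := by
    rw [← hbmod]
    exact ⟨b / a, by linear_combination - EuclideanDomain.div_add_mod b a⟩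
  have hup2 : (q2 (u.coeff 0) (u.coeff 1) (u.coeff 2)).IsPrimitive := by rw [← q2_coeffs hud]; exact hup
  clear hwu
  generalize u.coeff 0 = b0 at *
  generalize hb1 : u.coeff 1 = b1 at *
  generalize hmm : u.coeff 2 = m at *
  have hM := h.congr hdb
  obtain ⟨V, hV⟩ : z ∣ (q2 b0 b1 0) ^ 2 - C (m ^ 2) * fZ := by
    apply prim_dvd hz
    rw [hza, (isUnit_C.2 hc.isUnit).mul_left_dvd]
    have : toQ ((q2 b0 b1 0) ^ 2 - C (m ^ 2) * fZ) = C (m:ℚ) ^ 2 * ((bQ b0 b1 m) ^ 2 - fQ) := by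
      rw [map_sub, map_pow, map_mul, toQ_C, ← bQ_mul hm0, ← show fQ = toQ fZ from rfl]
      push_cast; rw [C_pow]; ring
    rw [this]
    exact hM.dvd.mul_left _
  have hVd : V.natDegree ≤ 4 := by
    by_cases hV0 : V = 0
    · rw [hV0]; simp
    have h1 : (z * V).natDegree ≤ 5 := by
      rw [← hV]; unfold q2 fZ; compute_degree
    rw [natDegree_mul hz.ne_zero hV0] at h1
    omega
  have hVV : V = V4 (V.coeff 0) (V.coeff 1) (V.coeff 2) (V.coeff 3) (V.coeff 4) := by
    conv_lhs => rw [V.as_sum_range_C_mul_X_pow' (n := 5) (by omega)]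
    simp [Finset.sum_range_succ, V4]; ring
  have hzz := q2_coeffs hzd2
  generalize z.coeff 0 = a0 at *
  generalize z.coeff 1 = a1 at *
  generalize z.coeff 2 = a2 at *
  generalize V.coeff 0 = v0 at *
  generalize V.coeff 1 = v1 at *
  generalize V.coeff 2 = v2 at *
  generalize V.coeff 3 = v3 at *
  generalize V.coeff 4 = v4 at *
  have hE : C (a2 * v4) * X ^ 6 + C (a1 * v4 + a2 * v3 + 15 * m ^ 2) * X ^ 5 + C (a0 * v4 + a1 * v3 + a2 * v2) * X ^ 4 + C (a0 * v3 + a1 * v2 + a2 * v1) * X ^ 3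
      + C (a0 * v2 + a1 * v1 + a2 * v0 - b1 ^ 2) * X ^ 2 + C (a0 * v1 + a1 * v0 - 2 * b0 * b1) * X + C (a0 * v0 - (b0 ^ 2 + 45 * m ^ 2)) = (0 : ℤ[X]) := by
    rw [hzz, hVV] at hV
    simp only [q2, V4, fZ, C_add, C_mul, C_sub, C_pow, C_0] at hV ⊢
    have two : (C 2 : ℤ[X]) = 2 := rfl
    linear_combination - hV - C b0 * C b1 * X * two
  have hcf : ∀ i, coeff (C (a2 * v4) * X ^ 6 + C (a1 * v4 + a2 * v3 + 15 * m ^ 2) * X ^ 5 + C (a0 * v4 + a1 * v3 + a2 * v2) * X ^ 4 + C (a0 * v3 + a1 * v2 + a2 * v1) * X ^ 3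
      + C (a0 * v2 + a1 * v1 + a2 * v0 - b1 ^ 2) * X ^ 2 + C (a0 * v1 + a1 * v0 - 2 * b0 * b1) * X + C (a0 * v0 - (b0 ^ 2 + 45 * m ^ 2))) i = 0 := by
    intro i; rw [hE, coeff_zero]
  simp only [coeff_add, coeff_C_mul, coeff_X_pow, coeff_X, coeff_C] at hcf
  have c0 := hcf 0
  have c1 := hcf 1
  have c2 := hcf 2
  have c3 := hcf 3
  have c4 := hcf 4
  have c5 := hcf 5
  have c6 := hcf 6
  norm_num at c0 c1 c2 c3 c4 c5
  simp only [show (6:ℕ) ≠ 5 by decide, show (6:ℕ) ≠ 4 by decide, show (6:ℕ) ≠ 3 by decide, show (6:ℕ) ≠ 2 by decide, show (1:ℕ) ≠ 6 by decide, show (6:ℕ) ≠ 0 by decide, if_true, if_false, mul_zero, add_zero, mul_one] at c6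
  refine ⟨a0, a1, a2, b0, b1, m, v0, v1, v2, v3, v4, c, ⟨hm0, prim_coeffs (hzz ▸ hz), prim_coeffs hup2, ?_, ?_, ?_, ?_, ?_, ?_, ?_⟩, hc, hzz ▸ hza, hdb⟩
  all_goals linarith

end RP


namespace RP
open Polynomial NumberField
open QuadraticAlgebra (norm)

theorem halve {a b : ℚ[X]} (h : MQ a b) (hd : 1 ≤ a.natDegree) {l : ℚ} (hl : l ≠ 0) {ξ : K} (hξ : (l:K) * aeval β a = ξ ^ 2) :
    ∃ (a' b' : ℚ[X]) (h1 : R) (l' : ℚ), MQ a' b' ∧ h1 ∈ Iab a b * (Iab a' b' * Iab a' b') ∧ h1 ≠ 0 ∧ l' ≠ 0 ∧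
      norm h1 = C l' * (a * (a' * a')) := by
  obtain ⟨d, hdd⟩ : ∃ d, d = a.natDegree := ⟨_, rfl⟩
  have hd2 : d ≤ 2 := hdd ▸ h.deg
  let φ : (degreeLT ℚ (2 + d) × ℚ × degreeLT ℚ 3) →ₗ[ℚ] AdjoinRoot a × K :=
    { toFun := fun x => (AdjoinRoot.mkₐ a ((x.1 : ℚ[X]) + x.2.1 • b), aeval β (x.1 : ℚ[X]) - ξ * aeval β (x.2.2 : ℚ[X]))
      map_add' := by
        intro x y
        ext1
        · show AdjoinRoot.mkₐ a (((x.1 : ℚ[X]) + (y.1 : ℚ[X])) + (x.2.1 + y.2.1) • b) = AdjoinRoot.mkₐ a ((x.1 : ℚ[X]) + x.2.1 • b) + AdjoinRoot.mkₐ a ((y.1 : ℚ[X]) + y.2.1 • b)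
          rw [← map_add]; congr 1; rw [add_smul]; ring
        · show aeval β ((x.1 : ℚ[X]) + (y.1 : ℚ[X])) - ξ * aeval β ((x.2.2 : ℚ[X]) + (y.2.2 : ℚ[X])) = (aeval β (x.1 : ℚ[X]) - ξ * aeval β (x.2.2 : ℚ[X])) + (aeval β (y.1 : ℚ[X]) - ξ * aeval β (y.2.2 : ℚ[X]))
          rw [map_add, map_add]; ring
      map_smul' := by
        intro c x
        ext1
        · show AdjoinRoot.mkₐ a (c • (x.1 : ℚ[X]) + (c • x.2.1) • b) = c • AdjoinRoot.mkₐ a ((x.1 : ℚ[X]) + x.2.1 • b)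
          rw [← map_smul]; congr 1; rw [smul_add, smul_assoc]
        · show aeval β (c • (x.1 : ℚ[X])) - ξ * aeval β (c • (x.2.2 : ℚ[X])) = c • (aeval β (x.1 : ℚ[X]) - ξ * aeval β (x.2.2 : ℚ[X]))
          rw [map_smul, map_smul, smul_sub, mul_smul_comm] }
  have fA : Module.finrank ℚ (AdjoinRoot a) = d := by
    rw [hdd, (AdjoinRoot.powerBasis h.ne).finrank, AdjoinRoot.powerBasis_dim]
  have : Module.Finite ℚ (AdjoinRoot a) := (AdjoinRoot.powerBasis h.ne).finite
  have fin (n : ℕ) : Module.Finite ℚ (degreeLT ℚ n) := Module.Finite.equiv (degreeLTEquiv ℚ n).symm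
  have fdl (n : ℕ) : Module.finrank ℚ (degreeLT ℚ n) = n := by
    rw [(degreeLTEquiv ℚ n).finrank_eq]; simp
  have hlt : Module.finrank ℚ (AdjoinRoot a × K) < Module.finrank ℚ (degreeLT ℚ (2 + d) × ℚ × degreeLT ℚ 3) := by
    rw [Module.finrank_prod, Module.finrank_prod, Module.finrank_prod, fA, finrankK, fdl, fdl, Module.finrank_self]; omega
  have hker := LinearMap.ker_ne_bot_of_finrank_lt (f := φ) hlt
  obtain ⟨⟨⟨A, hA⟩, B, ⟨a', ha'⟩⟩, hx, hx0⟩ := (Submodule.ne_bot_iff _).1 hker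
  rw [LinearMap.mem_ker] at hx
  have hx1 : AdjoinRoot.mk a (A + B • b) = 0 := congrArg Prod.fst hx
  have hx2 : aeval β A - ξ * aeval β a' = 0 := congrArg Prod.snd hx
  rw [AdjoinRoot.mk_eq_zero, smul_eq_C_mul] at hx1
  have hAd : A.natDegree ≤ 1 + d := by
    rw [mem_degreeLT] at hA
    by_cases h0 : A = 0
    · rw [h0]; simp
    rw [degree_eq_natDegree h0] at hA
    have : A.natDegree < 2 + d := by exact_mod_cast hA
    omega
  have had : a'.natDegree ≤ 2 := by
    rw [mem_degreeLT] at ha'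
    by_cases h0 : a' = 0
    · rw [h0]; simp
    rw [degree_eq_natDegree h0] at ha'
    have : a'.natDegree < 3 := by exact_mod_cast ha'
    omega
  have hE : A ^ 2 - C (B ^ 2) * fQ = C l * (a * (a' * a')) := by
    rw [← sub_eq_zero]
    have d1 : a ∣ A ^ 2 - C (B ^ 2) * fQ - C l * (a * (a' * a')) := by
      have e1 := hx1.mul_right (A - C B * b)
      have e2 := h.dvd.mul_left (C B ^ 2)
      have e3 : a ∣ C l * (a * (a' * a')) := (dvd_mul_right _ _).mul_left _
      have := dvd_sub (dvd_add e1 e2) e3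
      rw [C_pow]
      convert this using 2
      ring
    have d2 : (X ^ 5 - C 3 : ℚ[X]) ∣ A ^ 2 - C (B ^ 2) * fQ - C l * (a * (a' * a')) := by
      rw [← minpolyβ]
      apply minpoly.dvd
      have hf : aeval β fQ = 0 := by
        rw [fQ_eq]; simp [β5]; norm_num
      have hl' : aeval β (C l : ℚ[X]) = (l : K) := by rw [aeval_C]; rfl
      rw [map_sub, map_sub, map_pow, map_mul, hf, map_mul, map_mul, map_mul, hl']
      linear_combination (aeval β A + ξ * aeval β a') * hx2 - aeval β a' * aeval β a' * hξ
    have hcop : IsCoprime a (X ^ 5 - C 3 : ℚ[X]) := by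
      refine IsCoprime.of_isCoprime_of_dvd_right (cop_f h.ne h.deg).symm ⟨C 15, ?_⟩
      rw [fQ_eq, sub_mul, ← C_mul]; norm_num
    obtain ⟨q, hq⟩ := hcop.mul_dvd d1 d2
    by_contra hne
    have hdeg : (A ^ 2 - C (B ^ 2) * fQ - C l * (a * (a' * a'))).natDegree ≤ d + 4 := by
      refine (natDegree_sub_le _ _).trans (max_le ((natDegree_sub_le _ _).trans (max_le ?_ ?_)) ?_)
      · refine natDegree_pow_le.trans ?_; omega
      · refine (natDegree_C_mul_le _ _).trans ?_; rw [fQ_deg]; omega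
      · refine (natDegree_C_mul_le _ _).trans (natDegree_mul_le.trans ?_)
        have := natDegree_mul_le (p := a') (q := a')
        omega
    have := natDegree_le_of_dvd (hcop.mul_dvd d1 d2) hne
    have hg5 : (X ^ 5 - C 3 : ℚ[X]).natDegree = 5 := natDegree_X_pow_sub_C
    rw [natDegree_mul h.ne g_irred.ne_zero, hg5] at this
    omega
  have ha0 : a' ≠ 0 := by
    intro h0
    have : (⟨A, C B⟩ : R) = 0 := by
      apply norm_ne_zero fQ_odd
      rw [QuadraticAlgebra.norm_def]
      rw [h0, C_pow] at hE
      simp only [zero_mul, add_zero]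
      linear_combination hE
    apply hx0
    have e1 : A = 0 := congrArg QuadraticAlgebra.re this
    have e2 : C B = 0 := congrArg QuadraticAlgebra.im this
    rw [C_eq_zero] at e2
    subst e1 e2 h0
    rfl
  by_cases hB : B = 0
  · subst hB
    rw [zero_pow two_ne_zero, C_0, zero_mul, sub_zero] at hE
    obtain ⟨s, hs⟩ : a' ∣ A := by
      rw [← IsIntegrallyClosed.pow_dvd_pow_iff (n := 2) (two_ne_zero), hE]
      exact ⟨C l * a, by ring⟩
    have hsa : C l * a = s * s := by
      have h2 : a' * a' ≠ 0 := mul_ne_zero ha0 ha0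
      apply mul_left_cancel₀ h2
      rw [hs] at hE
      linear_combination - hE
    have hsd : s ∣ a := by
      have : s ∣ C l * a := ⟨s, hsa⟩
      rwa [(isUnit_C.2 hl.isUnit).dvd_mul_left] at this
    have hM := h.neg
    refine ⟨s, -b, ι a, l⁻¹, hM.of_dvd hsd, ?_, ?_, inv_ne_zero hl, ?_⟩
    · refine Ideal.mul_mono_right ?_ h.mem_cj_mul
      have hM' : MQ (s * s) (-b) := by
        rw [← hsa]
        exact ⟨mul_ne_zero (by rwa [Ne, C_eq_zero]) h.ne, by rw [natDegree_C_mul hl]; exact h.deg, by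
          rw [(isUnit_C.2 hl.isUnit).mul_left_dvd]; exact hM.dvd⟩
      rw [← Iab_scale (a := a) hl, hsa]
      exact Iab_le_mul hM'.cop hM'.dvd
    · intro h0; exact h.ne (ι_inj (h0.trans (map_zero ι).symm))
    · rw [QuadraticAlgebra.norm_algebraMap]
      have : C l⁻¹ * C l = (1 : ℚ[X]) := by rw [← C_mul, inv_mul_cancel₀ hl, C_1]
      linear_combination - a ^ 2 * this + C l⁻¹ * a * hsa
  · have hBB : C B⁻¹ * C B = (1 : ℚ[X]) := by rw [← C_mul, inv_mul_cancel₀ hB, C_1]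
    obtain ⟨b1, hb1⟩ : ∃ b1, b1 = - (C B⁻¹ * A) := ⟨_, rfl⟩
    have hN : b1 ^ 2 - fQ = C (B⁻¹ ^ 2 * l) * (a * (a' * a')) := by
      rw [hb1]
      simp only [C_mul, C_pow] at hE ⊢
      linear_combination C B⁻¹ ^ 2 * hE + fQ * (C B⁻¹ * C B + 1) * hBB
    have hc : a ∣ b - b1 := by
      have := hx1.mul_left (C B⁻¹)
      convert this using 1
      rw [hb1]
      linear_combination - b * hBB
    have hMa := h.congr hc
    have hMa' : MQ a' b1 := ⟨ha0, had, by rw [hN]; exact ⟨C (B⁻¹ ^ 2 * l) * (a * a'), by ring⟩⟩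
    have hl' : B⁻¹ ^ 2 * l ≠ 0 := mul_ne_zero (pow_ne_zero _ (inv_ne_zero hB)) hl
    refine ⟨a', b1, gy b1, B⁻¹ ^ 2 * l, hMa', ?_, gy_ne _, hl', ?_⟩
    · rw [Iab_congr hc]
      have c2 : IsCoprime b1 (a' * a') := hMa'.cop.mul_right hMa'.cop
      have c3 : IsCoprime b1 (a * (a' * a')) := hMa.cop.mul_right c2
      have d3 : a * (a' * a') ∣ b1 ^ 2 - fQ := ⟨_, by rw [hN, mul_comm]⟩
      exact (Iab_le_mul c3 d3).trans (Ideal.mul_mono_right (Iab_le_mul c2 ((dvd_mul_left _ _).trans d3))) (mem_Iab_g _ _)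
    · rw [gy_norm, hN]

theorem reduce {a b : ℚ[X]} (h : MQ a b) (hd : 1 ≤ a.natDegree) :
    ∃ (a' b' b3 : ℚ[X]) (h2 : R) (c : ℚ), MQ a' b' ∧ (b3 = C 60 ∨ b3 = - C 60) ∧
      h2 ∈ Iab a (-b) * (Iab a' b' * Iab (X - C 3) b3) ∧ h2 ≠ 0 ∧ c ≠ 0 ∧ norm h2 = C c * (a * a' * (X - C 3)) := by
  have hp : Prime (X - C 3 : ℚ[X]) := prime_X_sub_C 3
  have hf3 : (X - C 3 : ℚ[X]) ∣ fQ - C 60 ^ 2 := by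
    rw [dvd_iff_isRoot, IsRoot, fQ_eq]; simp; norm_num
  by_cases hpa : (X - C 3 : ℚ[X]) ∣ a
  · obtain ⟨a', ha'⟩ := hpa
    have hb : ∃ b3, (b3 = C 60 ∨ b3 = - C 60) ∧ (X - C 3 : ℚ[X]) ∣ b - b3 := by
      have h1 : (X - C 3 : ℚ[X]) ∣ (b - C 60) * (b + C 60) := by
        have := dvd_add ((Dvd.intro _ ha'.symm).trans h.dvd) hf3
        convert this using 1; ring
      rcases hp.dvd_or_dvd h1 with h1 | h1
      · exact ⟨_, Or.inl rfl, h1⟩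
      · exact ⟨_, Or.inr rfl, by rwa [sub_neg_eq_add]⟩
    obtain ⟨b3, hb3, hb3d⟩ := hb
    refine ⟨a', b, b3, ι a, 1, h.of_dvd (Dvd.intro_left _ ha'.symm), hb3, ?_, ?_, one_ne_zero, ?_⟩
    · have h1 := h.mem_cj_mul
      rw [mul_comm] at h1
      refine Ideal.mul_mono_right ?_ h1
      rw [← Iab_congr hb3d, mul_comm]
      have hc := h.cop
      have hdv := h.dvd
      rw [ha'] at hc hdv ⊢
      exact Iab_le_mul hc hdv
    · intro h0; exact h.ne (ι_inj (h0.trans (map_zero ι).symm))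
    · rw [QuadraticAlgebra.norm_algebraMap, C_1]; linear_combination a * ha'
  · have hcop : IsCoprime (X - C 3 : ℚ[X]) a := (hp.irreducible.coprime_iff_not_dvd).2 hpa
    obtain ⟨u, v, huv⟩ := hcop
    have hcop : IsCoprime (X - C 3 : ℚ[X]) a := ⟨u, v, huv⟩
    obtain ⟨b3, hb3⟩ : ∃ b3, b3 = b * u * (X - C 3) + C 60 * v * a := ⟨_, rfl⟩
    have e1 : a ∣ b - b3 := ⟨(b - C 60) * v, by rw [hb3]; linear_combination (- b) * huv⟩
    have e2 : (X - C 3 : ℚ[X]) ∣ b3 - C 60 := ⟨(b - C 60) * u, by rw [hb3]; linear_combination C 60 * huv⟩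
    have hM := h.congr e1
    have hMp : MQ (X - C 3) b3 := by
      have : MQ (X - C 3) (C 60) := ⟨hp.ne_zero, by rw [natDegree_X_sub_C]; norm_num, (dvd_sub_comm).1 hf3⟩
      exact this.congr ((dvd_sub_comm).1 e2)
    have hap : a * (X - C 3) ∣ b3 ^ 2 - fQ := hcop.symm.mul_dvd hM.dvd hMp.dvd
    have hdap : (a * (X - C 3)).natDegree = a.natDegree + 1 := by
      rw [natDegree_mul h.ne hp.ne_zero, natDegree_X_sub_C]
    have hap0 : a * (X - C 3) ≠ 0 := mul_ne_zero h.ne hp.ne_zero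
    by_cases hd1 : a.natDegree = 1
    · have hMM : MQ (a * (X - C 3)) b3 := ⟨hap0, by omega, hap⟩
      have hMn := hMM.neg
      refine ⟨a * (X - C 3), b3, - C 60, ι (a * (X - C 3)), 1, hMM, Or.inr rfl, ?_, ?_, one_ne_zero, ?_⟩
      · have h1 := Ideal.mul_mono_right (Iab_le_mul hMn.cop hMn.dvd) hMM.mem_cj_mul
        rw [Iab_congr (show a ∣ - b - -b3 by rw [show - b - -b3 = - (b - b3) by ring]; exact (dvd_neg).2 e1)]
        rw [← Iab_congr (show (X - C 3 : ℚ[X]) ∣ -b3 - - C 60 by rw [show - b3 - -C 60 = - (b3 - C 60) by ring]; exact (dvd_neg).2 e2)]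
        rwa [mul_left_comm] at h1
      · intro h0; exact hap0 (ι_inj (h0.trans (map_zero ι).symm))
      · rw [QuadraticAlgebra.norm_algebraMap, C_1]; ring
    · have hd2 : a.natDegree = 2 := by have := h.deg; omega
      obtain ⟨b4, hb4⟩ : ∃ b4, b4 = - (b3 % (a * (X - C 3))) := ⟨_, rfl⟩
      have e3 : a * (X - C 3) ∣ - b3 - b4 := ⟨- (b3 / (a * (X - C 3))), by
        rw [hb4]; linear_combination EuclideanDomain.div_add_mod b3 (a * (X - C 3))⟩
      have hb4d : b4.natDegree ≤ 2 := by
        rw [hb4, natDegree_neg]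
        have := natDegree_mod_lt b3 (q := a * (X - C 3)) (by omega)
        omega
      have e4 : a ∣ - b - b4 := by
        have := dvd_add ((dvd_neg).2 e1) ((dvd_mul_right _ _).trans e3)
        convert this using 1; ring
      have e5 : (X - C 3 : ℚ[X]) ∣ b4 - - C 60 := by
        have := dvd_add ((dvd_neg).2 e2) ((dvd_neg).2 ((dvd_mul_left _ _).trans e3))
        convert this using 1; ring
      have hMa4 := h.neg.congr e4
      have hMp4 : MQ (X - C 3) b4 := hMp.neg.congr ((dvd_mul_left _ _).trans e3)
      obtain ⟨V, hV⟩ : a * (X - C 3) ∣ b4 ^ 2 - fQ := hcop.symm.mul_dvd hMa4.dvd hMp4.dvd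
      have hdeg5 : (b4 ^ 2 - fQ).natDegree = 5 := by
        rw [natDegree_sub_eq_right_of_natDegree_lt, fQ_deg]
        rw [fQ_deg]
        refine lt_of_le_of_lt natDegree_pow_le ?_; omega
      have hV0 : V ≠ 0 := by
        rintro rfl
        rw [mul_zero] at hV; rw [hV] at hdeg5; simp at hdeg5
      have hMV : MQ V b4 := by
        refine ⟨hV0, ?_, Dvd.intro_left _ hV.symm⟩
        rw [hV, natDegree_mul hap0 hV0] at hdeg5
        omega
      refine ⟨V, b4, - C 60, gy b4, 1, hMV, Or.inr rfl, ?_, gy_ne _, one_ne_zero, ?_⟩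
      · rw [← Iab_congr e5, Iab_congr e4]
        have c2 : IsCoprime b4 (V * (X - C 3)) := hMV.cop.mul_right hMp4.cop
        have c3 : IsCoprime b4 (a * (V * (X - C 3))) := hMa4.cop.mul_right c2
        have d3 : a * (V * (X - C 3)) ∣ b4 ^ 2 - fQ := ⟨1, by rw [hV]; ring⟩
        exact (Iab_le_mul c3 d3).trans (Ideal.mul_mono_right (Iab_le_mul c2 ((dvd_mul_left _ _).trans d3))) (mem_Iab_g _ _)
      · rw [gy_norm, hV, C_1]; ring

end RP


namespace RP
open Polynomial NumberField
open QuadraticAlgebra (norm)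

def Wild (a : ℚ[X]) : Prop := ∃ (c : ℚ) (z : ℤ[X]), c ≠ 0 ∧ toQ z = C c * a ∧ red z = X + 1

theorem Xp1_deg : (X + 1 : (ZMod 2)[X]).natDegree = 1 := natDegree_X_add_C 1
theorem Xp1_ne : (X + 1 : (ZMod 2)[X]) ≠ 0 := X_add_C_ne_zero 1

theorem not_cube {G : R2} (h : norm G = (X + 1) ^ 3) : False := by
  rw [QuadraticAlgebra.norm_def] at h
  simp only [zero_mul, add_zero] at h
  have hf0 : f2 ≠ 0 := by intro h; have := f2_deg; rw [h] at this; simp at this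
  have h3 : ((X + 1 : (ZMod 2)[X]) ^ 3).natDegree = 3 := by rw [natDegree_pow, Xp1_deg]
  have hd := congrArg natDegree h
  rw [h3] at hd
  by_cases hB : G.im = 0
  · rw [hB, mul_zero, sub_zero] at hd
    by_cases hA : G.re = 0
    · rw [hA] at hd; simp at hd
    · rw [natDegree_mul hA hA] at hd; omega
  · have hle : (f2 * G.im * G.im).natDegree ≥ 5 := by
      rw [natDegree_mul (mul_ne_zero hf0 hB) hB, natDegree_mul hf0 hB, f2_deg]; omega
    by_cases hA : G.re = 0
    · rw [hA, mul_zero, zero_sub, natDegree_neg] at hd; omega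
    · have hne := deg_ne f2_odd hA hB
      rcases lt_or_gt_of_ne hne with h1 | h1
      · rw [natDegree_sub_eq_right_of_natDegree_lt h1] at hd; omega
      · rw [natDegree_sub_eq_left_of_natDegree_lt h1] at hd; omega

theorem toQ_D : toQ (X - C 3) = X - C 3 := by rw [map_sub, toQ_X, toQ_C]; norm_num
theorem red_D : red (X - C 3) = X + 1 := by
  rw [map_sub, red_C, show ((3:ℤ) : ZMod 2) = -1 from rfl, C_neg, C_1, sub_neg_eq_add]; simp [red]

theorem not_wild {a a' : ℚ[X]} {h2 : R} {c : ℚ} (hc : c ≠ 0) (h0 : h2 ≠ 0) (hN : norm h2 = C c * (a * a' * (X - C 3)))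
    (hw : Wild a) : ¬ Wild a' := by
  rintro ⟨c2, z2, hc2, e2, r2⟩
  obtain ⟨c1, z1, hc1, e1, r1⟩ := hw
  obtain ⟨k, P, hk, hP, eP⟩ := primitive h2 h0
  have hz : red (z1 * z2 * (X - C 3)) = (X + 1) ^ 3 := by
    rw [map_mul, map_mul, r1, r2, red_D]; ring
  have hz0 : red (z1 * z2 * (X - C 3)) ≠ 0 := by rw [hz]; exact pow_ne_zero _ Xp1_ne
  have hP0 : red (norm P) ≠ 0 := by
    rw [← rQ_norm]; intro h; exact hP (norm_ne_zero f2_odd h)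
  have hr : toQ (norm P) = C (k ^ 2 * c * c1⁻¹ * c2⁻¹) * toQ (z1 * z2 * (X - C 3)) := by
    rw [← eQ_norm, eP, map_mul, QuadraticAlgebra.norm_algebraMap, hN, map_mul toQ, map_mul toQ, e1, e2, toQ_D]
    have i1 : C c1⁻¹ * C c1 = (1 : ℚ[X]) := by rw [← C_mul, inv_mul_cancel₀ hc1, C_1]
    have i2 : C c2⁻¹ * C c2 = (1 : ℚ[X]) := by rw [← C_mul, inv_mul_cancel₀ hc2, C_1]
    simp only [C_mul, C_pow]
    linear_combination - C k ^ 2 * C c * a * a' * (X - C 3) * (i1 * (C c2⁻¹ * C c2) + i2)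
  obtain ⟨p, q, hp, hq, hpq⟩ := ratioP hP0 hz0 hr
  have := congrArg red hpq
  rw [map_mul, map_mul, red_odd hp, red_odd hq, one_mul, one_mul, hz, ← rQ_norm] at this
  exact not_cube this

variable {T : Type*} [AddCommGroup T] {ℓ : QA → T}

theorem aeval_q2 (a0 a1 a2 : ℤ) : aeval β (toQ (q2 a0 a1 a2)) = evz ![a0, a1, a2, 0, 0] := by
  have : (fun i => ((![a0, a1, a2, 0, 0] : Fin 5 → ℤ) i : ℚ)) = ![(a0:ℚ), a1, a2, 0, 0] := by
    ext i; fin_cases i <;> simp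
  rw [evz, this, ev_def]
  simp [q2, toQ]; ring

theorem red_q2 (a0 a1 a2 : ℤ) (h2 : 2 ∣ a2) (h1 : ¬ 2 ∣ a1) (h0 : ¬ 2 ∣ a0) : red (q2 a0 a1 a2) = X + 1 := by
  rw [q2, map_add, map_add, map_mul, map_mul, red_even h2, red_odd h1, red_odd h0]; simp [red]

theorem tame (H : Ell ℓ) {a b : ℚ[X]} (h : MQ a b) (hw : ¬ Wild a) (hd : 1 ≤ a.natDegree) :
    (∃ (l : ℚ) (ξ : K), l ≠ 0 ∧ (l:K) * aeval β a = ξ ^ 2) ∧ ∃ v, Good ℓ (Iab a b) a v := by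
  obtain ⟨a0, a1, a2, b0, b1, m, v0, v1, v2, v3, v4, c, hM, hc, ha, hb⟩ := toMum h hd
  have hIab : Iab (toQ (q2 a0 a1 a2)) (bQ b0 b1 m) = Iab a b := by
    rw [ha, Iab_scale hc, Iab_congr hb]
  have hci : C c⁻¹ * C c = (1 : ℚ[X]) := by rw [← C_mul, inv_mul_cancel₀ hc, C_1]
  have haa : C c⁻¹ * toQ (q2 a0 a1 a2) = a := by rw [ha, ← mul_assoc, hci, one_mul]
  have key : kap a0 a1 a2 ≠ 0 → (∃ ξ : K, (kap a0 a1 a2 : K) * evz ![a0, a1, a2, 0, 0] = ξ ^ 2) →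
      (∃ (l : ℚ) (ξ : K), l ≠ 0 ∧ (l:K) * aeval β a = ξ ^ 2) := by
    rintro hk ⟨ξ, hξ⟩
    refine ⟨kap a0 a1 a2 * c, ξ, mul_ne_zero (by exact_mod_cast hk) hc, ?_⟩
    rw [← hξ, ← aeval_q2, ha, map_mul, aeval_C]
    push_cast
    rw [mul_assoc]; rfl
  have key2 : ∀ v, Good ℓ (Iab (toQ (q2 a0 a1 a2)) (bQ b0 b1 m)) (toQ (q2 a0 a1 a2)) v → Good ℓ (Iab a b) a v := by
    intro v hv
    have := hv.scale (inv_ne_zero hc)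
    rwa [haa, hIab] at this
  rcases hM.types with ⟨t2, t1⟩ | ⟨t2, t1⟩ | ⟨t2, t1, t0⟩
  · obtain ⟨k1, k2⟩ := hM.g1 t2 t1
    exact ⟨key k1 k2, _, key2 _ (hM.good1 H t2 t1)⟩
  · obtain ⟨k1, k2⟩ := hM.g2 t2 t1
    obtain ⟨-, -, -, t, B0, B1, m', w1, w2, w3, w4, w5, w6, w7⟩ := hM.g2_arith t2 t1
    exact ⟨key k1 k2, _, key2 _ (hM.good2 H t2 t1 w1 w2 w3 w4 w6 w7)⟩
  · exact absurd ⟨c, _, hc, ha, red_q2 _ _ _ t2 t1 t0⟩ hw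

theorem good_const (H : Ell ℓ) {a b : ℚ[X]} (h : MQ a b) (hd : a.natDegree = 0) : Good ℓ (Iab a b) a 0 := by
  rw [eq_C_of_natDegree_eq_zero hd]
  have h0 : a.coeff 0 ≠ 0 := by
    intro h0; apply h.ne; rw [eq_C_of_natDegree_eq_zero hd, h0, C_0]
  have := (Good.top H).scale h0
  rw [mul_one] at this
  exact this.anti le_top

theorem tame_good (H : Ell ℓ) {a b : ℚ[X]} (h : MQ a b) (hw : ¬ Wild a) : ∃ v, Good ℓ (Iab a b) a v := by
  by_cases hd : 1 ≤ a.natDegree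
  · exact (tame H h hw hd).2
  · exact ⟨0, good_const H h (by omega)⟩

theorem X0Mum : Mum 9 (-6) 1 (-735) 405 8 60345 (-25920) (-5760) (-960) 0 := by
  refine ⟨by norm_num, ?_, ?_, by norm_num, by norm_num, by norm_num, by norm_num, by norm_num, by norm_num, by norm_num⟩
  · rintro p hp ⟨-, -, h⟩; exact hp.not_isUnit (isUnit_of_dvd_one h)
  · rintro p hp ⟨h1, h2, h3⟩
    apply hp.not_isUnit
    apply isUnit_of_dvd_one
    have := dvd_add (h1.mul_right (-1)) (h3.mul_right (-92))
    have e : (-735) * (-1) + 8 * (-92) = (-1 : ℤ) := by norm_num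
    rw [e] at this
    exact (dvd_neg).1 this

noncomputable def vX0 (ℓ : QA → T) : T := ℓ ⟨q2 (-735) 405 0, C 8⟩

theorem goodX0 (H : Ell ℓ) : Good ℓ (Iab (X - C 3) (C 60) * Iab (X - C 3) (C 60)) ((X - C 3) * (X - C 3)) (vX0 ℓ) := by
  have h := X0Mum.good1 H (by norm_num) (by norm_num)
  have e : toQ (q2 9 (-6) 1) = (X - C 3) * (X - C 3) := by
    simp [q2, toQ]
    have : (C 3 : ℚ[X]) = 3 := rfl
    rw [this]; ring
  rw [e] at h
  refine h.anti ?_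
  rw [Iab_congr (b' := bQ (-735) 405 8)]
  · exact Iab_mul_le _ _ _
  · rw [dvd_iff_isRoot, IsRoot, bQ]
    simp [q2, toQ]; norm_num

theorem goodX0' (H : Ell ℓ) {b3 : ℚ[X]} (hb : b3 = C 60 ∨ b3 = - C 60) : ∃ e : ℤ,
    Good ℓ (Iab (X - C 3) b3 * Iab (X - C 3) b3) ((X - C 3) * (X - C 3)) (e • vX0 ℓ) := by
  rcases hb with rfl | rfl
  · exact ⟨1, by rw [one_smul]; exact goodX0 H⟩
  · refine ⟨-1, ?_⟩
    rw [neg_one_smul, ← cj_Iab]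
    have := (goodX0 H).cj H
    rwa [cj, Ideal.map_mul] at this

theorem step (H : Ell ℓ) {a b : ℚ[X]} (h : MQ a b) (hw : ¬ Wild a) {v : T} (hv : Good ℓ (Iab a b) a v) :
    ∃ (a' b' : ℚ[X]) (v' : T) (e : ℤ), MQ a' b' ∧ ¬ Wild a' ∧ Good ℓ (Iab a' b') a' v' ∧ v = e • vX0 ℓ + (2:ℤ) • v' := by
  by_cases hd : 1 ≤ a.natDegree
  · obtain ⟨l, ξ, hl, hξ⟩ := (tame H h hw hd).1
    obtain ⟨a', b', h1, l', hM, hm, h10, hl', hN⟩ := halve h hd hl hξ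
    by_cases hw' : Wild a'
    · have hd' : 1 ≤ a'.natDegree := by
        obtain ⟨c, z, hc, hz, hr⟩ := hw'
        have h1 : z.natDegree = a'.natDegree := by
          have := congrArg natDegree hz
          rw [natDegree_C_mul hc] at this
          rw [← this]
          exact (natDegree_map_eq_of_injective Int.cast_injective z).symm
        have h2 : (red z).natDegree ≤ z.natDegree := natDegree_map_le
        rw [hr, Xp1_deg] at h2
        omega
      obtain ⟨a2, b2, b3, h2, c, hM2, hb3, hm2, h20, hc, hN2⟩ := reduce hM hd'
      have hw2 := not_wild hc h20 hN2 hw'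
      obtain ⟨v2, hv2⟩ := tame_good H hM2 hw2
      obtain ⟨e, he⟩ := goodX0' H hb3
      have hG := hv.mul H ((hv2.mul H hv2).mul H he)
      obtain ⟨J, hJ⟩ : ∃ J, J = Iab a b * (Iab a2 b2 * Iab a2 b2 * (Iab (X - C 3) b3 * Iab (X - C 3) b3)) := ⟨_, rfl⟩
      rw [← hJ] at hG
      have hmem : h1 * (h2 * h2) ∈ Ideal.span {ι a' * ι a'} * J := by
        have := Ideal.mul_mem_mul hm (Ideal.mul_mem_mul hm2 hm2)
        rw [← Ideal.span_singleton_mul_span_singleton, hJ]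
        refine Ideal.mul_mono_left (Ideal.mul_mono hM.cj_mul_le hM.cj_mul_le) ?_
        convert this using 1
        ring
      obtain ⟨y, hy, hyy⟩ := Ideal.mem_span_singleton_mul.1 hmem
      have hne : ι a' * ι a' ≠ 0 := by
        rw [← map_mul]
        intro h0; exact mul_ne_zero hM.ne hM.ne (ι_inj (h0.trans (map_zero ι).symm))
      have hy0 : y ≠ 0 := by
        rintro rfl
        rw [mul_zero] at hyy
        exact mul_ne_zero h10 (mul_ne_zero h20 h20) hyy.symm
      have hNy : norm y = C (l' * c ^ 2) * (a * (a2 * a2 * ((X - C 3) * (X - C 3)))) := by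
        have := congrArg QuadraticAlgebra.norm hyy
        rw [map_mul, map_mul, map_mul, map_mul, QuadraticAlgebra.norm_algebraMap, hN, hN2] at this
        have hne2 : a' ^ 2 * a' ^ 2 ≠ 0 := mul_ne_zero (pow_ne_zero _ hM.ne) (pow_ne_zero _ hM.ne)
        apply mul_left_cancel₀ hne2
        rw [this, C_mul, C_pow]; ring
      have hcl := hG.close H y hy hy0 _ hNy
      have hcj := hv2.cj H
      rw [cj_Iab] at hcj
      refine ⟨a2, -b2, -v2, -e, hM2.neg, hw2, hcj, ?_⟩
      rw [eq_neg_of_add_eq_zero_left hcl, two_smul, neg_smul]; abel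
    · obtain ⟨v', hv'⟩ := tame_good H hM hw'
      have hG := hv.mul H (hv'.mul H hv')
      have := hG.close H h1 hm h10 _ hN
      have hcj := hv'.cj H
      rw [cj_Iab] at hcj
      refine ⟨a', -b', -v', 0, hM.neg, hw', hcj, ?_⟩
      rw [zero_smul, zero_add, two_smul]
      rw [eq_neg_of_add_eq_zero_left this]; abel
  · refine ⟨a, b, 0, 0, h, hw, good_const H h (by omega), ?_⟩
    rw [smul_zero, zero_smul, add_zero]
    have hd : a.natDegree = 0 := by omega
    have h0 : a.coeff 0 ≠ 0 := by
      intro h0; apply h.ne; rw [eq_C_of_natDegree_eq_zero hd, h0, C_0]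
    refine hv.close H (ι a) (mem_Iab_a _ _) ?_ (a.coeff 0) ?_
    · intro h0; exact h.ne (ι_inj (h0.trans (map_zero ι).symm))
    · rw [QuadraticAlgebra.norm_algebraMap, ← eq_C_of_natDegree_eq_zero hd]; ring

theorem chain (H : Ell ℓ) (k : ℕ) : ∀ (a b : ℚ[X]) (v : T), MQ a b → ¬ Wild a → Good ℓ (Iab a b) a v →
    ∃ (n : ℤ) (t : T), v = n • vX0 ℓ + (2 ^ k : ℤ) • t := by
  induction k with
  | zero => intro a b v _ _ _; exact ⟨0, v, by simp⟩
  | succ k ih =>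
    intro a b v h hw hv
    obtain ⟨a', b', v', e, h', hw', hv', rfl⟩ := step H h hw hv
    obtain ⟨n, t, rfl⟩ := ih a' b' v' h' hw' hv'
    refine ⟨e + 2 * n, t, ?_⟩
    rw [smul_add, smul_smul, smul_smul, add_smul, pow_succ, mul_comm _ (2:ℤ)]; abel

end RP


namespace RP
open Polynomial NumberField
open QuadraticAlgebra (norm)

abbrev Sr (N : ℕ) := ZMod (2 ^ (3 * N))
abbrev La (N : ℕ) := HahnSeries ℤ (Sr N)
variable {N : ℕ}

noncomputable def xx : La N := HahnSeries.single (-1) 1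
noncomputable def ww : La N := HahnSeries.single 1 1
theorem xw : (xx : La N) * ww = 1 := by
  rw [xx, ww, HahnSeries.single_mul_single, mul_one, neg_add_cancel]; rfl

noncomputable def ps : PowerSeries (Sr N) →+* La N := HahnSeries.ofPowerSeries ℤ (Sr N)
theorem ps_X : ps (PowerSeries.X) = (ww : La N) := HahnSeries.ofPowerSeries_X

noncomputable def phi : ℤ[X] →+* La N := eval₂RingHom (Int.castRingHom (La N)) xx
theorem phi_X : phi X = (xx : La N) := by simp [phi]
theorem phi_C (m : ℤ) : phi (C m) = (m : La N) := by simp [phi]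

noncomputable def psi : ℤ[X] →+* PowerSeries (Sr N) :=
  (coeToPowerSeries.ringHom (R := Sr N)).comp (mapRingHom (Int.castRingHom (Sr N)))

theorem phi_rev (p : ℤ[X]) : (phi p : La N) = ps (psi p.reverse) * xx ^ p.natDegree := by
  letI : Invertible (xx : La N) := ⟨ww, by rw [mul_comm, xw], xw⟩
  have h := eval₂_reverse_mul_pow (Int.castRingHom (La N)) xx p
  rw [show (phi p : La N) = eval₂ (Int.castRingHom (La N)) xx p from rfl, ← h]
  congr 1
  have : (eval₂RingHom (Int.castRingHom (La N)) ww) = ps.comp psi := by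
    apply Polynomial.ringHom_ext'
    · exact Subsingleton.elim _ _
    · simp [psi, ps_X]
  exact congrArg (fun f => f p.reverse) (congrArg DFunLike.coe this)

theorem two_nil : (2 : Sr N) ^ (3 * N) = 0 := by
  have := ZMod.natCast_self (2 ^ (3 * N))
  push_cast at this
  exact this
theorem two_nilL : (2 : La N) ^ (3 * N) = 0 := by
  have := congrArg (HahnSeries.C (Γ := ℤ) (R := Sr N)) two_nil
  rw [map_pow, map_zero, map_ofNat] at this
  exact this

theorem odd_unit {k : ℤ} (h : ¬ 2 ∣ k) : IsUnit (k : Sr N) := by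
  have hc : IsCoprime k (2 ^ (3 * N)) := by
    apply IsCoprime.pow_right
    rw [isCoprime_comm, Int.prime_two.irreducible.coprime_iff_not_dvd]; exact h
  obtain ⟨a, b, hab⟩ := hc
  have := congrArg (Int.cast : ℤ → Sr N) hab
  push_cast at this
  rw [two_nil, mul_zero, add_zero, mul_comm] at this
  exact IsUnit.of_mul_eq_one _ this

theorem psi_unit {p : ℤ[X]} (h : ¬ 2 ∣ p.leadingCoeff) : IsUnit (psi p.reverse : PowerSeries (Sr N)) := by
  rw [PowerSeries.isUnit_iff_constantCoeff]
  have : PowerSeries.constantCoeff (psi p.reverse : PowerSeries (Sr N)) = (p.leadingCoeff : Sr N) := by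
    rw [← PowerSeries.coeff_zero_eq_constantCoeff_apply, psi, RingHom.comp_apply, coeToPowerSeries.ringHom_apply, coeff_coe,
      coe_mapRingHom, coeff_map, coeff_zero_reverse]; rfl
  rw [this]; exact odd_unit h

theorem xx_unit : IsUnit (xx : La N) := IsUnit.of_mul_eq_one _ xw

theorem phi_unit (n : ℕ) : ∀ p : ℤ[X], p.natDegree ≤ n → red p ≠ 0 → IsUnit (phi p : La N) := by
  induction n with
  | zero =>
    intro p hp h
    by_cases hl : 2 ∣ p.leadingCoeff
    · exfalso; apply h
      rw [eq_C_of_natDegree_le_zero hp]; apply red_even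
      rwa [leadingCoeff, Nat.le_zero.1 hp] at hl
    · rw [phi_rev]
      exact ((psi_unit hl).map ps).mul (xx_unit.pow _)
  | succ n ih =>
    intro p hp h
    by_cases hl : 2 ∣ p.leadingCoeff
    · have hp' := eraseLead_add_C_mul_X_pow p
      have hr : red p = red p.eraseLead := by
        conv_lhs => rw [← hp']
        rw [map_add, map_mul, red_even hl, zero_mul, add_zero]
      rw [hr] at h
      have := ih p.eraseLead ((eraseLead_natDegree_le p).trans (by omega)) h
      rw [← hp', map_add]
      refine IsNilpotent.isUnit_add_left_of_commute ?_ this (Commute.all _ _)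
      obtain ⟨k, hk⟩ := hl
      refine ⟨3 * N, ?_⟩
      rw [hk, map_mul, phi_C]
      push_cast
      rw [mul_pow, mul_pow, two_nilL]; ring
    · rw [phi_rev]
      exact ((psi_unit hl).map ps).mul (xx_unit.pow _)

noncomputable def zz (P : QA) : La N := phi P.im * Ring.inverse (phi P.re)

theorem zz_mul {P : QA} (h : red P.re ≠ 0) : (zz P : La N) * phi P.re = phi P.im := by
  rw [zz, mul_assoc, Ring.inverse_mul_cancel _ (phi_unit _ _ le_rfl h), mul_one]

theorem zz_eq {P : QA} (h : red P.re ≠ 0) {y : La N} (hy : y * phi P.re = phi P.im) : zz P = y := by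
  apply (phi_unit _ _ le_rfl h).mul_right_cancel
  rw [zz_mul h, hy]

theorem one_add_unit {P Q : QA} (hP : SS P) (hQ : SS Q) : IsUnit (1 + phi fZ * zz P * zz Q : La N) := by
  have h : phi (P * Q).re = (1 + phi fZ * zz P * zz Q : La N) * (phi P.re * phi Q.re) := by
    rw [QuadraticAlgebra.re_mul, map_add, map_mul, map_mul, map_mul, ← zz_mul hP.1, ← zz_mul hQ.1]; ring
  exact isUnit_of_mul_isUnit_left (h ▸ phi_unit _ _ le_rfl (hP.mul hQ).1)

theorem zz_prod {P Q : QA} (hP : SS P) (hQ : SS Q) : (zz (P * Q) : La N) * (1 + phi fZ * zz P * zz Q) = zz P + zz Q := by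
  have h : phi (P * Q).re = (1 + phi fZ * zz P * zz Q : La N) * (phi P.re * phi Q.re) := by
    rw [QuadraticAlgebra.re_mul, map_add, map_mul, map_mul, map_mul, ← zz_mul hP.1, ← zz_mul hQ.1]; ring
  have h2 : phi (P * Q).im = (zz P + zz Q : La N) * (phi P.re * phi Q.re) := by
    rw [QuadraticAlgebra.im_mul]
    simp only [map_add, map_mul, map_zero, zero_mul, add_zero]
    rw [← zz_mul hP.1, ← zz_mul hQ.1]; ring
  have h3 := zz_mul (N := N) (hP.mul hQ).1
  rw [h, h2] at h3
  apply ((phi_unit _ _ le_rfl hP.1).mul (phi_unit _ _ le_rfl hQ.1)).mul_right_cancel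
  rw [← h3]; ring

theorem SS.sq {P : QA} (h : SS P) (n : ℕ) : SS (P ^ (2 ^ n)) := by
  induction n with
  | zero => simpa using h
  | succ n ih => rw [pow_succ, pow_mul, pow_two]; exact ih.mul ih

/-- iterates of doubling -/
theorem zz_val {P : QA} (h : SS P) (n : ℕ) : ∃ s : La N, zz (P ^ (2 ^ n)) = 2 ^ n * (zz P + zz P ^ 3 * s) := by
  induction n with
  | zero => exact ⟨0, by simp⟩
  | succ n ih =>
    obtain ⟨s, hs⟩ := ih
    have h1 := zz_prod (N := N) (h.sq n) (h.sq n)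
    obtain ⟨i, hi⟩ := (one_add_unit (N := N) (h.sq n) (h.sq n)).exists_right_inv
    rw [pow_succ 2 n, pow_mul, pow_two (P ^ 2 ^ n)]
    have h2 : zz (P ^ 2 ^ n * P ^ 2 ^ n) = 2 * zz (P ^ 2 ^ n) * i := by
      linear_combination i * h1 - zz (P ^ 2 ^ n * P ^ 2 ^ n) * hi
    refine ⟨s - phi fZ * (2 ^ n * (1 + zz P ^ 2 * s)) ^ 2 * i * (1 + zz P ^ 2 * s), ?_⟩
    have hi' : i = 1 - phi fZ * zz (P ^ 2 ^ n) * zz (P ^ 2 ^ n) * i := by linear_combination hi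
    rw [h2]
    rw [hs] at hi' ⊢
    linear_combination 2 * (2 ^ n * (zz P + zz P ^ 3 * s)) * hi'

noncomputable def el (N : ℕ) (P : QA) : Sr N × Sr N := ((zz (P ^ 2 ^ N) : La N).coeff 1, (zz (P ^ 2 ^ N) : La N).coeff 2)

theorem Out.sq {P : QA} (h : Out P) (n : ℕ) : Out (P ^ (2 ^ n)) := by
  induction n with
  | zero => simpa using h
  | succ n ih =>
    rw [pow_succ, pow_mul, pow_two]
    exact ⟨by simp [ih.1, ih.2], by simp [ih.1, ih.2]⟩

noncomputable def phiS : (Sr N)[X] →+* La N := eval₂RingHom (HahnSeries.C) xx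

theorem phiS_map (p : ℤ[X]) : phiS (mapRingHom (Int.castRingHom (Sr N)) p) = phi p := by
  have : phiS.comp (mapRingHom (Int.castRingHom (Sr N))) = phi := by
    apply Polynomial.ringHom_ext'
    · exact Subsingleton.elim _ _
    · simp [phiS, phi]
  exact congrArg (fun f => f p) (congrArg DFunLike.coe this)

theorem phiS_coeff (p : (Sr N)[X]) (n : ℤ) (hn : 0 < n) : (phiS p).coeff n = 0 := by
  induction p using Polynomial.induction_on' with
  | add p q hp hq => rw [map_add, HahnSeries.coeff_add, hp, hq, add_zero]
  | monomial i a =>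
    rw [phiS, coe_eval₂RingHom, eval₂_monomial, xx, HahnSeries.single_pow, HahnSeries.C_apply, HahnSeries.single_mul_single]
    apply HahnSeries.coeff_single_of_ne
    simp; omega

theorem zz_out {P : QA} (h : Out P) : ∃ p : (Sr N)[X], zz P = phiS p := by
  obtain ⟨q, hq⟩ := red_zero (p := P.re - 1) (by rw [map_sub, h.1, map_one, sub_self])
  have hu : IsUnit (mapRingHom (Int.castRingHom (Sr N)) P.re) := by
    rw [show P.re = 1 + C 2 * q by rw [← hq]; ring, map_add, map_one]
    apply IsNilpotent.isUnit_one_add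
    refine ⟨3 * N, ?_⟩
    have : (mapRingHom (Int.castRingHom (Sr N))) (C 2) = C 2 := by rw [coe_mapRingHom, map_C]; simp only [eq_intCast, Int.cast_ofNat]
    rw [map_mul, mul_pow, this, ← C_pow, two_nil, C_0, zero_mul]
  obtain ⟨i, hi⟩ := hu.exists_right_inv
  refine ⟨mapRingHom (Int.castRingHom (Sr N)) P.im * i, ?_⟩
  apply zz_eq h.ss.1
  rw [← phiS_map, ← phiS_map, ← map_mul]
  congr 1
  linear_combination (mapRingHom (Int.castRingHom (Sr N)) P.im) * hi

theorem zz_inn0 {P : QA} (h : Inn P) : ∃ y : PowerSeries (Sr N), zz P = ww ^ 3 * ps y := by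
  obtain ⟨u, hu⟩ := (psi_unit (N := N) h.1).exists_right_inv
  have hu' := congrArg ps hu
  rw [map_mul, map_one] at hu'
  rcases h.2.2 with h0 | h0
  · exact ⟨0, zz_eq h.ss.1 (by rw [h0]; simp)⟩
  · obtain ⟨d, hd⟩ := Nat.exists_eq_add_of_le h0
    refine ⟨PowerSeries.X ^ d * u * psi P.im.reverse, zz_eq h.ss.1 ?_⟩
    rw [phi_rev P.re, phi_rev P.im, hd]
    simp only [map_mul, map_pow, ps_X]
    have hp (k : ℕ) : (xx : La N) ^ k * ww ^ k = 1 := by rw [← mul_pow, xw, one_pow]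
    rw [pow_add, pow_add]
    linear_combination xx ^ P.im.natDegree * ps (psi P.im.reverse) * (hu' * (xx ^ 3 * ww ^ 3 * (xx ^ d * ww ^ d)) + hp 3 * (xx ^ d * ww ^ d) + hp d)

theorem zz_inn {P : QA} (h : Inn P) (n : ℕ) : ∃ y : PowerSeries (Sr N), zz (P ^ (2 ^ n)) = ww ^ 3 * ps y := by
  induction n with
  | zero => rw [pow_zero, pow_one]; exact zz_inn0 h
  | succ n ih =>
    obtain ⟨y, hy⟩ := ih
    have h1 := zz_prod (N := N) (h.ss.sq n) (h.ss.sq n)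
    rw [pow_succ 2 n, pow_mul, pow_two (P ^ 2 ^ n)]
    have hu : IsUnit (1 + PowerSeries.X * ((15 - 45 * PowerSeries.X ^ 5) * y ^ 2) : PowerSeries (Sr N)) := by
      rw [PowerSeries.isUnit_iff_constantCoeff]; simp
    obtain ⟨i, hi⟩ := hu.exists_right_inv
    have hi' := congrArg ps hi
    simp only [map_mul, map_one, map_add, map_sub, map_pow, ps_X, map_ofNat] at hi'
    refine ⟨2 * y * i, ?_⟩
    have hf : phi fZ * (ww : La N) ^ 6 = (15 - 45 * ww ^ 5) * ww := by
      rw [fZ]; simp only [map_sub, map_mul, map_pow, phi_X, phi_C]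
      push_cast
      have hp : (xx : La N) ^ 5 * ww ^ 5 = 1 := by rw [← mul_pow, xw, one_pow]
      linear_combination 15 * ww * hp
    rw [hy] at h1
    simp only [map_mul, map_ofNat]
    linear_combination ps i * h1 - zz (P ^ 2 ^ n * P ^ 2 ^ n) * (hi' + ps i * ps y ^ 2 * hf)

theorem ps_coeff (y : PowerSeries (Sr N)) (n : ℤ) (hn : n < 0) : (ps y).coeff n = 0 := by
  rw [ps, HahnSeries.ofPowerSeries_apply]
  apply HahnSeries.embDomain_of_notMem_range
  rintro ⟨k, hk⟩
  simp at hk; omega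

theorem ww_mul_coeff (k : ℕ) (x : La N) (n : ℤ) : (ww ^ k * x).coeff n = x.coeff (n - k) := by
  rw [ww, HahnSeries.single_pow, HahnSeries.coeff_single_mul]; simp

theorem zz_nil {P : QA} (h : SS P) : ∃ y : La N, zz (P ^ 2 ^ N) = 2 ^ N * y := by
  obtain ⟨s, hs⟩ := zz_val (N := N) h N
  exact ⟨_, hs⟩

theorem elEll (N : ℕ) : Ell (el N) := by
  refine ⟨?_, ?_, ?_, ?_⟩
  · intro P Q hP hQ
    have key : (zz ((P * Q) ^ 2 ^ N) : La N) = zz (P ^ 2 ^ N) + zz (Q ^ 2 ^ N) := by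
      rw [mul_pow]
      apply (one_add_unit (N := N) (hP.sq N) (hQ.sq N)).mul_right_cancel
      rw [zz_prod (hP.sq N) (hQ.sq N)]
      obtain ⟨y, hy⟩ := zz_nil (N := N) hP
      obtain ⟨y', hy'⟩ := zz_nil (N := N) hQ
      rw [hy, hy']
      have h2 : (2 : La N) ^ N * 2 ^ N * 2 ^ N = 0 := by
        rw [← pow_add, ← pow_add, ← two_nilL]; congr 1; omega
      linear_combination - (y + y') * phi fZ * y * y' * h2
    rw [el, key]; rfl
  · intro p hp
    have : (zz (ιZ p ^ 2 ^ N) : La N) = 0 := by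
      rw [← map_pow, zz, QuadraticAlgebra.algebraMap_im, map_zero, zero_mul]
    rw [el, this]; rfl
  · intro P hP
    obtain ⟨y, hy⟩ := zz_inn (N := N) hP N
    rw [el, hy, ww_mul_coeff, ww_mul_coeff, ps_coeff _ _ (by norm_num), ps_coeff _ _ (by norm_num)]; rfl
  · intro P hP
    obtain ⟨y, hy⟩ := zz_out (N := N) (hP.sq N)
    rw [el, hy, phiS_coeff _ _ (by norm_num), phiS_coeff _ _ (by norm_num)]; rfl

end RP


namespace RP
open Polynomial NumberField
open QuadraticAlgebra (norm)
variable {N : ℕ}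

theorem int_mul_coeff (k : ℤ) (x : La N) (n : ℤ) : ((k : La N) * x).coeff n = k * x.coeff n := by
  rw [← zsmul_eq_mul, HahnSeries.coeff_smul, zsmul_eq_mul]

theorem el_val {P : QA} (h : SS P) (m : ℤ) (g : La N) (hz : (zz P : La N) = (m : La N) * g) : ∃ c1 c2 : ℤ,
    el N P = (2 ^ N * (m * g.coeff 1 + m ^ 3 * c1), 2 ^ N * (m * g.coeff 2 + m ^ 3 * c2)) := by
  obtain ⟨s, hs⟩ := zz_val (N := N) h N
  have e : zz (P ^ 2 ^ N) = ((2 ^ N : ℤ) : La N) * ((m : La N) * g + ((m ^ 3 : ℤ) : La N) * (g ^ 3 * s)) := by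
    rw [hs, hz]; push_cast; ring
  obtain ⟨c1, h1⟩ := ZMod.intCast_surjective ((g ^ 3 * s).coeff 1)
  obtain ⟨c2, h2⟩ := ZMod.intCast_surjective ((g ^ 3 * s).coeff 2)
  refine ⟨c1, c2, ?_⟩
  rw [el, e, int_mul_coeff, HahnSeries.coeff_add, int_mul_coeff, int_mul_coeff, int_mul_coeff, HahnSeries.coeff_add, int_mul_coeff,
    int_mul_coeff, h1, h2]
  push_cast; rfl

theorem dvd_of_S {k : ℤ} (h : (k : Sr N) = 0) : (2:ℤ) ^ (3 * N) ∣ k := by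
  have := (ZMod.intCast_zmod_eq_zero_iff_dvd k (2 ^ (3 * N))).1 h
  exact_mod_cast this

theorem q2_coeff0 (a b c : ℤ) : (q2 a b c).coeff 0 = a := by
  simp only [q2, coeff_add, coeff_C_mul, coeff_X_pow, coeff_X, coeff_C]; norm_num
theorem q2_coeff1 (a b c : ℤ) : (q2 a b c).coeff 1 = b := by
  simp only [q2, coeff_add, coeff_C_mul, coeff_X_pow, coeff_X, coeff_C]; norm_num
theorem q2_coeff2 (a b c : ℤ) : (q2 a b c).coeff 2 = c := by
  simp only [q2, coeff_add, coeff_C_mul, coeff_X_pow, coeff_X, coeff_C]; norm_num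

theorem SS_line {b0 b1 m : ℤ} (hb : ¬ 2 ∣ b1) (hm : 2 ∣ m) : SS ⟨q2 b0 b1 0, C m⟩ := by
  refine ⟨?_, red_even hm⟩
  show red (q2 b0 b1 0) ≠ 0
  intro h
  have := congrArg (fun p => coeff p 1) h
  simp only [red_coeff, coeff_zero] at this
  have e : (q2 b0 b1 0).coeff 1 = b1 := q2_coeff1 _ _ _
  rw [e] at this
  exact hb ((ZMod.intCast_zmod_eq_zero_iff_dvd _ 2).1 this)

theorem val1 {b0 b1 m : ℤ} (hb : ¬ 2 ∣ b1) (hm : 2 ∣ m) : ∃ U W s r : ℤ,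
    el N ⟨q2 b0 b1 0, C m⟩ = (((2 ^ N * (m * U) : ℤ) : Sr N), ((2 ^ N * (m * W) : ℤ) : Sr N)) ∧
    2 ^ (3 * N) ∣ b1 * U - 1 - m ^ 2 * s ∧ 2 ^ (3 * N) ∣ b1 ^ 2 * W + b0 - m ^ 2 * r := by
  have hS := SS_line (b0 := b0) hb hm
  have hu : IsUnit (PowerSeries.C (b1 : Sr N) + PowerSeries.C (b0 : Sr N) * PowerSeries.X : PowerSeries (Sr N)) := by
    rw [PowerSeries.isUnit_iff_constantCoeff]; simpa using odd_unit hb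
  obtain ⟨i, hi⟩ := hu.exists_right_inv
  have psC (k : ℤ) : ps (PowerSeries.C (k : Sr N)) = (k : La N) := by rw [map_intCast, map_intCast]
  have hi' := congrArg ps hi
  rw [map_mul, map_add, map_mul, psC, psC, ps_X, map_one] at hi'
  have hz : zz ⟨q2 b0 b1 0, C m⟩ = (m : La N) * (ww ^ 1 * ps i) := by
    apply zz_eq hS.1
    show (m : La N) * (ww ^ 1 * ps i) * phi (q2 b0 b1 0) = phi (C m)
    rw [q2]
    simp only [map_add, map_mul, map_pow, phi_C, phi_X]
    push_cast
    linear_combination (m : La N) * hi' + (m : La N) * ps i * (b1 : La N) * xw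
  obtain ⟨c1, c2, hc⟩ := el_val hS m _ hz
  rw [ww_mul_coeff, ww_mul_coeff] at hc
  have k0 : (ps i).coeff (1 - ((1:ℕ):ℤ)) = PowerSeries.coeff 0 i := HahnSeries.ofPowerSeries_apply_coeff i 0
  have k1 : (ps i).coeff (2 - ((1:ℕ):ℤ)) = PowerSeries.coeff 1 i := HahnSeries.ofPowerSeries_apply_coeff i 1
  rw [k0, k1] at hc
  obtain ⟨i0, h0⟩ := ZMod.intCast_surjective (PowerSeries.coeff 0 i)
  obtain ⟨i1, h1⟩ := ZMod.intCast_surjective (PowerSeries.coeff 1 i)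
  rw [← h0, ← h1] at hc
  have e0 : (b1 : Sr N) * i0 = 1 := by
    have := congrArg (PowerSeries.coeff 0) hi
    rw [h0]
    simpa [PowerSeries.coeff_zero_eq_constantCoeff_apply] using this
  have e1 : (b1 : Sr N) * i1 + b0 * i0 = 0 := by
    have := congrArg (PowerSeries.coeff 1) hi
    rw [add_mul, mul_assoc, map_add, PowerSeries.coeff_C_mul, PowerSeries.coeff_C_mul,
      show (1:ℕ) = 0 + 1 from rfl, PowerSeries.coeff_succ_X_mul, ← h0, zero_add, ← h1] at this
    rw [this, PowerSeries.coeff_one]; simp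
  refine ⟨i0 + m ^ 2 * c1, i1 + m ^ 2 * c2, b1 * c1, b1 ^ 2 * c2, ?_, dvd_of_S ?_, dvd_of_S ?_⟩
  · rw [hc]; push_cast; congr 1 <;> ring
  · push_cast; linear_combination e0
  · push_cast; linear_combination (b1 : Sr N) * e1 - b0 * e0

theorem SS_G2 {B1 m : ℤ} (hb : ¬ 2 ∣ B1) (hm : 2 ∣ m) : SS ⟨C B1 * X ^ 2 + C 0 * X ^ 3, C m⟩ := by
  refine ⟨?_, red_even hm⟩
  show red (C B1 * X ^ 2 + C 0 * X ^ 3) ≠ 0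
  rw [map_add, map_mul, map_mul, red_odd hb, C_0, map_zero, zero_mul, add_zero, one_mul, map_pow, red_X]
  exact pow_ne_zero _ X_ne_zero

theorem val2 {B1 m : ℤ} (hb : ¬ 2 ∣ B1) (hm : 2 ∣ m) : ∃ U W s : ℤ,
    el N ⟨C B1 * X ^ 2 + C 0 * X ^ 3, C m⟩ = (((2 ^ N * (m ^ 3 * U) : ℤ) : Sr N), ((2 ^ N * (m * W) : ℤ) : Sr N)) ∧
    2 ^ (3 * N) ∣ B1 * W - 1 - m ^ 2 * s := by
  have hS := SS_G2 hb hm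
  obtain ⟨i, hi⟩ := (odd_unit (N := N) hb).exists_right_inv
  obtain ⟨i, rfl⟩ := ZMod.intCast_surjective i
  have hi' : (B1 : La N) * (i : La N) = 1 := by
    have := congrArg (HahnSeries.C (Γ := ℤ) (R := Sr N)) hi
    rwa [map_mul, map_intCast, map_intCast, map_one] at this
  have hz : zz ⟨C B1 * X ^ 2 + C 0 * X ^ 3, C m⟩ = (m : La N) * (ww ^ 2 * ((i : La N) * 1)) := by
    apply zz_eq hS.1
    show (m : La N) * (ww ^ 2 * ((i : La N) * 1)) * phi (C B1 * X ^ 2 + C 0 * X ^ 3) = phi (C m)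
    simp only [map_add, map_mul, map_pow, phi_C, phi_X]
    push_cast
    linear_combination (m : La N) * hi' + (m : La N) * (i : La N) * (B1 : La N) * (xx * ww + 1) * xw
  obtain ⟨c1, c2, hc⟩ := el_val hS m _ hz
  rw [ww_mul_coeff, ww_mul_coeff, int_mul_coeff, int_mul_coeff, HahnSeries.coeff_one, HahnSeries.coeff_one] at hc
  refine ⟨c1, i + m ^ 2 * c2, B1 * c2, ?_, dvd_of_S ?_⟩
  · rw [hc]; push_cast; norm_num; ring
  · push_cast; linear_combination hi

variable {a0 a1 a2 b0 b1 m v0 v1 v2 v3 v4 : ℤ}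

theorem Mum.ne (h : Mum a0 a1 a2 b0 b1 m v0 v1 v2 v3 v4) : red (q2 a0 a1 a2) ≠ 0 := by
  intro h0
  have hc (i : ℕ) := congrArg (fun p => coeff p i) h0
  have t0 := hc 0
  have t1 := hc 1
  have t2 := hc 2
  simp only [red_coeff, coeff_zero] at t0 t1 t2
  have e0 : (q2 a0 a1 a2).coeff 0 = a0 := q2_coeff0 _ _ _
  have e1 : (q2 a0 a1 a2).coeff 1 = a1 := q2_coeff1 _ _ _
  have e2 : (q2 a0 a1 a2).coeff 2 = a2 := q2_coeff2 _ _ _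
  rw [e0] at t0; rw [e1] at t1; rw [e2] at t2
  exact h.ha 2 Int.prime_two ⟨(ZMod.intCast_zmod_eq_zero_iff_dvd _ 2).1 t0, (ZMod.intCast_zmod_eq_zero_iff_dvd _ 2).1 t1,
    (ZMod.intCast_zmod_eq_zero_iff_dvd _ 2).1 t2⟩

theorem Mum.red_eq (h : Mum a0 a1 a2 b0 b1 m v0 v1 v2 v3 v4) {c : ℚ} {z : ℤ[X]} (hz : toQ z = C c * toQ (q2 a0 a1 a2))
    (hr : red z ≠ 0) : red (q2 a0 a1 a2) = red z := by
  obtain ⟨p, q, hp, hq, e⟩ := ratioP hr h.ne hz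
  have := congrArg red e
  rw [map_mul, map_mul, red_odd hp, red_odd hq, one_mul, one_mul] at this
  exact this.symm

theorem Mum.not_wild (h : Mum a0 a1 a2 b0 b1 m v0 v1 v2 v3 v4) (hh : ¬ 2 ∣ a2 ∨ 2 ∣ a1) : ¬ Wild (toQ (q2 a0 a1 a2)) := by
  rintro ⟨c, z, hc, hz, hr⟩
  have := h.red_eq hz (by rw [hr]; exact Xp1_ne)
  rw [hr] at this
  have t1 := congrArg (fun p => coeff p 1) this
  have t2 := congrArg (fun p => coeff p 2) this
  simp only [red_coeff] at t1 t2
  have e1 : (q2 a0 a1 a2).coeff 1 = a1 := q2_coeff1 _ _ _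
  have e2 : (q2 a0 a1 a2).coeff 2 = a2 := q2_coeff2 _ _ _
  rw [e1] at t1
  rw [e2] at t2
  simp [coeff_X, coeff_one] at t1 t2
  rcases hh with hh | hh
  · exact hh ((ZMod.intCast_zmod_eq_zero_iff_dvd _ 2).1 t2)
  · rw [(ZMod.intCast_zmod_eq_zero_iff_dvd _ 2).2 hh] at t1
    exact zero_ne_one t1

theorem Mum.mq (h : Mum a0 a1 a2 b0 b1 m v0 v1 v2 v3 v4) : MQ (toQ (q2 a0 a1 a2)) (bQ b0 b1 m) := by
  refine ⟨?_, ?_, ?_⟩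
  · intro h0
    apply h.ne
    rw [toQ_inj (h0.trans (map_zero _).symm), map_zero]
  · exact natDegree_map_le.trans natDegree_quadratic_le
  · have hm : (m:ℚ) ≠ 0 := by exact_mod_cast h.hm
    have := Dvd.intro _ h.polyQ
    rwa [← C_pow, (isUnit_C.2 (pow_ne_zero 2 hm).isUnit).dvd_mul_left] at this

theorem Mum.chain (h : Mum a0 a1 a2 b0 b1 m v0 v1 v2 v3 v4) (hh : ¬ 2 ∣ a2 ∨ 2 ∣ a1) {v : Sr N × Sr N}
    (hv : Good (el N) (Iab (toQ (q2 a0 a1 a2)) (bQ b0 b1 m)) (toQ (q2 a0 a1 a2)) v) : ∃ n : ℤ, v = n • vX0 (el N) := by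
  obtain ⟨n, t, ht⟩ := RP.chain (elEll N) (3 * N) _ _ v h.mq (h.not_wild hh) hv
  refine ⟨n, ?_⟩
  rw [ht]
  have : (2 ^ (3 * N) : ℤ) • t = 0 := by
    ext
    · rw [Prod.smul_fst, zsmul_eq_mul]; push_cast; rw [two_nil, zero_mul]; rfl
    · rw [Prod.smul_snd, zsmul_eq_mul]; push_cast; rw [two_nil, zero_mul]; rfl
  rw [this, add_zero]

theorem cancel_N {x y : ℤ} (h : ((2 ^ N * x : ℤ) : Sr N) = ((2 ^ N * y : ℤ) : Sr N)) : (2:ℤ) ^ (2 * N) ∣ x - y := by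
  have h1 : (2:ℤ) ^ (3 * N) ∣ 2 ^ N * (x - y) := by
    apply dvd_of_S
    rw [mul_sub, Int.cast_sub, h, sub_self]
  rw [show 3 * N = N + 2 * N by ring, pow_add] at h1
  exact (mul_dvd_mul_iff_left (by positivity)).1 h1

theorem vX0_val (N : ℕ) : ∃ U W s r : ℤ, vX0 (el N) = (((2 ^ N * (8 * U) : ℤ) : Sr N), ((2 ^ N * (8 * W) : ℤ) : Sr N)) ∧
    2 ^ (3 * N) ∣ 405 * U - 1 - 64 * s ∧ 2 ^ (3 * N) ∣ 405 ^ 2 * W - 735 - 64 * r := by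
  obtain ⟨U, W, s, r, h1, h2, h3⟩ := val1 (N := N) (b0 := -735) (b1 := 405) (m := 8) (by norm_num) (by norm_num)
  exact ⟨U, W, s, r, h1, h2, h3⟩

theorem two_part (m : ℤ) (h : m ≠ 0) : ∃ (e : ℕ) (m' : ℤ), m = 2 ^ e * m' ∧ ¬ 2 ∣ m' := by
  have : FiniteMultiplicity (2:ℤ) m := Int.finiteMultiplicity_iff.2 ⟨by norm_num, h⟩
  obtain ⟨c, h1, h2⟩ := this.exists_eq_pow_mul_and_not_dvd
  exact ⟨_, c, h1, h2⟩

theorem cop_pow {m' : ℤ} (h : ¬ 2 ∣ m') (k : ℕ) : IsCoprime ((2:ℤ) ^ k) m' := by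
  apply IsCoprime.pow_left
  rw [Int.prime_two.irreducible.coprime_iff_not_dvd]; exact h

theorem Mum.G1 (h : Mum a0 a1 a2 b0 b1 m v0 v1 v2 v3 v4) (ha2 : ¬ 2 ∣ a2) (hm2 : 2 ∣ m) :
    8 ∣ m ∧ 64 ∣ 49 * b1 + 27 * b0 ∧ ¬ 2 ∣ b1 := by
  obtain ⟨-, -, -, -, hb1, -⟩ := h.g1_arith ha2 hm2
  obtain ⟨e, m', he, hm'⟩ := two_part m h.hm
  obtain ⟨N, hN⟩ : ∃ N, N = e + 6 := ⟨_, rfl⟩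
  obtain ⟨n, hn⟩ := h.chain (N := N) (Or.inl ha2) (h.good1 (elEll N) ha2 hm2)
  obtain ⟨U, W, s, r, k1, k2, k3⟩ := val1 (N := N) (b0 := b0) hb1 hm2
  obtain ⟨U0, W0, s0, r0, l1, l2, l3⟩ := vX0_val N
  rw [k1, l1] at hn
  have g1 : (2:ℤ) ^ (2 * N) ∣ m * U - 8 * (n * U0) := by
    apply cancel_N
    have := congrArg Prod.fst hn
    rw [Prod.smul_fst, zsmul_eq_mul] at this
    simp only at this
    rw [this]; push_cast; ring
  have g2 : (2:ℤ) ^ (2 * N) ∣ m * W - 8 * (n * W0) := by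
    apply cancel_N
    have := congrArg Prod.snd hn
    rw [Prod.smul_snd, zsmul_eq_mul] at this
    simp only at this
    rw [this]; push_cast; ring
  have p64 : (64:ℤ) ∣ 2 ^ (3 * N) := by
    rw [show (64:ℤ) = 2 ^ 6 by norm_num]; exact pow_dvd_pow _ (by omega)
  have p8 : (8:ℤ) ∣ 2 ^ (2 * N) := by
    rw [show (8:ℤ) = 2 ^ 3 by norm_num]; exact pow_dvd_pow _ (by omega)
  have hU : ¬ 2 ∣ U := by
    intro h2
    have t1 : (2:ℤ) ∣ b1 * U - 1 - m ^ 2 * s := (Dvd.dvd.trans (by norm_num) p64).trans k2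
    have t2 : (2:ℤ) ∣ b1 * U := h2.mul_left _
    have t3 : (2:ℤ) ∣ m ^ 2 * s := (hm2.pow two_ne_zero).mul_right _
    omega
  have h8 : 8 ∣ m := by
    have t1 : (8:ℤ) ∣ m * U := by
      have t := p8.trans g1
      have := dvd_add t (dvd_mul_right 8 (n * U0))
      rwa [sub_add_cancel] at this
    have := cop_pow hU 3
    norm_num at this
    exact this.dvd_of_dvd_mul_right t1
  refine ⟨h8, ?_, hb1⟩
  have hx : (64:ℤ) ∣ U * W0 - W * U0 := by
    have t := dvd_sub (g1.mul_right W0) (g2.mul_right U0)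
    rw [show (m * U - 8 * (n * U0)) * W0 - (m * W - 8 * (n * W0)) * U0 = m * (U * W0 - W * U0) by ring, he, mul_assoc] at t
    have t2 := (pow_dvd_pow (2:ℤ) (show e + 6 ≤ 2 * N by omega)).trans t
    rw [pow_add] at t2
    have t3 := (mul_dvd_mul_iff_left (by positivity)).1 t2
    have t4 := (cop_pow hm' 6).dvd_of_dvd_mul_left t3
    norm_num at t4; exact t4
  have hmm : (64:ℤ) ∣ m ^ 2 := by
    obtain ⟨k, rfl⟩ := h8; exact ⟨k ^ 2, by ring⟩
  have zc {x : ℤ} (hx : (64:ℤ) ∣ x) : (x : ZMod 64) = 0 := (ZMod.intCast_zmod_eq_zero_iff_dvd x 64).2 hx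
  have z1 := zc (p64.trans k2)
  have z2 := zc (p64.trans k3)
  have z3 := zc (p64.trans l2)
  have z4 := zc (p64.trans l3)
  have z5 := zc hx
  have z6 := zc hmm
  have z7 : (64 : ZMod 64) = 0 := rfl
  push_cast at z1 z2 z3 z4 z5 z6
  apply (ZMod.intCast_zmod_eq_zero_iff_dvd _ 64).1
  push_cast
  have i15 : (15 : ZMod 64) * 47 = 1 := rfl
  rw [z6] at z1 z2
  rw [z7] at z3 z4
  have a1 : (b1 : ZMod 64) * U = 1 := by linear_combination z1
  have a2 : (b1 : ZMod 64) ^ 2 * W = - b0 := by linear_combination z2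
  have a3 : (405 : ZMod 64) * U0 = 1 := by linear_combination z3
  have a4 : (405 : ZMod 64) ^ 2 * W0 = 735 := by linear_combination z4
  have fin : (b1 : ZMod 64) * 735 + b0 * 405 = 0 := by
    linear_combination (b1 : ZMod 64) ^ 2 * 405 ^ 2 * z5 - b1 * 405 ^ 2 * W0 * a1 - b1 * a4 + 405 ^ 2 * U0 * a2 - b0 * 405 * a3
  linear_combination 47 * fin - (49 * (b1 : ZMod 64) + 27 * b0) * i15

theorem Mum.G2 (h : Mum a0 a1 0 b0 b1 m v0 v1 v2 v3 v4) (ha1 : 2 ∣ a1) : False := by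
  obtain ⟨ha0, -, -, t, B0, B1, m', w1, w2, w3, w4, w5, w6, w7⟩ := h.g2_arith (dvd_zero 2) ha1
  have hB0 : B0 = 0 := by
    have : (2:ℤ) ^ t * B0 = 0 := by rw [← w7]; ring
    simpa using this
  obtain ⟨μ, hμ⟩ : ∃ μ, μ = a0 ^ 2 * m' := ⟨_, rfl⟩
  have hμ2 : 2 ∣ μ := by rw [hμ]; exact w3.mul_left _
  have hμ0 : μ ≠ 0 := by rw [hμ]; refine mul_ne_zero (pow_ne_zero _ ?_) w5; rintro rfl; exact ha0 (dvd_zero 2)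
  obtain ⟨e, m1, he, hm1⟩ := two_part μ hμ0
  obtain ⟨N, hN⟩ : ∃ N, N = e + 6 := ⟨_, rfl⟩
  obtain ⟨n, hn⟩ := h.chain (N := N) (Or.inr ha1) (h.good2 (elEll N) (dvd_zero 2) ha1 w1 w2 w3 w4 w6 w7)
  rw [hB0, ← hμ] at hn
  obtain ⟨U, W, s, k1, k2⟩ := val2 (N := N) w2 hμ2
  obtain ⟨U0, W0, s0, r0, l1, l2, l3⟩ := vX0_val N
  rw [k1, l1] at hn
  have g1 : (2:ℤ) ^ (2 * N) ∣ - (μ ^ 3 * U) - 8 * (n * U0) := by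
    apply cancel_N
    have := congrArg Prod.fst hn
    rw [Prod.smul_fst, Prod.fst_neg, zsmul_eq_mul] at this
    simp only at this
    rw [mul_neg, Int.cast_neg, this]; push_cast; ring
  have g2 : (2:ℤ) ^ (2 * N) ∣ - (μ * W) - 8 * (n * W0) := by
    apply cancel_N
    have := congrArg Prod.snd hn
    rw [Prod.smul_snd, Prod.snd_neg, zsmul_eq_mul] at this
    simp only at this
    rw [mul_neg, Int.cast_neg, this]; push_cast; ring
  have p64 : (64:ℤ) ∣ 2 ^ (3 * N) := by
    rw [show (64:ℤ) = 2 ^ 6 by norm_num]; exact pow_dvd_pow _ (by omega)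
  have hW : ¬ 2 ∣ W := by
    intro h2
    have t1 : (2:ℤ) ∣ B1 * W - 1 - μ ^ 2 * s := (Dvd.dvd.trans (by norm_num) p64).trans k2
    have t2 : (2:ℤ) ∣ B1 * W := h2.mul_left _
    have t3 : (2:ℤ) ∣ μ ^ 2 * s := (hμ2.pow two_ne_zero).mul_right _
    omega
  have hU0 : ¬ 2 ∣ U0 := by
    intro h2
    have t1 := p64.trans l2
    omega
  have pe : (2:ℤ) ^ (e + 1) ∣ 2 ^ (2 * N) := pow_dvd_pow _ (by omega)
  -- μ^3 divisible by 2^(e+1)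
  have hμ3 : (2:ℤ) ^ (e + 1) ∣ μ ^ 3 * U := by
    have : (2:ℤ) ^ e ∣ μ := ⟨_, he⟩
    obtain ⟨k, hk⟩ := hμ2
    obtain ⟨j, hj⟩ := this
    refine ⟨k * j * μ * U, ?_⟩
    rw [pow_succ (2:ℤ) e]
    calc μ ^ 3 * U = μ * μ * μ * U := by ring
      _ = (2 ^ e * j) * (2 * k) * μ * U := by rw [← hj, ← hk]
      _ = _ := by ring
  have q1 : (2:ℤ) ^ (e + 1) ∣ 8 * n := by
    have t := dvd_add (pe.trans g1) hμ3
    rw [show - (μ ^ 3 * U) - 8 * (n * U0) + μ ^ 3 * U = - ((8 * n) * U0) by ring, dvd_neg] at t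
    exact (cop_pow hU0 _).dvd_of_dvd_mul_right t
  have q2 : (2:ℤ) ^ (e + 1) ∣ μ * W := by
    have t := dvd_add (pe.trans g2) (q1.mul_right W0)
    rw [show - (μ * W) - 8 * (n * W0) + 8 * n * W0 = - (μ * W) by ring, dvd_neg] at t
    exact t
  have q3 := (cop_pow hW _).dvd_of_dvd_mul_right q2
  rw [he, pow_succ] at q3
  exact hm1 ((mul_dvd_mul_iff_left (by positivity)).1 q3)

end RP


namespace RP
open Polynomial NumberField

theorem bQ_eval {b0 b1 m : ℤ} (hm : m ≠ 0) (t : ℚ) : m * (bQ b0 b1 m).eval t = b1 * t + b0 := by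
  have := congrArg (eval t) (bQ_mul (b0 := b0) (b1 := b1) hm)
  rw [eval_mul, eval_C] at this
  rw [this, q2]
  simp only [map_add, map_mul, map_pow, toQ_C, toQ_X, eval_add, eval_mul, eval_pow, eval_C, eval_X]
  push_cast; ring

theorem odd_x {x y : ℚ} (h : y ^ 2 = 15 * x ^ 5 - 45) : ∃ p q : ℤ, ¬ 2 ∣ p ∧ ¬ 2 ∣ q ∧ x * q = p := by
  have hmq : MQ (X - C x) (C y) := by
    refine ⟨X_sub_C_ne_zero x, by rw [natDegree_X_sub_C]; norm_num, ?_⟩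
    rw [dvd_iff_isRoot, fQ_eq, IsRoot]
    simp only [eval_sub, eval_mul, eval_pow, eval_C, eval_X]
    rw [h]; ring
  obtain ⟨a0, a1, a2, b0, b1, m, v0, v1, v2, v3, v4, c, hM, hc, hz, -⟩ := toMum hmq (by rw [natDegree_X_sub_C])
  have ha2 : a2 = 0 := by
    have := congrArg (fun p => coeff p 2) hz
    simp only [toQ_coeff, coeff_C_mul, q2_coeff2, coeff_sub, coeff_X, coeff_C] at this
    norm_num at this
    exact this
  have h1 : (a1 : ℚ) = c := by
    have := congrArg (fun p => coeff p 1) hz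
    simp only [toQ_coeff, coeff_C_mul, q2_coeff1, coeff_sub, coeff_X, coeff_C] at this
    norm_num at this
    exact this
  have h0 : (a0 : ℚ) = - (c * x) := by
    have := congrArg (fun p => coeff p 0) hz
    simp only [toQ_coeff, coeff_C_mul, q2_coeff0, coeff_sub, coeff_X, coeff_C] at this
    norm_num at this
    exact this
  subst ha2
  rcases hM.types with h | h | h
  · exact (h.1 (dvd_zero 2)).elim
  · exact (hM.G2 h.2).elim
  · refine ⟨-a0, a1, by rw [dvd_neg]; exact h.2.2, h.2.1, ?_⟩
    push_cast; rw [h0, h1]; ring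

theorem line_x {x y : ℚ} (h : y ^ 2 = 15 * x ^ 5 - 45) (hx : x ≠ 3) {p q : ℤ} (hp : ¬ 2 ∣ p) (hq : ¬ 2 ∣ q) (hpq : x * q = p)
    (ε : ℤ) (hε : ε ^ 2 = 1) : ∃ n β : ℤ, ¬ 2 ∣ n ∧ ¬ 2 ∣ β ∧ (y - 60 * ε) * (8 * n) = β * (x - 3) := by
  have hd : x - 3 ≠ 0 := sub_ne_zero.2 hx
  have hε' : (ε : ℚ) ^ 2 = 1 := by exact_mod_cast hε
  obtain ⟨s, hs⟩ : ∃ s, s = (y - 60 * ε) / (x - 3) := ⟨_, rfl⟩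
  have hs' : s * (x - 3) = y - 60 * ε := by rw [hs]; field_simp
  have hnd : ((X - C x) * (X - C 3) : ℚ[X]).natDegree = 2 := by
    rw [natDegree_mul (X_sub_C_ne_zero _) (X_sub_C_ne_zero _), natDegree_X_sub_C, natDegree_X_sub_C]
  have hmq : MQ ((X - C x) * (X - C 3)) (C s * (X - C 3) + C (60 * (ε:ℚ))) := by
    refine ⟨mul_ne_zero (X_sub_C_ne_zero _) (X_sub_C_ne_zero _), hnd.le, ?_⟩
    apply IsCoprime.mul_dvd
    · exact isCoprime_X_sub_C_of_isUnit_sub hd.isUnit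
    · rw [dvd_iff_isRoot, fQ_eq, IsRoot]
      simp only [eval_sub, eval_add, eval_mul, eval_pow, eval_C, eval_X]
      rw [hs']; linear_combination h
    · rw [dvd_iff_isRoot, fQ_eq, IsRoot]
      simp only [eval_sub, eval_add, eval_mul, eval_pow, eval_C, eval_X]
      linear_combination 3600 * hε'
  obtain ⟨a0, a1, a2, b0, b1, m, v0, v1, v2, v3, v4, c, hM, hc, hz, hb⟩ := toMum hmq (by rw [hnd]; norm_num)
  have e1 : (60 * (ε:ℚ)) * m = b1 * 3 + b0 := by
    rw [← bQ_eval hM.hm]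
    have := dvd_iff_isRoot.1 ((dvd_mul_left _ _).trans hb)
    rw [IsRoot] at this
    simp only [eval_sub, eval_add, eval_mul, eval_C, eval_X] at this
    linear_combination (m : ℚ) * this
  have e2 : y * m = b1 * x + b0 := by
    rw [← bQ_eval hM.hm]
    have := dvd_iff_isRoot.1 ((dvd_mul_right _ _).trans hb)
    rw [IsRoot] at this
    simp only [eval_sub, eval_add, eval_mul, eval_C, eval_X] at this
    linear_combination (m : ℚ) * this - m * hs'
  have ha2 : ¬ 2 ∣ a2 := by
    have hr : red ((C q * X - C p) * (X - C 3)) = (X + 1) * (X + 1) := by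
      rw [map_mul, red_D, map_sub, map_mul, red_odd hq, red_odd hp, red_X, one_mul, CharTwo.sub_eq_add]
    have hq' : toQ ((C q * X - C p) * (X - C 3)) = C ((q:ℚ) * c⁻¹) * toQ (q2 a0 a1 a2) := by
      rw [hz, map_mul, toQ_D, map_sub, map_mul, toQ_C, toQ_C, toQ_X, ← hpq, ← mul_assoc, ← C_mul, mul_assoc (q:ℚ), inv_mul_cancel₀ hc,
        C_mul, C_mul, C_1]
      ring
    have := hM.red_eq hq' (by rw [hr]; exact mul_ne_zero Xp1_ne Xp1_ne)
    rw [hr] at this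
    have t := congrArg (fun p => coeff p 2) this
    simp only [red_coeff, q2_coeff2] at t
    intro h2
    rw [(ZMod.intCast_zmod_eq_zero_iff_dvd _ 2).2 h2] at t
    rw [show ((X + 1) * (X + 1) : (ZMod 2)[X]) = X ^ 2 + C 2 * X + C 1 by rw [C_1, show (C 2 : (ZMod 2)[X]) = 2 from rfl]; ring] at t
    simp only [coeff_add, coeff_C_mul, coeff_X_pow, coeff_X, coeff_C] at t
    norm_num at t
  have hm2 : 2 ∣ m := by
    rcases hM.types with h | h | h
    · exact h.2
    · exact (ha2 h.1).elim
    · exact (ha2 h.1).elim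
  obtain ⟨⟨k, rfl⟩, h64, hb1⟩ := hM.G1 ha2 hm2
  refine ⟨k, b1, ?_, hb1, ?_⟩
  · have e1' : 60 * ε * (8 * k) = b1 * 3 + b0 := by exact_mod_cast e1
    intro hk
    obtain ⟨j, rfl⟩ := hk
    have : b0 = 960 * (ε * j) - 3 * b1 := by linear_combination -e1'
    omega
  · push_cast at e1 e2
    linear_combination e2 - e1

theorem x_eq {x y : ℚ} (h : y ^ 2 = 15 * x ^ 5 - 45) : x = 3 := by
  by_contra hx
  obtain ⟨p, q, hp, hq, hpq⟩ := odd_x h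
  obtain ⟨n, β, hn, hβ, e⟩ := line_x h hx hp hq hpq 1 (by norm_num)
  obtain ⟨n', β', hn', hβ', e'⟩ := line_x h hx hp hq hpq (-1) (by norm_num)
  have hd : x - 3 ≠ 0 := sub_ne_zero.2 hx
  push_cast at e e'
  have k1 : 960 * (n * n' : ℚ) = (x - 3) * (β' * n - β * n') := by linear_combination (n:ℚ) * e' - n' * e
  have k2 : 960 * (n * n' : ℚ) * (x ^ 4 + 3 * x ^ 3 + 9 * x ^ 2 + 27 * x + 81) = β * β' * (x - 3) := by
    apply mul_right_cancel₀ hd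
    linear_combination ((y + 60) * (8 * n')) * e + β * (x - 3) * e' - 64 * n * n' * h
  have k3 : (β' * n - β * n' : ℚ) * (x ^ 4 + 3 * x ^ 3 + 9 * x ^ 2 + 27 * x + 81) = β * β' := by
    apply mul_right_cancel₀ hd
    linear_combination k2 - (x ^ 4 + 3 * x ^ 3 + 9 * x ^ 2 + 27 * x + 81) * k1
  have k4 : (β' * n - β * n') * (p ^ 4 + 3 * p ^ 3 * q + 9 * p ^ 2 * q ^ 2 + 27 * p * q ^ 3 + 81 * q ^ 4) = β * β' * q ^ 4 := by
    have : ((β' * n - β * n') * (p ^ 4 + 3 * p ^ 3 * q + 9 * p ^ 2 * q ^ 2 + 27 * p * q ^ 3 + 81 * q ^ 4) : ℚ) = β * β' * q ^ 4 := by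
      rw [← hpq]; linear_combination (q:ℚ) ^ 4 * k3
    exact_mod_cast this
  have o {z : ℤ} (hz : ¬ 2 ∣ z) : Odd z := by rwa [← Int.not_even_iff_odd, even_iff_two_dvd]
  have o1 : Even ((β' * n - β * n') * (p ^ 4 + 3 * p ^ 3 * q + 9 * p ^ 2 * q ^ 2 + 27 * p * q ^ 3 + 81 * q ^ 4)) :=
    (((o hβ').mul (o hn)).sub_odd ((o hβ).mul (o hn'))).mul_right _
  rw [k4, ← Int.not_odd_iff_even] at o1
  exact o1 (((o hβ).mul (o hβ')).mul (o hq).pow)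

end RP

theorem rational_points_case1 (X Y : ℚ) :
    Y ^ 2 = 5 * X ^ 5 - 5 * 3 ^ 6 ↔ (X, Y) = (9, 540) ∨ (X, Y) = (9, -540) := by
  constructor
  · intro h
    have hx : X / 3 = 3 := RP.x_eq (x := X / 3) (y := Y / 9) (by linear_combination h / 81)
    have hX : X = 9 := by linarith
    subst hX
    have : (Y - 540) * (Y + 540) = 0 := by linear_combination h
    rcases mul_eq_zero.1 this with h | h
    · left; rw [sub_eq_zero.1 h]
    · right; rw [eq_neg_of_add_eq_zero_left h]
  · rintro (h | h) <;> (rw [Prod.mk.injEq] at h; obtain ⟨rfl, rfl⟩ := h; norm_num)
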